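/- Let V ⊆ ℂ^n be an irreducible variety of dimension d and let S be a finite set of points inside V(ℝ). Then there is a constant C(n) such that for every integer M ≥ 1 there exists a polynomial g ∈ ℝ[x_1,…,x_n] \ I(V) of degree at most C(n)·M such that each connected component of ℝ^n \ Z(g) contains at most C(n)·|S|/(M^{n−i_V(M)}·Δ_{i_V(M)}(V)) elements of S. -/

import Mathlib

open MvPolynomial Set

noncomputable section

namespace Paper

variable (n : ℕ)

/-- The zero locus in `ℂⁿ` of a set of polynomials. -/
def zeroLocus (I : Set (MvPolynomial (Fin n) ℂ)) : Set (Fin n → ℂ) :=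
  {x | ∀ f ∈ I, eval x f = 0}

/-- A subset of `ℂⁿ` is algebraic if it is the zero locus of a set of polynomials. -/
def IsAlgebraicSet (V : Set (Fin n → ℂ)) : Prop :=
  ∃ I : Set (MvPolynomial (Fin n) ℂ), V = zeroLocus n I

/-- An irreducible (affine) variety in `ℂⁿ`: a nonempty algebraic set that is not covered
by two algebraic sets unless it is contained in one of them. -/
def IsIrredVariety (V : Set (Fin n → ℂ)) : Prop :=
  IsAlgebraicSet n V ∧ V.Nonempty ∧
    ∀ V₁ V₂ : Set (Fin n → ℂ), IsAlgebraicSet n V₁ → IsAlgebraicSet n V₂ →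
      V ⊆ V₁ ∪ V₂ → V ⊆ V₁ ∨ V ⊆ V₂

/-- There is a strictly increasing chain of `d + 1` irreducible varieties inside `V`. -/
def HasChain (V : Set (Fin n → ℂ)) (d : ℕ) : Prop :=
  ∃ W : Fin (d + 1) → Set (Fin n → ℂ),
    (∀ i, IsIrredVariety n (W i)) ∧ (∀ i j : Fin (d + 1), i < j → W i ⊂ W j) ∧
      W (Fin.last d) ⊆ V

/-- The (Krull) dimension of a subset of `ℂⁿ`, as the length of the longest chain of
irreducible subvarieties. -/
def dim (V : Set (Fin n → ℂ)) : ℕ := sSup {d | HasChain n V d}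

/-- `W` is an irreducible component of `X`: an irreducible subvariety that is maximal among
irreducible subvarieties of `X`. -/
def IsIrredComponent (W X : Set (Fin n → ℂ)) : Prop :=
  IsIrredVariety n W ∧ W ⊆ X ∧
    ∀ W', IsIrredVariety n W' → W ⊆ W' → W' ⊆ X → W' = W

/-- The degree of an irreducible variety `V ⊆ ℂⁿ` of dimension `d` (i.e. the degree of its
projective closure): the largest finite number of points in which an affine-linear subspace of
dimension `n - d` meets `V`. -/
def degree (V : Set (Fin n → ℂ)) : ℕ :=
  sSup { m | ∃ L : AffineSubspace ℂ (Fin n → ℂ),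
    Module.finrank ℂ L.direction = n - dim n V ∧ (V ∩ ↑L).Finite ∧ (V ∩ ↑L).ncard = m }

/-- The degree of an algebraic set: the sum of the degrees of its irreducible components. -/
def degreeSum (X : Set (Fin n → ℂ)) : ℕ :=
  ∑ᶠ W ∈ {W | IsIrredComponent n W X}, degree n W

/-- The maximal dimension of an irreducible component of `X` containing `V` equals `e`. -/
def MaxCompDimEq (X V : Set (Fin n → ℂ)) (e : ℕ) : Prop :=
  (∃ W, IsIrredComponent n W X ∧ V ⊆ W ∧ dim n W = e) ∧
    ∀ W, IsIrredComponent n W X → V ⊆ W → dim n W ≤ e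

/-- The partial degrees `δ_i(V)` of an irreducible variety `V`:  the minimal `δ` such that there
are polynomials of degree at most `δ` cutting out an algebraic set containing `V` whose
irreducible components containing `V` have maximal dimension `n - i`.  By convention
`δ_0(V) = 0`. -/
def partialDeg (V : Set (Fin n → ℂ)) (i : ℕ) : ℕ :=
  if i = 0 then 0
  else sInf { δ | ∃ I : Finset (MvPolynomial (Fin n) ℂ),
    (∀ f ∈ I, f.totalDegree ≤ δ) ∧ V ⊆ zeroLocus n ↑I ∧
      MaxCompDimEq n (zeroLocus n ↑I) V (n - i) }

/-- The partial degrees as extended naturals, with the convention `δ_i(V) = ∞` for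
`i > n - dim V`. -/
def partialDegE (V : Set (Fin n → ℂ)) (i : ℕ) : ℕ∞ :=
  if i ≤ n - dim n V then (partialDeg n V i : ℕ∞) else ⊤

/-- `δ(V)` for an irreducible variety `V`: the minimal `δ` such that `V` is an irreducible
component of the zero set of a finite family of polynomials of degree at most `δ`. -/
def deltaIrr (V : Set (Fin n → ℂ)) : ℕ :=
  sInf { δ | ∃ I : Finset (MvPolynomial (Fin n) ℂ),
    (∀ f ∈ I, f.totalDegree ≤ δ) ∧ IsIrredComponent n V (zeroLocus n ↑I) }

/-- `δ(V)` for a general algebraic set `V`: the minimal `δ` such that every irreducible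
component of `V` is an irreducible component of the zero set of a finite family of polynomials
of degree at most `δ`. -/
def deltaSet (V : Set (Fin n → ℂ)) : ℕ :=
  sInf { δ | ∃ I : Finset (MvPolynomial (Fin n) ℂ),
    (∀ f ∈ I, f.totalDegree ≤ δ) ∧
      ∀ W, IsIrredComponent n W V → IsIrredComponent n W (zeroLocus n ↑I) }

/-- An algebraic set all of whose irreducible components have dimension `d`. -/
def IsAlgSetOfDim (V : Set (Fin n → ℂ)) (d : ℕ) : Prop :=
  IsAlgebraicSet n V ∧ V.Nonempty ∧ ∀ W, IsIrredComponent n W V → dim n W = d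

/-- `Δ_i(V) = max (deg V / (δ_{i+1}(V) ⋯ δ_{n-d}(V))) 1`. -/
def Delta (V : Set (Fin n → ℂ)) (i : ℕ) : ℝ :=
  max ((degree n V : ℝ) / ∏ j ∈ Finset.Icc (i + 1) (n - dim n V), (partialDeg n V j : ℝ)) 1

/-- `i` is admissible with respect to `V` if `δ_{i+1}(V) > 2 i δ_i(V)` (with the convention
`δ_i(V) = ∞` for `i > n - dim V`). -/
def Admissible (V : Set (Fin n → ℂ)) (i : ℕ) : Prop :=
  ((2 * i : ℕ) : ℕ∞) * partialDegE n V i < partialDegE n V (i + 1)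

/-- The interval `ℛ_i(V) = [c₁ δ_i(V)^{n-i} Δ_i(V), (c₀/2) δ_{i+1}(V)^{n-i} Δ_i(V)]`,
where `δ_{n-d+1}(V) = ∞` makes the last interval a half-line. -/
def RSet (c0 c1 : ℝ) (V : Set (Fin n → ℂ)) (i : ℕ) : Set ℝ :=
  if i = n - dim n V then
    Set.Ici (c1 * (partialDeg n V i : ℝ) ^ (n - i) * Delta n V i)
  else
    Set.Icc (c1 * (partialDeg n V i : ℝ) ^ (n - i) * Delta n V i)
      ((c0 / 2) * (partialDeg n V (i + 1) : ℝ) ^ (n - i) * Delta n V i)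

/-- The interval `ℛ^l_{s,τ}(V) = [τ δ_s(V)^{n-(s+l)} Δ_s(V), τ δ_{s+1}(V)^{n-(s+l)} Δ_s(V)]`,
where `δ_{n-d+1}(V) = ∞` makes the last interval a half-line. -/
def RlSet (τ : ℝ) (l : ℕ) (V : Set (Fin n → ℂ)) (s : ℕ) : Set ℝ :=
  if s = n - dim n V then
    Set.Ici (τ * (partialDeg n V s : ℝ) ^ (n - (s + l)) * Delta n V s)
  else
    Set.Icc (τ * (partialDeg n V s : ℝ) ^ (n - (s + l)) * Delta n V s)
      (τ * (partialDeg n V (s + 1) : ℝ) ^ (n - (s + l)) * Delta n V s)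

/-- The ideal `I(V)` of polynomials vanishing on `V ⊆ ℂⁿ`. -/
def vanishingIdeal (V : Set (Fin n → ℂ)) : Ideal (MvPolynomial (Fin n) ℂ) where
  carrier := {f | ∀ x ∈ V, eval x f = 0}
  add_mem' := by
    intro a b ha hb x hx
    simp [ha x hx, hb x hx]
  zero_mem' := by
    intro x hx
    simp
  smul_mem' := by
    intro c f hf x hx
    simp [smul_eq_mul, hf x hx]

/-- The ideal `I_ℝ(V)` of real polynomials vanishing on `V ⊆ ℂⁿ`. -/
def vanishingIdealR (V : Set (Fin n → ℂ)) : Ideal (MvPolynomial (Fin n) ℝ) :=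
  (vanishingIdeal n V).comap (MvPolynomial.map (algebraMap ℝ ℂ))

/-- The affine Hilbert function `H_{I(V)}(m) = dim_ℂ ℂ[x]_{≤ m} / I(V)_{≤ m}`, realised as the
dimension of the image of the space of polynomials of total degree at most `m` in the quotient
ring `ℂ[x]/I(V)`. -/
def hilbert (V : Set (Fin n → ℂ)) (m : ℕ) : ℕ :=
  Module.finrank ℂ
    (Submodule.map (Ideal.Quotient.mkₐ ℂ (vanishingIdeal n V)).toLinearMap
      (restrictTotalDegree (Fin n) ℂ m))

/-- The real affine Hilbert function `H_{I(V),ℝ}(m) = dim_ℝ ℝ[x]_{≤ m} / I_ℝ(V)_{≤ m}`. -/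
def hilbertR (V : Set (Fin n → ℂ)) (m : ℕ) : ℕ :=
  Module.finrank ℝ
    (Submodule.map (Ideal.Quotient.mkₐ ℝ (vanishingIdealR n V)).toLinearMap
      (restrictTotalDegree (Fin n) ℝ m))

/-- The inclusion `ℝⁿ → ℂⁿ`. -/
def toC (x : Fin n → ℝ) : Fin n → ℂ := fun i => (x i : ℂ)

/-- The set of real points of `V ⊆ ℂⁿ`. -/
def realPts (V : Set (Fin n → ℂ)) : Set (Fin n → ℝ) := {x | toC n x ∈ V}

/-- The real zero set of a real polynomial. -/
def zeroSetR (g : MvPolynomial (Fin n) ℝ) : Set (Fin n → ℝ) := {x | eval x g = 0}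

/-- The zero locus of the polynomials `P 1, …, P i` (the first `i` members of a tuple of
polynomials indexed from `1`). -/
def zeroLocusUpTo (P : ℕ → MvPolynomial (Fin n) ℂ) (i : ℕ) : Set (Fin n → ℂ) :=
  zeroLocus n {f | ∃ j : ℕ, 1 ≤ j ∧ j ≤ i ∧ f = P j}

/-- `V'` is an `(n-s)`-minimal variety of the irreducible variety `V`. -/
def IsMinimalVariety (V V' : Set (Fin n → ℂ)) (s : ℕ) : Prop :=
  IsIrredVariety n V' ∧ V ⊆ V' ∧ dim n V' = n - s ∧
    ∀ f ∈ vanishingIdeal n V, f ∉ vanishingIdeal n V' →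
      partialDegE n V (s + 1) ≤ (f.totalDegree : ℕ∞)

/-- `S` is `(k,b)`-free with respect to `T`, for the incidence relation `R`. -/
def KBFree {α β : Type*} (R : α → β → Prop) (S : Finset α) (T : Finset β) (k b : ℕ) : Prop :=
  ¬ ∃ (P : Finset α) (B : Finset β), P ⊆ S ∧ B ⊆ T ∧ P.card = k ∧ B.card = b ∧
      ∀ s ∈ P, ∀ t ∈ B, R s t

/-- The number of incidences between a finite set of points and a finite family of sets. -/
def incCountAbs {α : Type*} (S : Finset α) (T : Finset (Set α)) : ℕ :=
  ∑ t ∈ T, (↑S ∩ t).ncard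

/-- The number of incidences between a finite set of real points and a finite family of
subsets of `ℂⁿ`. -/
def incCount (S : Finset (Fin n → ℝ)) (T : Finset (Set (Fin n → ℂ))) : ℕ :=
  ∑ t ∈ T, (↑S ∩ toC n ⁻¹' t).ncard

/-- The total degree `deg T = ∑_{t ∈ T} deg t` of a finite family of algebraic sets. -/
def degFamily (T : Finset (Set (Fin n → ℂ))) : ℕ := ∑ t ∈ T, degreeSum n t

/-- The total degree of a finite family of irreducible varieties. -/
def degFamilyIrred (T : Finset (Set (Fin n → ℂ))) : ℕ := ∑ t ∈ T, degree n t

/-- `α_k(d)`. -/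
def alpha (k d : ℕ) : ℝ :=
  if k = 1 ∧ d = 1 then 0 else (k : ℝ) * ((d : ℝ) - 1) / ((d : ℝ) * (k : ℝ) - 1)

/-- `β_k(d)`. -/
def beta (k d : ℕ) : ℝ :=
  if k = 1 ∧ d = 1 then 1 else (d : ℝ) * ((k : ℝ) - 1) / ((d : ℝ) * (k : ℝ) - 1)

/-- `τ_d(b,k) = b^{1-β_k(d)} k^{1-α_k(d)}`. -/
def tauC (d b k : ℕ) : ℝ := (b : ℝ) ^ (1 - beta k d) * (k : ℝ) ^ (1 - alpha k d)

/-- The Chardin–Philippon property of the constant `c₀`: for every pure-dimensional algebraic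
set `W ⊆ ℂⁿ` and every `m ≥ 2 (n - dim W) δ(W)` one has `H_{I(W)}(m) ≥ c₀ m^{dim W} deg W`. -/
def ChardinPhilippon (c0 : ℝ) : Prop :=
  ∀ (W : Set (Fin n → ℂ)) (e : ℕ), IsAlgSetOfDim n W e →
    ∀ m : ℕ, 2 * (n - e) * deltaSet n W ≤ m →
      c0 * (m : ℝ) ^ e * (degreeSum n W : ℝ) ≤ (hilbert n W m : ℝ)

/-- The defining property of the constant `c₁`: for every irreducible variety `V`, every
positive integer lies in some interval `ℛ_i(V)` with `i` admissible with respect to `V`. -/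
def CoversPositiveIntegers (c0 c1 : ℝ) : Prop :=
  ∀ V : Set (Fin n → ℂ), IsIrredVariety n V →
    ∀ m : ℕ, 0 < m → ∃ i, Admissible n V i ∧ (m : ℝ) ∈ RSet n c0 c1 V i

/-- `i_V(M)`: the smallest admissible `i` such that `M^{n-i} Δ_i(V) ∈ ℛ_i(V)`. -/
def iV (c0 c1 : ℝ) (V : Set (Fin n → ℂ)) (M : ℕ) : ℕ :=
  sInf {i | Admissible n V i ∧ (M : ℝ) ^ (n - i) * Delta n V i ∈ RSet n c0 c1 V i}

/-- A real polynomial bisects a finite set `S ⊆ ℝⁿ` if it is positive on at most half of `S`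
and negative on at most half of `S`. -/
def Bisects (g : MvPolynomial (Fin n) ℝ) (S : Finset (Fin n → ℝ)) : Prop :=
  ((↑S ∩ {x | 0 < eval x g}).ncard : ℝ) ≤ (S.card : ℝ) / 2 ∧
    ((↑S ∩ {x | eval x g < 0}).ncard : ℝ) ≤ (S.card : ℝ) / 2

/-- The set of `r`-rich points of a family `T`: points lying in at least `r` members of `T`. -/
def richPts (T : Finset (Set (Fin n → ℂ))) (r : ℕ) : Set (Fin n → ℂ) :=
  {x | r ≤ ({t | t ∈ T ∧ x ∈ t} : Set (Set (Fin n → ℂ))).ncard}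

/-- A real hypersurface of degree at most `D`: the real zero set of a nonzero real polynomial
of degree at most `D`. -/
def IsRealHypersurfaceDegLE (t : Set (Fin n → ℝ)) (D : ℕ) : Prop :=
  ∃ p : MvPolynomial (Fin n) ℝ, p ≠ 0 ∧ t = zeroSetR n p ∧ p.totalDegree ≤ D

/-- Lexicographic comparison of the tuples `(f 1, …, f m)` and `(g 1, …, g m)`. -/
def LexLE (m : ℕ) (f g : ℕ → ℕ) : Prop :=
  (∀ j ∈ Finset.Icc 1 m, f j = g j) ∨
    ∃ i ∈ Finset.Icc 1 m, (∀ j, 1 ≤ j → j < i → f j = g j) ∧ f i < g i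


lemma norm_core {A S : Type*} [CommRing A] [IsDomain A] [IsIntegrallyClosed A] [CommRing S] [IsDomain S]
    [Algebra A S] [FaithfulSMul A S] [Module.Finite A S] (f : S) (hf : f ≠ 0) :
    ∃ a0 : A, a0 ≠ 0 ∧ f ∣ algebraMap A S a0 ∧ ∀ a : A, f ∣ algebraMap A S a → ∃ k, a0 ∣ a ^ k := by
  classical
  let K := FractionRing A
  let L := FractionRing S
  letI : Algebra K L := FractionRing.liftAlgebra A L
  haveI : IsScalarTower A K L := FractionRing.isScalarTower_liftAlgebra A L
  haveI : Module.Finite K L := Module.Finite.of_isLocalization A S (nonZeroDivisors A)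
  have hint : ∀ s : S, IsIntegral A s := fun s => Algebra.IsIntegral.isIntegral s
  have hmin := minpoly.isIntegrallyClosed_eq_field_fractions K L (hint f)
  refine ⟨(minpoly A f).coeff 0, ?_, ?_, ?_⟩
  · intro h
    have h3 : (minpoly K (algebraMap S L f)).coeff 0 = 0 := by rw [hmin, Polynomial.coeff_map, h, map_zero]
    have h4 := (minpoly.coeff_zero_eq_zero (Algebra.IsIntegral.isIntegral _)).1 h3
    exact hf (by simpa using h4)
  · have h := minpoly.aeval A f
    have h2 := Polynomial.divX_mul_X_add (minpoly A f)
    rw [← h2] at h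
    simp only [map_add, map_mul, Polynomial.aeval_X, Polynomial.aeval_C] at h
    exact ⟨- Polynomial.aeval f (minpoly A f).divX, by linear_combination h⟩
  · rintro a ⟨s, hs⟩
    refine ⟨Module.finrank K L, ?_⟩
    have h1 : algebraMap A K a ^ Module.finrank K L = 
        Algebra.norm K (algebraMap S L f) * Algebra.norm K (algebraMap S L s) := by
      rw [← map_mul, ← map_mul, ← hs, ← IsScalarTower.algebraMap_apply A S L, 
        IsScalarTower.algebraMap_apply A K L, Algebra.norm_algebraMap]
    have h2 := Algebra.norm_eq_norm_adjoin K (algebraMap S L f)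
    have hfi : IsIntegral K (algebraMap S L f) := Algebra.IsIntegral.isIntegral _
    have h3 := Algebra.PowerBasis.norm_gen_eq_coeff_zero_minpoly (IntermediateField.adjoin.powerBasis hfi)
    rw [IntermediateField.adjoin.powerBasis_gen, IntermediateField.minpoly_gen, hmin, Polynomial.coeff_map] at h3
    rw [h3] at h2
    obtain ⟨r, hr⟩ := IsIntegrallyClosed.isIntegral_iff.1 (Algebra.isIntegral_norm K (R := A) ((hint s).map (IsScalarTower.toAlgHom A S L)))
    obtain ⟨m, hm⟩ := Nat.exists_eq_succ_of_ne_zero (Module.finrank_pos (R := IntermediateField.adjoin K {algebraMap S L f}) (M := L)).ne'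
    rw [h2, hm] at h1
    rw [show algebraMap S L s = IsScalarTower.toAlgHom A S L s from rfl, ← hr] at h1
    set q := (IntermediateField.adjoin.powerBasis hfi).dim
    refine ⟨(-1)^q * ((-1)^q * (minpoly A f).coeff 0)^m * r, ?_⟩
    apply IsFractionRing.injective A K
    simp only [map_mul, map_pow, map_neg, map_one]
    rw [h1]; simp only [Nat.succ_eq_add_one]
    ring


lemma exists_sep {S : Type*} [CommRing S] [IsNoetherianRing S] (f : S) (q : Ideal S)
    (hq : q ∈ (Ideal.span {f}).minimalPrimes) :
    ∃ g, g ∉ q ∧ ∀ a ∈ q, ∃ k, f ∣ (g * a) ^ k := by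
  classical
  have hfin := Ideal.finite_minimalPrimes_of_isNoetherianRing S (Ideal.span {f})
  haveI : q.IsPrime := hq.1.1
  have hnot : ¬ ((hfin.toFinset.erase q).inf id ≤ q) := by
    rw [Ideal.IsPrime.inf_le' inferInstance]
    rintro ⟨p, hp, hpq⟩
    simp only [Finset.mem_erase, Set.Finite.mem_toFinset] at hp
    exact hp.1 (le_antisymm hpq (hq.2 hp.2.1 hpq))
  obtain ⟨g, hg, hgq⟩ := SetLike.not_le_iff_exists.1 hnot
  refine ⟨g, hgq, fun a ha => ?_⟩
  have : g * a ∈ (Ideal.span {f}).radical := by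
    rw [← Ideal.sInf_minimalPrimes, Submodule.mem_sInf]
    intro p hp
    by_cases hpq : p = q
    · subst hpq; exact Ideal.mul_mem_left _ _ ha
    · refine Ideal.mul_mem_right _ _ ?_
      have := (Finset.inf_le (f := id) (Finset.mem_erase.2 ⟨hpq, hfin.mem_toFinset.2 hp⟩)) hg
      exact this
  obtain ⟨k, hk⟩ := this
  exact ⟨k, Ideal.mem_span_singleton.1 hk⟩

/-- transcendence degree as a natural number -/
def td (S : Type) [CommRing S] [Algebra ℂ S] : ℕ := Cardinal.toNat (Algebra.trdeg ℂ S)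

lemma td_cast (S : Type) [CommRing S] [Algebra ℂ S] [Algebra.FiniteType ℂ S] :
    ((td S : ℕ) : Cardinal) = Algebra.trdeg ℂ S :=
  Cardinal.cast_toNat_of_lt_aleph0 trdeg_lt_aleph0_of_finiteType

lemma le_td {S : Type} [CommRing S] [Algebra ℂ S] [Algebra.FiniteType ℂ S] {ι : Type} [Fintype ι]
    {y : ι → S} (hy : AlgebraicIndependent ℂ y) : Fintype.card ι ≤ td S := by
  have := hy.cardinalMk_le_trdeg
  rw [← td_cast] at this
  simpa using this

lemma td_eq {S : Type} [CommRing S] [IsDomain S] [Algebra ℂ S] [Algebra.FiniteType ℂ S] {k : ℕ}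
    (g : MvPolynomial (Fin k) ℂ →ₐ[ℂ] S) (hg : Function.Injective g) (hi : g.IsIntegral) :
    td S = k := by
  letI := g.toRingHom.toAlgebra
  haveI : IsScalarTower ℂ (MvPolynomial (Fin k) ℂ) S := IsScalarTower.of_algHom g
  haveI : FaithfulSMul (MvPolynomial (Fin k) ℂ) S := (faithfulSMul_iff_algebraMap_injective _ _).2 hg
  haveI : Algebra.IsIntegral (MvPolynomial (Fin k) ℂ) S := ⟨hi⟩
  have h := trdeg_add_eq ℂ (MvPolynomial (Fin k) ℂ) (A := S)
  rw [trdeg_eq_zero (R := MvPolynomial (Fin k) ℂ) (A := S), add_zero, MvPolynomial.trdeg_of_isDomain] at h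
  rw [td, ← h]; simp

lemma exists_norm (S : Type) [CommRing S] [IsDomain S] [Algebra ℂ S] [Algebra.FiniteType ℂ S] :
    ∃ k, k = td S ∧ ∃ g : MvPolynomial (Fin k) ℂ →ₐ[ℂ] S, Function.Injective g ∧ g.Finite := by
  obtain ⟨k, g, h1, h2⟩ := exists_finite_inj_algHom_of_fg ℂ S
  have := td_eq g h1 (RingHom.IsIntegral.of_finite h2)
  exact ⟨k, this.symm, g, h1, h2⟩

lemma trdeg_frac (D : Type) [CommRing D] [IsDomain D] [Algebra ℂ D] :
    Algebra.trdeg ℂ (FractionRing D) = Algebra.trdeg ℂ D := by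
  haveI : Algebra.IsAlgebraic D (FractionRing D) := IsLocalization.isAlgebraic _ (nonZeroDivisors D)
  have h := trdeg_add_eq ℂ D (A := FractionRing D)
  rw [trdeg_eq_zero (R := D) (A := FractionRing D), add_zero] at h
  exact h.symm

lemma td_krull {S : Type} [CommRing S] [IsDomain S] [Algebra ℂ S] [Algebra.FiniteType ℂ S]
    (f : S) (hf : f ≠ 0) (q : Ideal S) (hq : q ∈ (Ideal.span {f}).minimalPrimes) :
    td S ≤ td (S ⧸ q) + 1 := by
  classical
  haveI : IsNoetherianRing S := Algebra.FiniteType.isNoetherianRing ℂ S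
  haveI hqp : q.IsPrime := hq.1.1
  obtain ⟨g, hgq, hg⟩ := exists_sep f q hq
  have hg0 : g ≠ 0 := fun h => hgq (h ▸ q.zero_mem)
  let S' := Localization.Away g
  have hM : Submonoid.powers g ≤ nonZeroDivisors S := powers_le_nonZeroDivisors_of_noZeroDivisors hg0
  haveI : IsDomain S' := IsLocalization.isDomain_of_le_nonZeroDivisors _ hM
  haveI : Algebra.FiniteType S S' := inferInstanceAs (Algebra.FiniteType S (Localization.Away g))
  haveI : Algebra.FiniteType ℂ S' := Algebra.FiniteType.trans (S := S) inferInstance inferInstance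
  have hinj : Function.Injective (algebraMap S S') := IsLocalization.injective S' hM
  let F := FractionRing (S ⧸ q)
  let φ0 : S →ₐ[ℂ] F := (IsScalarTower.toAlgHom ℂ (S ⧸ q) F).comp (Ideal.Quotient.mkₐ ℂ q)
  have hφ0 : ∀ s, φ0 s = 0 ↔ s ∈ q := by
    intro s
    change algebraMap (S ⧸ q) F (Ideal.Quotient.mk q s) = 0 ↔ _
    rw [← Ideal.Quotient.eq_zero_iff_mem]
    exact (map_eq_zero_iff _ (IsFractionRing.injective (S ⧸ q) F))
  have hgu : IsUnit (φ0 g) := by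
    rw [isUnit_iff_ne_zero, Ne, hφ0]; exact hgq
  let φ : S' →+* F := IsLocalization.Away.lift g (g := φ0.toRingHom) hgu
  have hφ : ∀ s, φ (algebraMap S S' s) = φ0 s := fun s => IsLocalization.Away.lift_eq g hgu s
  let φa : S' →ₐ[ℂ] F := ⟨φ, by
    intro c
    change φ (algebraMap ℂ S' c) = _
    rw [IsScalarTower.algebraMap_apply ℂ S S', hφ, AlgHom.commutes]⟩
  have hφa : ∀ s, φa (algebraMap S S' s) = φ0 s := hφ
  have hker : ∀ x : S', φa x = 0 → ∃ k, algebraMap S S' f ∣ x ^ k := by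
    intro x hx
    obtain ⟨⟨s, ⟨m, N, rfl⟩⟩, hs⟩ := IsLocalization.surj (Submonoid.powers g) x
    simp only at hs
    have h1 : s ∈ q := by
      rw [← hφ0, ← hφa, ← hs, map_mul, hx, zero_mul]
    obtain ⟨k, u, hu⟩ := hg s h1
    have hgU : IsUnit (algebraMap S S' g) := IsLocalization.Away.algebraMap_isUnit g
    refine ⟨k, ?_⟩
    have h2 : algebraMap S S' f ∣ x ^ k * ((algebraMap S S' g) ^ (N+1)) ^ k := by
      refine ⟨algebraMap S S' u, ?_⟩
      rw [← map_mul, ← hu, map_pow, map_mul, ← hs, map_pow]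
      ring
    exact (IsUnit.dvd_mul_right ((hgU.pow _).pow _)).1 h2
  have hle : td S ≤ td S' := by
    have := trdeg_le_of_injective (IsScalarTower.toAlgHom ℂ S S') hinj
    rw [← td_cast, ← td_cast] at this
    exact_mod_cast this
  obtain ⟨e, he, γ, hγ, hγf⟩ := exists_norm S'
  letI := γ.toRingHom.toAlgebra
  haveI : FaithfulSMul (MvPolynomial (Fin e) ℂ) S' := (faithfulSMul_iff_algebraMap_injective _ _).2 hγ
  haveI : Module.Finite (MvPolynomial (Fin e) ℂ) S' := hγf
  obtain ⟨a0, ha0, hfa0, hdiv⟩ := norm_core (A := MvPolynomial (Fin e) ℂ) (algebraMap S S' f) (by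
    rw [Ne, map_eq_zero_iff _ hinj]; exact hf)
  have hγe : ∀ a, algebraMap (MvPolynomial (Fin e) ℂ) S' a = γ a := fun a => rfl
  have hfq : φa (algebraMap S S' f) = 0 := by
    rw [hφa, hφ0]; exact hq.1.2 (Ideal.mem_span_singleton_self f)
  have hnc : ∃ j, degreeOf j a0 ≠ 0 := by
    by_contra hcon
    push Not at hcon
    have h0 : a0.totalDegree = 0 := by
      rw [totalDegree_eq_zero_iff]
      intro m hm j
      have := monomial_le_degreeOf j hm
      rw [hcon j] at this
      omega
    rw [totalDegree_eq_zero_iff_eq_C] at h0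
    have h3 : φa (γ a0) = 0 := by
      obtain ⟨u, hu⟩ := hfa0
      rw [← hγe, hu, map_mul, hfq, zero_mul]
    rw [h0] at h3
    have h4 : φa (γ (C (coeff 0 a0))) = algebraMap ℂ F (coeff 0 a0) := by
      rw [← MvPolynomial.algebraMap_eq, AlgHom.commutes, AlgHom.commutes]
    rw [h4] at h3
    have h5 : coeff 0 a0 = 0 := by simpa using h3
    rw [h5, C_0] at h0
    exact ha0 h0
  obtain ⟨j, hj⟩ := hnc
  have hind : AlgebraicIndependent ℂ (fun i : {i : Fin e // i ≠ j} => φa (γ (X i.1))) := by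
    rw [algebraicIndependent_iff]
    intro P hP
    by_contra hP0
    have h1 : φa (γ (rename Subtype.val P)) = 0 := by
      rw [← hP, ← AlgHom.comp_apply, ← AlgHom.comp_apply]
      congr 1
      ext i
      simp
    obtain ⟨k, hk⟩ := hker _ h1
    rw [← map_pow] at hk
    obtain ⟨k', hk'⟩ := hdiv _ hk
    obtain ⟨b, hb⟩ := hk'
    have hr0 : rename (Subtype.val : {i : Fin e // i ≠ j} → Fin e) P ≠ 0 := by
      rw [Ne, map_eq_zero_iff _ (rename_injective _ Subtype.val_injective)]; exact hP0
    have hb0 : b ≠ 0 := by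
      rintro rfl
      rw [mul_zero] at hb
      exact hr0 (eq_zero_of_pow_eq_zero (eq_zero_of_pow_eq_zero hb))
    have h2 := congrArg (degreeOf j) hb
    rw [degreeOf_mul_eq ha0 hb0, ← pow_mul, degreeOf_pow_eq _ _ _ hr0] at h2
    have h3 : degreeOf j (rename (Subtype.val : {i : Fin e // i ≠ j} → Fin e) P) = 0 := by
      by_contra h
      have hv : j ∈ (rename (Subtype.val : {i : Fin e // i ≠ j} → Fin e) P).vars := by
        rw [vars_def, Multiset.mem_toFinset, ← Multiset.count_ne_zero, ← degreeOf_def]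
        exact h
      obtain ⟨i, -, hi⟩ := mem_vars_rename _ _ hv
      exact i.2 hi
    rw [h3] at h2
    omega
  have h6 := hind.cardinalMk_le_trdeg
  rw [trdeg_frac, ← td_cast] at h6
  have h7 : Fintype.card {i : Fin e // i ≠ j} ≤ td (S ⧸ q) := by simpa using h6
  rw [Fintype.card_subtype_compl] at h7
  simp at h7
  omega

lemma td_lt {S : Type} [CommRing S] [IsDomain S] [Algebra ℂ S] [Algebra.FiniteType ℂ S]
    (q : Ideal S) [q.IsPrime] (hq : q ≠ ⊥) : td (S ⧸ q) < td S := by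
  classical
  obtain ⟨f, hfq, hf⟩ := Submodule.exists_mem_ne_zero_of_ne_bot hq
  obtain ⟨k, hk, γ, hγ, hγf⟩ := exists_norm (S ⧸ q)
  choose y hy using fun i : Fin k => Ideal.Quotient.mk_surjective (γ (X i))
  have hyi : AlgebraicIndependent ℂ (Ideal.Quotient.mkₐ ℂ q ∘ y) := by
    rw [algebraicIndependent_iff_injective_aeval]
    convert hγ using 1
    have : aeval (R := ℂ) (Ideal.Quotient.mkₐ ℂ q ∘ y) = γ := by
      ext i
      simpa using hy i
    rw [this]
  have hyS := AlgebraicIndependent.of_comp _ hyi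
  have hB : ∀ b ∈ Algebra.adjoin ℂ (Set.range y), b ∈ q → b = 0 := by
    intro b hb hbq
    rw [Algebra.adjoin_range_eq_range_aeval] at hb
    obtain ⟨P, rfl⟩ := hb
    have h1 : aeval (Ideal.Quotient.mkₐ ℂ q ∘ y) P = 0 := by
      have := comp_aeval_apply y (Ideal.Quotient.mkₐ ℂ q) P
      rw [show (Ideal.Quotient.mkₐ ℂ q ∘ y) = fun i => Ideal.Quotient.mkₐ ℂ q (y i) from rfl, ← this, Ideal.Quotient.mkₐ_eq_mk]
      exact Ideal.Quotient.eq_zero_iff_mem.2 hbq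
    have h2 := (algebraicIndependent_iff.1 hyi) P h1
    rw [h2]; exact map_zero _
  have hz := (hyS.option_iff_transcendental f).2 (by
    intro halg
    obtain ⟨p, hp0, hp⟩ := halg.exists_nonzero_coeff_and_aeval_eq_zero (mem_nonZeroDivisors_of_ne_zero hf)
    apply hp0
    have h2 := Polynomial.divX_mul_X_add p
    rw [← h2] at hp
    simp only [map_add, map_mul, Polynomial.aeval_X, Polynomial.aeval_C] at hp
    apply Subtype.ext
    refine hB _ (p.coeff 0).2 ?_
    have h3 : algebraMap _ S (p.coeff 0) = - (Polynomial.aeval f p.divX * f) := by linear_combination hp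
    change algebraMap _ S (p.coeff 0) ∈ q
    rw [h3]
    exact q.neg_mem (q.mul_mem_left _ hfq))
  have := le_td hz
  simp at this
  omega

lemma zl_anti {n : ℕ} {I J : Set (MvPolynomial (Fin n) ℂ)} (h : I ⊆ J) : zeroLocus n J ⊆ zeroLocus n I :=
  fun _ hx f hf => hx f (h hf)

lemma sub_zl {n : ℕ} {I : Set (MvPolynomial (Fin n) ℂ)} {V : Set (Fin n → ℂ)} :
    V ⊆ zeroLocus n I ↔ I ⊆ (vanishingIdeal n V : Set (MvPolynomial (Fin n) ℂ)) :=
  ⟨fun h f hf x hx => h hx f hf, fun h x hx f hf => h hf x hx⟩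

lemma zl_vi {n : ℕ} {V : Set (Fin n → ℂ)} (h : IsAlgebraicSet n V) :
    zeroLocus n (vanishingIdeal n V) = V := by
  apply Subset.antisymm
  · obtain ⟨I, hI⟩ := h
    have : I ⊆ (vanishingIdeal n V : Set _) := sub_zl.1 hI.subset
    exact (zl_anti this).trans hI.symm.subset
  · exact sub_zl.2 subset_rfl

lemma vi_anti {n : ℕ} {V W : Set (Fin n → ℂ)} (h : V ⊆ W) : vanishingIdeal n W ≤ vanishingIdeal n V :=
  fun _ hf x hx => hf x (h hx)

lemma vi_le_iff {n : ℕ} {V W : Set (Fin n → ℂ)} (hW : IsAlgebraicSet n W) :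
    vanishingIdeal n W ≤ vanishingIdeal n V ↔ V ⊆ W := by
  constructor
  · intro h
    rw [← zl_vi hW]
    exact sub_zl.2 h
  · exact vi_anti

lemma vi_prime {n : ℕ} {V : Set (Fin n → ℂ)} (h : IsIrredVariety n V) : (vanishingIdeal n V).IsPrime := by
  obtain ⟨h1, ⟨x, hx⟩, h2⟩ := h
  refine ⟨?_, ?_⟩
  · rw [Ideal.ne_top_iff_one]
    intro h
    have := h x hx
    simp at this
  · intro f g hfg
    rcases h2 (zeroLocus n {f}) (zeroLocus n {g}) ⟨_, rfl⟩ ⟨_, rfl⟩ (by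
      intro y hy
      have := hfg y hy
      rw [map_mul, mul_eq_zero] at this
      rcases this with h | h
      · left; intro f' hf'; rw [mem_singleton_iff.1 hf']; exact h
      · right; intro f' hf'; rw [mem_singleton_iff.1 hf']; exact h) with h | h
    · left; exact fun y hy => h hy f rfl
    · right; exact fun y hy => h hy g rfl

lemma vi_zl {n : ℕ} (P : Ideal (MvPolynomial (Fin n) ℂ)) [P.IsPrime] :
    vanishingIdeal n (zeroLocus n P) = P := by
  have := MvPolynomial.IsPrime.vanishingIdeal_zeroLocus (K := ℂ) P
  ext f
  rw [← SetLike.ext_iff.1 this f]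
  rfl

lemma zl_nonempty {n : ℕ} (P : Ideal (MvPolynomial (Fin n) ℂ)) [hP : P.IsPrime] : (zeroLocus n P).Nonempty := by
  by_contra h
  rw [not_nonempty_iff_eq_empty] at h
  have := vi_zl P
  rw [h] at this
  apply hP.ne_top
  rw [← this, eq_top_iff]
  intro f _ x hx
  exact absurd hx (notMem_empty x)

lemma irr_of_prime {n : ℕ} {V : Set (Fin n → ℂ)} (hV : IsAlgebraicSet n V) (hne : V.Nonempty)
    (hp : (vanishingIdeal n V).IsPrime) : IsIrredVariety n V := by
  refine ⟨hV, hne, ?_⟩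
  intro V1 V2 h1 h2 h
  by_contra hcon
  push Not at hcon
  rw [← vi_le_iff h1, ← vi_le_iff h2, SetLike.not_le_iff_exists, SetLike.not_le_iff_exists] at hcon
  obtain ⟨⟨f, hf1, hf⟩, ⟨g, hg1, hg⟩⟩ := hcon
  have : f * g ∈ vanishingIdeal n V := by
    intro x hx
    rw [map_mul]
    rcases h hx with h | h
    · rw [hf1 x h, zero_mul]
    · rw [hg1 x h, mul_zero]
  rcases hp.mem_or_mem this with h | h
  · exact hf h
  · exact hg h

lemma irr_zl {n : ℕ} (P : Ideal (MvPolynomial (Fin n) ℂ)) [P.IsPrime] : IsIrredVariety n (zeroLocus n P) := by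
  refine irr_of_prime ⟨_, rfl⟩ (zl_nonempty P) ?_
  rw [vi_zl]; infer_instance

lemma irr_point {n : ℕ} (p : Fin n → ℂ) : IsIrredVariety n {p} := by
  refine ⟨⟨{f | eval p f = 0}, ?_⟩, singleton_nonempty p, ?_⟩
  · apply Subset.antisymm
    · rintro x rfl f hf; exact hf
    · intro x hx
      rw [mem_singleton_iff]
      funext i
      have := hx (X i - C (p i)) (by simp)
      simpa [sub_eq_zero] using this
  · intro V1 V2 _ _ h
    rcases h rfl with h | h
    · left; rintro x rfl; exact h
    · right; rintro x rfl; exact h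

/-- td of coordinate ring -/
def tdV {n : ℕ} (V : Set (Fin n → ℂ)) : ℕ := td (MvPolynomial (Fin n) ℂ ⧸ vanishingIdeal n V)

lemma td_congr {A B : Type} [CommRing A] [CommRing B] [Algebra ℂ A] [Algebra ℂ B] (e : A ≃ₐ[ℂ] B) : td A = td B := by
  rw [td, td, AlgEquiv.trdeg_eq e]

lemma tdV_quot {n : ℕ} {V W : Set (Fin n → ℂ)} (h : vanishingIdeal n W ≤ vanishingIdeal n V) :
    td ((MvPolynomial (Fin n) ℂ ⧸ vanishingIdeal n W) ⧸
      (vanishingIdeal n V).map (Ideal.Quotient.mkₐ ℂ (vanishingIdeal n W))) = tdV V :=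
  td_congr (DoubleQuot.quotQuotEquivQuotOfLEₐ ℂ h)

lemma ker_mk {n : ℕ} (I : Ideal (MvPolynomial (Fin n) ℂ)) : RingHom.ker (Ideal.Quotient.mkₐ ℂ I) = I := by
  ext f
  rw [RingHom.mem_ker]
  exact Ideal.Quotient.eq_zero_iff_mem

lemma tdV_lt {n : ℕ} {V W : Set (Fin n → ℂ)} (hV : IsIrredVariety n V) (hW : IsIrredVariety n W)
    (h : V ⊂ W) : tdV V < tdV W := by
  have hle : vanishingIdeal n W ≤ vanishingIdeal n V := vi_anti h.1
  haveI := vi_prime hV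
  haveI := vi_prime hW
  rw [← tdV_quot hle]
  haveI : ((vanishingIdeal n V).map (Ideal.Quotient.mkₐ ℂ (vanishingIdeal n W))).IsPrime :=
    Ideal.map_isPrime_of_surjective (Ideal.Quotient.mkₐ_surjective ℂ _) (by
      rw [ker_mk]; exact hle)
  apply td_lt
  intro hbot
  rw [Ideal.map_eq_bot_iff_le_ker, ker_mk, vi_le_iff hV.1] at hbot
  exact h.2 hbot

lemma krullV {n : ℕ} {V W : Set (Fin n → ℂ)} (hV : IsIrredVariety n V) (hW : IsIrredVariety n W)
    (h : V ⊆ W) (f : MvPolynomial (Fin n) ℂ) (hf : f ∈ vanishingIdeal n V) :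
    ∃ W', IsIrredVariety n W' ∧ V ⊆ W' ∧ W' ⊆ W ∧ f ∈ vanishingIdeal n W' ∧ tdV W ≤ tdV W' + 1 := by
  by_cases hfW : f ∈ vanishingIdeal n W
  · exact ⟨W, hW, h, subset_rfl, hfW, by omega⟩
  have hle : vanishingIdeal n W ≤ vanishingIdeal n V := vi_anti h
  haveI := vi_prime hV
  haveI := vi_prime hW
  set π := Ideal.Quotient.mkₐ ℂ (vanishingIdeal n W) with hπ
  have hsurj : Function.Surjective π := Ideal.Quotient.mkₐ_surjective ℂ _
  haveI : ((vanishingIdeal n V).map π).IsPrime :=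
    Ideal.map_isPrime_of_surjective hsurj (by
      rw [ker_mk]; exact hle)
  obtain ⟨q, hq, hqV⟩ := Ideal.exists_minimalPrimes_le (I := Ideal.span {π f}) (J := (vanishingIdeal n V).map π) (by
    rw [Ideal.span_singleton_le_iff_mem]
    exact Ideal.mem_map_of_mem _ hf)
  haveI := hq.1.1
  have hk := td_krull (π f) (by
    intro h0; exact hfW (Ideal.Quotient.eq_zero_iff_mem.1 h0)) q hq
  haveI : (q.comap π).IsPrime := Ideal.comap_isPrime _ _
  have hWq : vanishingIdeal n W ≤ q.comap π := by
    intro g hg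
    rw [Ideal.mem_comap]
    have : π g = 0 := Ideal.Quotient.eq_zero_iff_mem.2 hg
    rw [this]; exact q.zero_mem
  refine ⟨zeroLocus n (q.comap π), irr_zl _, ?_, ?_, ?_, ?_⟩
  · rw [sub_zl]
    intro g hg
    have h1 : π g ∈ (vanishingIdeal n V).map π := hqV hg
    have h2 : g ∈ ((vanishingIdeal n V).map π).comap π := h1
    rw [Ideal.comap_map_of_surjective' _ hsurj, ker_mk, sup_eq_left.2 hle] at h2
    exact h2
  · rw [← vi_le_iff hW.1, vi_zl]; exact hWq
  · rw [vi_zl]; exact hq.1.2 (Ideal.mem_span_singleton_self _)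
  · have h3 : td ((MvPolynomial (Fin n) ℂ ⧸ vanishingIdeal n W) ⧸ q) = tdV (zeroLocus n (q.comap π)) := by
      have h4 : vanishingIdeal n W ≤ vanishingIdeal n (zeroLocus n (q.comap π)) := by rw [vi_zl]; exact hWq
      rw [← tdV_quot h4]
      have : (vanishingIdeal n (zeroLocus n (q.comap π))).map π = q := by
        rw [vi_zl, Ideal.map_comap_of_surjective _ hsurj]
      rw [this]
    rw [← h3]; exact hk

lemma tdV_point {n : ℕ} (p : Fin n → ℂ) : tdV ({p} : Set (Fin n → ℂ)) = 0 := by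
  haveI := vi_prime (irr_point p)
  haveI : Algebra.IsAlgebraic ℂ (MvPolynomial (Fin n) ℂ ⧸ vanishingIdeal n {p}) := by
    constructor
    intro x
    obtain ⟨f, rfl⟩ := Ideal.Quotient.mk_surjective x
    have : Ideal.Quotient.mk (vanishingIdeal n {p}) f = algebraMap ℂ _ (eval p f) := by
      change _ = Ideal.Quotient.mk (vanishingIdeal n {p}) (C (eval p f))
      rw [Ideal.Quotient.eq]
      rintro x rfl
      simp
    rw [this]
    exact isAlgebraic_algebraMap _
  rw [tdV, td, trdeg_eq_zero]; simp

lemma chain_le {n : ℕ} (k : ℕ) : ∀ (V : Set (Fin n → ℂ)), IsIrredVariety n V → HasChain n V k → k ≤ tdV V := by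
  induction k with
  | zero => intros; omega
  | succ k ih =>
    rintro V hV ⟨W, h1, h2, h3⟩
    have hlast : W (Fin.castSucc (Fin.last k)) ⊂ W (Fin.last (k+1)) := h2 _ _ (Fin.castSucc_lt_last _)
    have h4 := ih _ (h1 _) ⟨fun i => W i.castSucc, fun i => h1 _, fun i j hij => h2 _ _ (Fin.castSucc_lt_castSucc_iff.2 hij), subset_rfl⟩
    have h5 := tdV_lt (h1 _) hV (hlast.trans_subset h3)
    omega

lemma has_chain {n : ℕ} (k : ℕ) : ∀ (V : Set (Fin n → ℂ)), IsIrredVariety n V → tdV V = k → HasChain n V k := by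
  induction k with
  | zero => 
    intro V hV _
    refine ⟨fun _ => V, fun _ => hV, ?_, subset_rfl⟩
    intro i j hij
    have h1 := i.2; have h2 := j.2; have h3 := Fin.lt_def.1 hij; omega
  | succ k ih =>
    intro V hV hk
    obtain ⟨p, hp⟩ := hV.2.1
    have hpV : ({p} : Set (Fin n → ℂ)) ⊆ V := singleton_subset_iff.2 hp
    have hne : ¬ V ⊆ {p} := by
      intro h
      have := tdV_point p
      rw [Subset.antisymm hpV h] at this
      omega
    rw [← vi_le_iff (irr_point p).1, SetLike.not_le_iff_exists] at hne
    obtain ⟨f, hf, hfV⟩ := hne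
    obtain ⟨W', hW', h1, h2, h3, h4⟩ := krullV (irr_point p) hV hpV f hf
    have hss : W' ⊂ V := ⟨h2, fun h => hfV (vi_anti h h3)⟩
    have h5 := tdV_lt hW' hV hss
    obtain ⟨U, hU1, hU2, hU3⟩ := ih W' hW' (by omega)
    refine ⟨Fin.snoc (α := fun _ => Set (Fin n → ℂ)) U V, ?_, ?_, ?_⟩
    · intro i
      refine Fin.lastCases ?_ (fun i => ?_) i
      · simpa using hV
      · simpa using hU1 i
    · intro i j
      refine Fin.lastCases ?_ (fun j => ?_) j
      · refine Fin.lastCases ?_ (fun i => ?_) i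
        · intro h; exact absurd h (lt_irrefl _)
        · intro _
          simp only [Fin.snoc_castSucc, Fin.snoc_last]
          refine lt_of_le_of_lt ?_ hss
          rcases eq_or_lt_of_le (Fin.le_last i) with h | h
          · rw [h]; exact hU3
          · exact (hU2 _ _ h).le.trans hU3
      · refine Fin.lastCases ?_ (fun i => ?_) i
        · intro h; exact absurd h (not_lt.2 (Fin.le_last _))
        · intro h
          simp only [Fin.snoc_castSucc]
          exact hU2 _ _ (Fin.castSucc_lt_castSucc_iff.1 h)
    · simp

lemma dim_eq {n : ℕ} {V : Set (Fin n → ℂ)} (hV : IsIrredVariety n V) : dim n V = tdV V := by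
  apply le_antisymm
  · exact csSup_le ⟨_, has_chain _ V hV rfl⟩ (fun k hk => chain_le k V hV hk)
  · exact le_csSup ⟨tdV V, fun k hk => chain_le k V hV hk⟩ (has_chain _ V hV rfl)

lemma dim_lt {n : ℕ} {V W : Set (Fin n → ℂ)} (hV : IsIrredVariety n V) (hW : IsIrredVariety n W)
    (h : V ⊂ W) : dim n V < dim n W := by
  rw [dim_eq hV, dim_eq hW]; exact tdV_lt hV hW h

lemma dim_mono {n : ℕ} {V W : Set (Fin n → ℂ)} (hV : IsIrredVariety n V) (hW : IsIrredVariety n W)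
    (h : V ⊆ W) : dim n V ≤ dim n W := by
  rcases eq_or_ssubset_of_subset h with h | h
  · rw [h]
  · exact (dim_lt hV hW h).le

lemma krull_dim {n : ℕ} {V W : Set (Fin n → ℂ)} (hV : IsIrredVariety n V) (hW : IsIrredVariety n W)
    (h : V ⊆ W) (f : MvPolynomial (Fin n) ℂ) (hf : f ∈ vanishingIdeal n V) :
    ∃ W', IsIrredVariety n W' ∧ V ⊆ W' ∧ W' ⊆ W ∧ f ∈ vanishingIdeal n W' ∧ dim n W ≤ dim n W' + 1 := by
  obtain ⟨W', h1, h2, h3, h4, h5⟩ := krullV hV hW h f hf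
  exact ⟨W', h1, h2, h3, h4, by rw [dim_eq hW, dim_eq h1]; exact h5⟩

lemma dim_point {n : ℕ} (p : Fin n → ℂ) : dim n {p} = 0 := by
  rw [dim_eq (irr_point p), tdV_point]

lemma vi_univ (n : ℕ) : vanishingIdeal n univ = ⊥ := by
  rw [eq_bot_iff]
  intro f hf
  rw [Ideal.mem_bot]
  apply MvPolynomial.funext
  intro x
  rw [hf x (mem_univ x), map_zero]

lemma alg_univ (n : ℕ) : IsAlgebraicSet n univ := ⟨∅, by ext x; simp [zeroLocus]⟩

lemma irr_univ (n : ℕ) : IsIrredVariety n univ := by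
  refine irr_of_prime (alg_univ n) univ_nonempty ?_
  rw [vi_univ]; exact Ideal.isPrime_bot

lemma dim_univ (n : ℕ) : dim n univ = n := by
  rw [dim_eq (irr_univ n), tdV, vi_univ, td_congr (AlgEquiv.quotientBot ℂ (MvPolynomial (Fin n) ℂ)), td]
  rw [MvPolynomial.trdeg_of_isDomain]; simp

lemma dim_le {n : ℕ} {V : Set (Fin n → ℂ)} (hV : IsIrredVariety n V) : dim n V ≤ n := by
  conv_rhs => rw [← dim_univ n]
  exact dim_mono hV (irr_univ n) (subset_univ _)

lemma eq_of_dim {n : ℕ} {V W : Set (Fin n → ℂ)} (hV : IsIrredVariety n V) (hW : IsIrredVariety n W)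
    (h : V ⊆ W) (hd : dim n W ≤ dim n V) : V = W := by
  rcases eq_or_ssubset_of_subset h with h | h
  · exact h
  · have := dim_lt hV hW h; omega

lemma exists_comp {n : ℕ} {V X : Set (Fin n → ℂ)} (hV : IsIrredVariety n V) (h : V ⊆ X) :
    ∃ W, IsIrredComponent n W X ∧ V ⊆ W := by
  classical
  let T : Set ℕ := {k | ∃ W, IsIrredVariety n W ∧ V ⊆ W ∧ W ⊆ X ∧ n - dim n W = k}
  have hT : T.Nonempty := ⟨_, V, hV, subset_rfl, h, rfl⟩
  obtain ⟨W, h1, h2, h3, h4⟩ := Nat.sInf_mem hT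
  refine ⟨W, ⟨h1, h3, ?_⟩, h2⟩
  intro W' hW' hWW' hX
  have h5 : sInf T ≤ n - dim n W' := Nat.sInf_le ⟨W', hW', h2.trans hWW', hX, rfl⟩
  have h6 := dim_le hW'
  have h7 := dim_le h1
  exact (eq_of_dim h1 hW' hWW' (by omega)).symm

lemma maxComp_iff {n : ℕ} {V X : Set (Fin n → ℂ)} (hV : IsIrredVariety n V) (e : ℕ) :
    MaxCompDimEq n X V e ↔ (∃ W, IsIrredVariety n W ∧ V ⊆ W ∧ W ⊆ X ∧ dim n W = e) ∧
      ∀ W, IsIrredVariety n W → V ⊆ W → W ⊆ X → dim n W ≤ e := by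
  constructor
  · rintro ⟨⟨W, h1, h2, h3⟩, h4⟩
    refine ⟨⟨W, h1.1, h2, h1.2.1, h3⟩, ?_⟩
    intro W' hW' hVW' hX
    obtain ⟨U, hU, hWU⟩ := exists_comp hW' hX
    exact (dim_mono hW' hU.1 hWU).trans (h4 U hU (hVW'.trans hWU))
  · rintro ⟨⟨W, h1, h2, h3, h4⟩, h5⟩
    refine ⟨⟨W, ⟨h1, h3, ?_⟩, h2, h4⟩, fun W' hW' hV' => h5 W' hW'.1 hV' hW'.2.1⟩
    intro W' hW' hWW' hX
    exact (eq_of_dim h1 hW' hWW' (by rw [h4]; exact h5 W' hW' (h2.trans hWW') hX)).symm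

def Xle {n : ℕ} (V : Set (Fin n → ℂ)) (m : ℕ) : Set (Fin n → ℂ) :=
  zeroLocus n {f | f ∈ vanishingIdeal n V ∧ f.totalDegree ≤ m}

lemma sub_Xle {n : ℕ} (V : Set (Fin n → ℂ)) (m : ℕ) : V ⊆ Xle V m :=
  sub_zl.2 (fun _ hf => hf.1)

lemma Xle_anti {n : ℕ} (V : Set (Fin n → ℂ)) {m m' : ℕ} (h : m ≤ m') : Xle V m' ⊆ Xle V m :=
  zl_anti (fun _ hf => ⟨hf.1, hf.2.trans h⟩)

lemma zl_span {n : ℕ} (I : Set (MvPolynomial (Fin n) ℂ)) :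
    zeroLocus n (Ideal.span I : Set (MvPolynomial (Fin n) ℂ)) = zeroLocus n I := by
  apply Subset.antisymm (zl_anti Ideal.subset_span)
  rw [sub_zl]
  have : I ⊆ vanishingIdeal n (zeroLocus n I) := sub_zl.1 subset_rfl
  exact Ideal.span_le.2 this

lemma fin_zl {n : ℕ} (T : Set (MvPolynomial (Fin n) ℂ)) :
    ∃ I : Finset (MvPolynomial (Fin n) ℂ), (I : Set _) ⊆ T ∧ zeroLocus n (I : Set _) = zeroLocus n T := by
  have h1 : (Submodule.span (MvPolynomial (Fin n) ℂ) T).FG := IsNoetherian.noetherian _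
  rw [Submodule.fg_span_iff_fg_span_finset_subset] at h1
  obtain ⟨I, h1, h2⟩ := h1
  refine ⟨I, h1, ?_⟩
  refine (zl_span _).symm.trans (Eq.trans ?_ (zl_span T))
  exact congrArg (fun J : Ideal (MvPolynomial (Fin n) ℂ) => zeroLocus n (J : Set _)) h2.symm

lemma ivt_comp {n : ℕ} {V : Set (Fin n → ℂ)} (hV : IsIrredVariety n V) (e : ℕ) (he : e ≤ n)
    (I : Finset (MvPolynomial (Fin n) ℂ)) : (∀ f ∈ I, f ∈ vanishingIdeal n V) →
    (∀ W, IsIrredVariety n W → V ⊆ W → W ⊆ zeroLocus n (I : Set _) → dim n W ≤ e) →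
    ∃ J ⊆ I, MaxCompDimEq n (zeroLocus n (J : Set _)) V e := by
  classical
  induction I using Finset.induction_on with
  | empty =>
    intro _ h
    refine ⟨∅, subset_rfl, ?_⟩
    rw [maxComp_iff hV]
    have hu : (univ : Set (Fin n → ℂ)) ⊆ zeroLocus n ((∅ : Finset (MvPolynomial (Fin n) ℂ)) : Set _) := by
      intro x _ f hf; simp at hf
    have h1 := h univ (irr_univ n) (subset_univ _) hu
    rw [dim_univ] at h1
    exact ⟨⟨univ, irr_univ n, subset_univ _, hu, by rw [dim_univ]; omega⟩, h⟩
  | insert f J hfJ ih =>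
    intro h0 h
    by_cases hJ : ∀ W, IsIrredVariety n W → V ⊆ W → W ⊆ zeroLocus n (J : Set _) → dim n W ≤ e
    · obtain ⟨J', h1, h2⟩ := ih (fun f hf => h0 f (Finset.mem_insert_of_mem hf)) hJ
      exact ⟨J', h1.trans (Finset.subset_insert _ _), h2⟩
    · push Not at hJ
      obtain ⟨W, hW, hVW, hWJ, hd⟩ := hJ
      obtain ⟨W', h1, h2, h3, h4, h5⟩ := krull_dim hV hW hVW f (h0 f (Finset.mem_insert_self _ _))
      refine ⟨insert f J, subset_rfl, ?_⟩
      rw [maxComp_iff hV]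
      have h6 : W' ⊆ zeroLocus n ((insert f J : Finset _) : Set _) := by
        intro x hx g hg
        rw [Finset.coe_insert] at hg
        rcases hg with rfl | hg
        · exact h4 x hx
        · exact hWJ (h3 hx) g hg
      refine ⟨⟨W', h1, h2, h6, ?_⟩, h⟩
      have := h W' h1 h2 h6
      omega

lemma pd_le_iff {n : ℕ} {V : Set (Fin n → ℂ)} (hV : IsIrredVariety n V) {k : ℕ} (hk : 1 ≤ k)
    (hk2 : k ≤ n - dim n V) (m : ℕ) : partialDeg n V k ≤ m ↔
    ∀ W, IsIrredVariety n W → V ⊆ W → W ⊆ Xle V m → dim n W ≤ n - k := by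
  have key : ∀ m, (∀ W, IsIrredVariety n W → V ⊆ W → W ⊆ Xle V m → dim n W ≤ n - k) →
     m ∈ { δ | ∃ I : Finset (MvPolynomial (Fin n) ℂ),
    (∀ f ∈ I, f.totalDegree ≤ δ) ∧ V ⊆ zeroLocus n ↑I ∧
      MaxCompDimEq n (zeroLocus n ↑I) V (n - k) } := by
    intro m h
    obtain ⟨I, h1, h2⟩ := fin_zl {f | f ∈ vanishingIdeal n V ∧ f.totalDegree ≤ m}
    obtain ⟨J, h3, h4⟩ := ivt_comp hV (n - k) (by omega) I (fun f hf => (h1 hf).1) (by rw [h2]; exact h)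
    exact ⟨J, fun f hf => (h1 (h3 hf)).2, sub_zl.2 (fun f hf => (h1 (h3 hf)).1), h4⟩
  rw [partialDeg, if_neg (by omega)]
  constructor
  · intro h
    have hne : { δ | ∃ I : Finset (MvPolynomial (Fin n) ℂ),
      (∀ f ∈ I, f.totalDegree ≤ δ) ∧ V ⊆ zeroLocus n ↑I ∧
      MaxCompDimEq n (zeroLocus n ↑I) V (n - k) }.Nonempty := by
      obtain ⟨I, h1, h2⟩ := fin_zl (vanishingIdeal n V : Set (MvPolynomial (Fin n) ℂ))
      refine ⟨_, key (I.sup totalDegree) ?_⟩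
      intro W hW hVW hWX
      have h3 : W ⊆ V := by
        rw [← zl_vi hV.1, ← h2]
        refine hWX.trans (zl_anti ?_)
        intro f hf
        exact ⟨h1 hf, Finset.le_sup (f := totalDegree) hf⟩
      have := dim_mono hW hV h3
      have := dim_le hV
      omega
    obtain ⟨I, h1, h2, h3⟩ := Nat.sInf_mem hne
    rw [maxComp_iff hV] at h3
    intro W hW hVW hWX
    refine h3.2 W hW hVW (hWX.trans (zl_anti ?_))
    intro f hf
    exact ⟨sub_zl.1 h2 hf, (h1 f hf).trans h⟩
  · intro h
    exact Nat.sInf_le (key m h)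

lemma pd_mono {n : ℕ} {V : Set (Fin n → ℂ)} (hV : IsIrredVariety n V) {k l : ℕ} 
    (hkl : k ≤ l) (hl : l ≤ n - dim n V) : partialDeg n V k ≤ partialDeg n V l := by
  rcases Nat.eq_zero_or_pos k with rfl | hk
  · simp [partialDeg]
  rw [pd_le_iff hV hk (hkl.trans hl)]
  intro W h1 h2 h3
  have := (pd_le_iff hV (le_trans hk hkl) hl _).1 le_rfl W h1 h2 h3
  omega

lemma Xle_zero {n : ℕ} {V : Set (Fin n → ℂ)} (hV : V.Nonempty) : Xle V 0 = univ := by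
  rw [eq_univ_iff_forall]
  rintro x f ⟨hf, hd⟩
  rw [Nat.le_zero, totalDegree_eq_zero_iff_eq_C] at hd
  obtain ⟨y, hy⟩ := hV
  have := hf y hy
  rw [hd] at this ⊢
  simpa using this

lemma pd_pos {n : ℕ} {V : Set (Fin n → ℂ)} (hV : IsIrredVariety n V) {k : ℕ} (hk : 1 ≤ k)
    (hl : k ≤ n - dim n V) : 1 ≤ partialDeg n V k := by
  by_contra h
  have := (pd_le_iff hV hk hl 0).1 (by omega) univ (irr_univ n) (subset_univ _) (by rw [Xle_zero hV.2.1])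
  rw [dim_univ] at this
  omega

lemma pd_lt {n : ℕ} {V : Set (Fin n → ℂ)} (hV : IsIrredVariety n V) {k : ℕ} (hk : 1 ≤ k)
    (hl : k ≤ n - dim n V) {m : ℕ} (hm : m < partialDeg n V k) :
    ∃ W, IsIrredComponent n W (Xle V m) ∧ V ⊆ W ∧ n - k + 1 ≤ dim n W := by
  have := mt (pd_le_iff hV hk hl m).2 (by omega)
  push Not at this
  obtain ⟨W, h1, h2, h3, h4⟩ := this
  obtain ⟨U, hU, hWU⟩ := exists_comp h1 h3
  exact ⟨U, hU, h2.trans hWU, by have := dim_mono h1 hU.1 hWU; omega⟩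

lemma comp_irr {n : ℕ} {V W : Set (Fin n → ℂ)} (hV : IsIrredVariety n V) :
    IsIrredComponent n W V ↔ W = V := by
  constructor
  · rintro ⟨h1, h2, h3⟩
    exact (h3 V hV h2 subset_rfl).symm
  · rintro rfl
    exact ⟨hV, subset_rfl, fun W' _ h1 h2 => Subset.antisymm h2 h1⟩

lemma deltaSet_le {n : ℕ} {V W : Set (Fin n → ℂ)} {m : ℕ} (hW : IsIrredComponent n W (Xle V m)) :
    deltaSet n W ≤ m := by
  obtain ⟨I, h1, h2⟩ := fin_zl {f | f ∈ vanishingIdeal n V ∧ f.totalDegree ≤ m}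
  refine Nat.sInf_le ⟨I, fun f hf => (h1 hf).2, ?_⟩
  intro W' hW'
  rw [comp_irr hW.1] at hW'
  rw [h2, hW']
  exact hW

lemma algOfDim_irr {n : ℕ} {V : Set (Fin n → ℂ)} (hV : IsIrredVariety n V) : IsAlgSetOfDim n V (dim n V) :=
  ⟨hV.1, hV.2.1, fun W hW => by rw [(comp_irr hV).1 hW]⟩

lemma degreeSum_irr {n : ℕ} {V : Set (Fin n → ℂ)} (hV : IsIrredVariety n V) : degreeSum n V = degree n V := by
  rw [degreeSum]
  have : {W | IsIrredComponent n W V} = {V} := by ext W; exact comp_irr hV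
  rw [this]
  simp

lemma comp_top {n : ℕ} {V : Set (Fin n → ℂ)} (hV : IsIrredVariety n V) :
    IsIrredComponent n V (Xle V (partialDeg n V (n - dim n V))) := by
  refine ⟨hV, sub_Xle _ _, ?_⟩
  intro W hW hVW hX
  refine (eq_of_dim hV hW hVW ?_).symm
  have hd := dim_le hV
  rcases Nat.eq_zero_or_pos (n - dim n V) with h | h
  · have := dim_le hW; omega
  · have := (pd_le_iff hV h le_rfl _).1 le_rfl W hW hVW hX
    omega

lemma adm_le {n : ℕ} {V : Set (Fin n → ℂ)} {i : ℕ} (h : Admissible n V i) : i ≤ n - dim n V := by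
  by_contra hi
  rw [Admissible, partialDegE, partialDegE, if_neg hi, if_neg (by omega)] at h
  exact absurd h (by
    have : ((2 * i : ℕ) : ℕ∞) ≠ 0 := by
      simp; omega
    rw [ENat.mul_top this]; simp)

lemma std_indep {ι M : Type*} [LinearOrder ι] [AddCommGroup M] [Module ℂ M] (v : ι → M) :
    LinearIndependent ℂ (fun i : {i | v i ∉ Submodule.span ℂ (v '' {j | j < i})} => v i) := by
  classical
  rw [linearIndependent_iff']
  intro s
  induction s using Finset.induction_on_max with
  | empty => simp
  | insert a s hs ih =>
    intro g hg
    have ha : a ∉ s := fun h => lt_irrefl _ (hs a h)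
    rw [Finset.sum_insert ha] at hg
    have hga : g a = 0 := by
      by_contra hne
      apply a.2
      have : v a = - (g a)⁻¹ • ∑ i ∈ s, g i • v i := by
        rw [eq_neg_of_add_eq_zero_right hg, smul_neg, neg_smul, neg_neg, smul_smul, inv_mul_cancel₀ hne, one_smul]
      rw [this]
      apply Submodule.smul_mem
      apply Submodule.sum_mem
      intro i hi
      exact Submodule.smul_mem _ _ (Submodule.subset_span ⟨i, hs i hi, rfl⟩)
    rw [hga, zero_smul, zero_add] at hg
    intro i hi
    rcases Finset.mem_insert.1 hi with rfl | hi
    · exact hga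
    · exact ih g hg i hi

lemma std_span {ι M : Type*} [LinearOrder ι] [WellFoundedLT ι] [AddCommGroup M] [Module ℂ M] (v : ι → M) (i : ι) :
    v i ∈ Submodule.span ℂ (v '' {j | j ≤ i ∧ v j ∉ Submodule.span ℂ (v '' {k | k < j})}) := by
  induction i using WellFoundedLT.induction with
  | ind i ih =>
    by_cases h : v i ∈ Submodule.span ℂ (v '' {k | k < i})
    · refine (Submodule.span_le.2 ?_) h
      rintro _ ⟨k, hk, rfl⟩
      refine Submodule.span_mono (image_mono ?_) (ih k hk)
      rintro j ⟨h1, h2⟩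
      exact ⟨h1.trans (le_of_lt hk), h2⟩
    · exact Submodule.subset_span ⟨i, ⟨le_rfl, h⟩, rfl⟩

/-- image of polys of degree ≤ m -/
def FV {n : ℕ} (V : Set (Fin n → ℂ)) (m : ℕ) : Submodule ℂ (MvPolynomial (Fin n) ℂ ⧸ vanishingIdeal n V) :=
  Submodule.map (Ideal.Quotient.mkₐ ℂ (vanishingIdeal n V)).toLinearMap
      (restrictTotalDegree (Fin n) ℂ m)

lemma mem_FV {n : ℕ} {V : Set (Fin n → ℂ)} {m : ℕ} {s : MvPolynomial (Fin n) ℂ ⧸ vanishingIdeal n V} :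
    s ∈ FV V m ↔ ∃ f : MvPolynomial (Fin n) ℂ, f.totalDegree ≤ m ∧ Ideal.Quotient.mk _ f = s := by
  rw [FV, Submodule.mem_map]
  simp only [mem_restrictTotalDegree]
  rfl

instance FV_fin {n : ℕ} (V : Set (Fin n → ℂ)) (m : ℕ) : Module.Finite ℂ (FV V m) := by
  unfold FV; infer_instance

lemma hilbert_eq {n : ℕ} (V : Set (Fin n → ℂ)) (m : ℕ) : hilbert n V m = Module.finrank ℂ (FV V m) := rfl

/-- monomial image -/
def mon {n : ℕ} (V : Set (Fin n → ℂ)) (α : DegLex (Fin n →₀ ℕ)) : MvPolynomial (Fin n) ℂ ⧸ vanishingIdeal n V :=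
  Ideal.Quotient.mk _ (monomial (ofDegLex α) 1)

lemma FV_span {n : ℕ} (V : Set (Fin n → ℂ)) (m : ℕ) :
    FV V m = Submodule.span ℂ (mon V '' {α | (ofDegLex α).degree ≤ m}) := by
  rw [FV, restrictTotalDegree, restrictSupport_eq_span, Submodule.map_span, image_image]
  rfl

def Std {n : ℕ} (V : Set (Fin n → ℂ)) : Set (DegLex (Fin n →₀ ℕ)) :=
  {α | mon V α ∉ Submodule.span ℂ (mon V '' {β | β < α})}

lemma std_down {n : ℕ} {V : Set (Fin n → ℂ)} {α β : Fin n →₀ ℕ} (h : toDegLex (α + β) ∈ Std V) : toDegLex α ∈ Std V := by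
  intro h1
  apply h
  have h2 : mon V (toDegLex (α + β)) = LinearMap.mulLeft ℂ (mon V (toDegLex β)) (mon V (toDegLex α)) := by
    rw [LinearMap.mulLeft_apply, mon, mon, mon, ← map_mul, monomial_mul]
    simp [add_comm]
  rw [h2]
  have h3 := Submodule.mem_map_of_mem (f := LinearMap.mulLeft ℂ (mon V (toDegLex β))) h1
  rw [Submodule.map_span, image_image] at h3
  refine Submodule.span_mono ?_ h3
  rintro _ ⟨γ, hγ, rfl⟩
  refine ⟨toDegLex β + γ, ?_, ?_⟩
  · change toDegLex β + γ < toDegLex (α + β)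
    rw [toDegLex_add, add_comm (toDegLex α)]
    exact add_lt_add_right hγ _
  · dsimp only
    rw [LinearMap.mulLeft_apply, mon, mon, mon, ← map_mul, monomial_mul]
    simp [ofDegLex_add]

def StdLe {n : ℕ} (V : Set (Fin n → ℂ)) (m : ℕ) : Set (DegLex (Fin n →₀ ℕ)) :=
  {α | α ∈ Std V ∧ (ofDegLex α).degree ≤ m}

lemma stdLe_fin {n : ℕ} (V : Set (Fin n → ℂ)) (m : ℕ) : (StdLe V m).Finite :=
  (Finsupp.finite_of_degree_le (σ := Fin n) m).subset (fun _ h => h.2)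

lemma deg_le_of_le {n : ℕ} {α β : DegLex (Fin n →₀ ℕ)} (h : α ≤ β) : (ofDegLex α).degree ≤ (ofDegLex β).degree :=
  Finsupp.DegLex.monotone_degree h

lemma stdLe_indep {n : ℕ} (V : Set (Fin n → ℂ)) (m : ℕ) :
    LinearIndependent ℂ (fun α : StdLe V m => mon V α) :=
  (std_indep (mon V)).comp (fun α : StdLe V m => (⟨α.1, α.2.1⟩ : {i | mon V i ∉ Submodule.span ℂ (mon V '' {j | j < i})}))
    (fun a b h => by simpa [Subtype.ext_iff] using h)

lemma stdLe_span {n : ℕ} (V : Set (Fin n → ℂ)) (m : ℕ) :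
    FV V m = Submodule.span ℂ (Set.range (fun α : StdLe V m => mon V α)) := by
  rw [FV_span]
  apply le_antisymm
  · rw [Submodule.span_le]
    rintro _ ⟨α, hα, rfl⟩
    refine Submodule.span_mono ?_ (std_span (mon V) α)
    rintro _ ⟨β, ⟨h1, h2⟩, rfl⟩
    exact ⟨⟨β, h2, (deg_le_of_le h1).trans hα⟩, rfl⟩
  · apply Submodule.span_mono
    rintro _ ⟨α, rfl⟩
    exact ⟨α, α.2.2, rfl⟩

lemma hilbert_ncard {n : ℕ} (V : Set (Fin n → ℂ)) (m : ℕ) : hilbert n V m = (StdLe V m).ncard := by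
  haveI := (stdLe_fin V m).fintype
  rw [hilbert_eq, stdLe_span, finrank_span_eq_card (stdLe_indep V m), ← Nat.card_eq_fintype_card, Nat.card_coe_set_eq]

lemma hilbert_mono {n : ℕ} (V : Set (Fin n → ℂ)) {m m' : ℕ} (h : m ≤ m') : hilbert n V m ≤ hilbert n V m' := by
  rw [hilbert_ncard, hilbert_ncard]
  exact Set.ncard_le_ncard (fun α hα => ⟨hα.1, hα.2.trans h⟩) (stdLe_fin V m')

lemma hilbert_double {n : ℕ} (V : Set (Fin n → ℂ)) (m : ℕ) : hilbert n V (2 * m) ≤ 2 ^ n * hilbert n V m := by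
  classical
  rw [hilbert_ncard, hilbert_ncard]
  have h2 : (2:ℕ) ^ n = (univ : Set (Fin n → Fin 2)).ncard := by
    rw [Set.ncard_univ]; simp
  rw [h2, ← Set.ncard_prod]
  let half : (Fin n →₀ ℕ) → (Fin n →₀ ℕ) := fun α => α.mapRange (fun k => k / 2) (by simp)
  let par : (Fin n →₀ ℕ) → (Fin n → Fin 2) := fun α i => ⟨α i % 2, Nat.mod_lt _ (by norm_num)⟩
  refine Set.ncard_le_ncard_of_injOn (fun α => (par (ofDegLex α), toDegLex (half (ofDegLex α)))) ?_ ?_ (Set.finite_univ.prod (stdLe_fin V m))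
  · rintro α ⟨h1, h3⟩
    refine ⟨mem_univ _, ?_, ?_⟩
    · have : half (ofDegLex α) + (ofDegLex α - half (ofDegLex α)) = ofDegLex α := by
        ext i
        simp [half]; omega
      apply std_down (β := ofDegLex α - half (ofDegLex α))
      rw [this]; exact h1
    · have : 2 * (half (ofDegLex α)).degree ≤ (ofDegLex α).degree := by
        rw [Finsupp.degree_eq_sum, Finsupp.degree_eq_sum, Finset.mul_sum]
        apply Finset.sum_le_sum
        intro i _
        simp [half]; omega
      simp only [ofDegLex_toDegLex]
      omega
  · intro α _ β _ h
    simp only [Prod.mk.injEq] at h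
    apply ofDegLex_injective
    ext i
    have h3 := congrFun h.1 i
    have h4 := DFunLike.congr_fun (toDegLex_injective h.2) i
    simp only [par, half, Fin.mk.injEq, Finsupp.mapRange_apply] at h3 h4
    omega

lemma hilbert_pow {n : ℕ} (V : Set (Fin n → ℂ)) (m j : ℕ) : hilbert n V (2 ^ j * m) ≤ (2 ^ n) ^ j * hilbert n V m := by
  induction j with
  | zero => simp
  | succ j ih =>
    rw [pow_succ, mul_comm (2^j) 2, mul_assoc]
    refine (hilbert_double V _).trans ?_
    rw [pow_succ, mul_comm ((2^n)^j), mul_assoc]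
    exact Nat.mul_le_mul_left _ ih

lemma hilbert_anti {n : ℕ} {V W : Set (Fin n → ℂ)} (h : V ⊆ W) (m : ℕ) : hilbert n V m ≤ hilbert n W m := by
  let φ : (MvPolynomial (Fin n) ℂ ⧸ vanishingIdeal n W) →ₐ[ℂ] (MvPolynomial (Fin n) ℂ ⧸ vanishingIdeal n V) :=
    Ideal.Quotient.factorₐ ℂ (vi_anti h)
  have : FV V m = (FV W m).map φ.toLinearMap := by
    rw [FV, FV, ← Submodule.map_comp]
    rfl
  rw [hilbert_eq, hilbert_eq, this]
  exact Submodule.finrank_map_le _ _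

lemma hilbert_congr {n : ℕ} {V W : Set (Fin n → ℂ)} (h : V ⊆ W) (m : ℕ) (hW : W ⊆ Xle V m) : hilbert n V m = hilbert n W m := by
  refine le_antisymm (hilbert_anti h m) ?_
  let φ : (MvPolynomial (Fin n) ℂ ⧸ vanishingIdeal n W) →ₐ[ℂ] (MvPolynomial (Fin n) ℂ ⧸ vanishingIdeal n V) :=
    Ideal.Quotient.factorₐ ℂ (vi_anti h)
  have hφ : ∀ x ∈ FV W m, φ.toLinearMap x ∈ FV V m := by
    intro x hx
    obtain ⟨f, hf, rfl⟩ := mem_FV.1 hx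
    exact mem_FV.2 ⟨f, hf, rfl⟩
  rw [hilbert_eq, hilbert_eq]
  apply LinearMap.finrank_le_finrank_of_injective (f := φ.toLinearMap.restrict hφ)
  rw [← LinearMap.ker_eq_bot, LinearMap.ker_eq_bot']
  rintro ⟨x, hx⟩ hx0
  obtain ⟨f, hf, rfl⟩ := mem_FV.1 hx
  have h1 : Ideal.Quotient.mk (vanishingIdeal n V) f = 0 := congrArg Subtype.val hx0
  rw [Ideal.Quotient.eq_zero_iff_mem] at h1
  apply Subtype.ext
  refine Ideal.Quotient.eq_zero_iff_mem.2 ?_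
  intro y hy
  exact hW hy f ⟨h1, hf⟩

lemma hilbert_pos {n : ℕ} {V : Set (Fin n → ℂ)} (hV : V.Nonempty) (m : ℕ) : 1 ≤ hilbert n V m := by
  rw [hilbert_eq, Nat.one_le_iff_ne_zero, ← Nat.pos_iff_ne_zero, Module.finrank_pos_iff]
  rw [Submodule.nontrivial_iff_ne_bot, Submodule.ne_bot_iff]
  refine ⟨1, mem_FV.2 ⟨1, by simp, rfl⟩, ?_⟩
  intro h
  obtain ⟨x, hx⟩ := hV
  have := (Ideal.Quotient.eq_zero_iff_mem.1 (show Ideal.Quotient.mk (vanishingIdeal n V) 1 = 0 from h)) x hx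
  simp at this

lemma alg_union {n : ℕ} {V W : Set (Fin n → ℂ)} (hV : IsAlgebraicSet n V) (hW : IsAlgebraicSet n W) :
    IsAlgebraicSet n (V ∪ W) := by
  refine ⟨(vanishingIdeal n (V ∪ W) : Set _), Subset.antisymm (sub_zl.2 subset_rfl) ?_⟩
  intro x hx
  by_contra hcon
  rw [mem_union, not_or] at hcon
  obtain ⟨h1, h2⟩ := hcon
  rw [← zl_vi hV] at h1
  rw [← zl_vi hW] at h2
  simp only [zeroLocus, mem_ofPred_eq, not_forall] at h1 h2
  obtain ⟨f, hf, hfx⟩ := h1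
  obtain ⟨g, hg, hgx⟩ := h2
  have : eval x (f * g) = 0 := hx (f * g) (by
    rintro y (hy | hy)
    · rw [map_mul, hf y hy, zero_mul]
    · rw [map_mul, hg y hy, mul_zero])
  rw [map_mul, mul_eq_zero] at this
  tauto

lemma alg_finite {n : ℕ} {X : Set (Fin n → ℂ)} (hX : X.Finite) : IsAlgebraicSet n X := by
  induction X, hX using Set.Finite.induction_on with
  | empty => exact ⟨{1}, by ext x; simp [zeroLocus]⟩
  | @insert a s _ _ ih =>
    rw [Set.insert_eq]
    exact alg_union (irr_point a).1 ih

lemma irr_finite {n : ℕ} {X W : Set (Fin n → ℂ)} (hX : X.Finite) (hW : IsIrredVariety n W) : W ⊆ X →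
    ∃ p ∈ X, W = {p} := by
  induction X, hX using Set.Finite.induction_on with
  | empty => 
    intro h
    obtain ⟨x, hx⟩ := hW.2.1
    exact absurd (h hx) (notMem_empty x)
  | @insert a s hs hsf ih =>
    intro h
    rw [Set.insert_eq] at h
    rcases hW.2.2 _ _ (irr_point a).1 (alg_finite hsf) h with h | h
    · exact ⟨a, mem_insert _ _, hW.2.1.subset_singleton_iff.1 h⟩
    · obtain ⟨p, hp, h⟩ := ih h
      exact ⟨p, mem_insert_of_mem _ hp, h⟩

lemma comp_finite {n : ℕ} {X : Set (Fin n → ℂ)} (hX : X.Finite) :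
    {W | IsIrredComponent n W X} = (fun p => ({p} : Set (Fin n → ℂ))) '' X := by
  ext W
  constructor
  · rintro ⟨h1, h2, _⟩
    obtain ⟨p, hp, h⟩ := irr_finite hX h1 h2
    exact ⟨p, hp, h.symm⟩
  · rintro ⟨p, hp, rfl⟩
    refine ⟨irr_point p, singleton_subset_iff.2 hp, ?_⟩
    intro W' hW' h1 h2
    obtain ⟨q, hq, rfl⟩ := irr_finite hX hW' h2
    rw [singleton_subset_singleton] at h1
    rw [h1]

lemma degree_point {n : ℕ} (p : Fin n → ℂ) : degree n {p} = 1 := by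
  apply le_antisymm
  · apply csSup_le'
    rintro m ⟨L, _, _, rfl⟩
    exact (Set.ncard_le_ncard inter_subset_left (finite_singleton p)).trans (by simp)
  · refine le_csSup ⟨1, ?_⟩ ⟨⊤, ?_, ?_, ?_⟩
    · rintro m ⟨L, _, _, rfl⟩
      exact (Set.ncard_le_ncard inter_subset_left (finite_singleton p)).trans (by simp)
    · rw [dim_point, AffineSubspace.direction_top, finrank_top]; simp
    · exact (finite_singleton p).inter_of_left _
    · simp

lemma degreeSum_finite {n : ℕ} {X : Set (Fin n → ℂ)} (hX : X.Finite) : degreeSum n X = X.ncard := by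
  rw [degreeSum, comp_finite hX, finsum_mem_image (fun a _ b _ h => by simpa using h)]
  rw [finsum_mem_congr rfl (g := fun _ => 1) (fun p _ => degree_point p)]
  rw [finsum_mem_eq_finite_toFinset_sum _ hX, Finset.sum_const, smul_eq_mul, mul_one, Set.ncard_eq_toFinset_card _ hX]

lemma aff_sep {n : ℕ} (L : AffineSubspace ℂ (Fin n → ℂ)) {x0 x : Fin n → ℂ} (h0 : x0 ∈ L) (hx : x ∉ L) :
    ∃ f : MvPolynomial (Fin n) ℂ, f.totalDegree ≤ 1 ∧ (∀ y ∈ L, eval y f = 0) ∧ eval x f ≠ 0 := by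
  have h1 : x - x0 ∉ L.direction := by
    intro h
    apply hx
    have := AffineSubspace.vadd_mem_of_mem_direction h h0
    simpa using this
  obtain ⟨φ, h2, h3⟩ := Submodule.exists_le_ker_of_notMem h1
  have hev : ∀ y, eval y (∑ i, C (φ (Pi.single i 1)) * (X i - C (x0 i))) = φ (y - x0) := by
    intro y
    conv_rhs => rw [pi_eq_sum_univ' (y - x0), map_sum]
    simp only [map_sum, map_mul, eval_C, map_sub, eval_X, map_smul, smul_eq_mul]
    apply Finset.sum_congr rfl
    intro i _
    rw [mul_comm]
    congr 2
  refine ⟨∑ i, C (φ (Pi.single i 1)) * (X i - C (x0 i)), ?_, ?_, ?_⟩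
  · apply totalDegree_finsetSum_le
    intro i _
    refine (totalDegree_mul _ _).trans ?_
    rw [totalDegree_C, zero_add]
    refine (totalDegree_sub _ _).trans ?_
    simp
  · intro y hy
    rw [hev]
    exact h3 (AffineSubspace.vsub_mem_direction hy h0)
  · rw [hev]; exact h2

lemma deg_bdd {n : ℕ} {c0 : ℝ} (hc0 : 0 < c0) (hCP : ChardinPhilippon n c0) {V : Set (Fin n → ℂ)} (hV : IsIrredVariety n V) :
    BddAbove { m | ∃ L : AffineSubspace ℂ (Fin n → ℂ),
    Module.finrank ℂ L.direction = n - dim n V ∧ (V ∩ ↑L).Finite ∧ (V ∩ ↑L).ncard = m } := by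
  obtain ⟨I, h1, h2⟩ := fin_zl (vanishingIdeal n V : Set (MvPolynomial (Fin n) ℂ))
  rw [zl_vi hV.1] at h2
  set K := max (I.sup totalDegree) 1 with hK
  refine ⟨⌈(hilbert n V (2 * n * K) : ℝ) / c0⌉₊, ?_⟩
  rintro m ⟨L, _, hfin, rfl⟩
  set X := V ∩ (L : Set (Fin n → ℂ)) with hX
  rcases X.eq_empty_or_nonempty with he | hne
  · rw [he]; simp
  obtain ⟨x0, hx0⟩ := hne
  have hXle : Xle X K = X := by
    refine Subset.antisymm ?_ (sub_Xle _ _)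
    intro y hy
    refine ⟨?_, ?_⟩
    · rw [← h2]
      intro f hf
      exact hy f ⟨vi_anti inter_subset_left (h1 hf), (Finset.le_sup (f := totalDegree) hf).trans (le_max_left _ _)⟩
    · by_contra hyL
      obtain ⟨f, hf1, hf2, hf3⟩ := aff_sep L hx0.2 hyL
      exact hf3 (hy f ⟨fun z hz => hf2 z hz.2, hf1.trans (le_max_right _ _)⟩)
  have hds : deltaSet n X ≤ K := by
    obtain ⟨I', h3, h4⟩ := fin_zl {f | f ∈ vanishingIdeal n X ∧ f.totalDegree ≤ K}
    refine Nat.sInf_le ⟨I', fun f hf => (h3 hf).2, ?_⟩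
    intro W hW
    rw [h4]
    change IsIrredComponent n W (Xle X K)
    rw [hXle]; exact hW
  have h5 := hCP X 0 ⟨alg_finite hfin, ⟨x0, hx0⟩, fun W hW => by
    obtain ⟨p, _, h⟩ := irr_finite hfin hW.1 hW.2.1
    rw [h, dim_point]⟩ (2 * n * K) (by rw [Nat.sub_zero]; exact Nat.mul_le_mul_left _ hds)
  rw [degreeSum_finite hfin, pow_zero, mul_one] at h5
  have h6 : (hilbert n X (2 * n * K) : ℝ) ≤ hilbert n V (2 * n * K) := by
    exact_mod_cast hilbert_anti inter_subset_left _
  rw [← Nat.cast_le (α := ℝ)]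
  refine le_trans ?_ (Nat.le_ceil _)
  rw [le_div_iff₀ hc0, mul_comm]
  linarith

lemma le_degree {n : ℕ} {c0 : ℝ} (hc0 : 0 < c0) (hCP : ChardinPhilippon n c0) {V : Set (Fin n → ℂ)} (hV : IsIrredVariety n V)
    (L : AffineSubspace ℂ (Fin n → ℂ)) (hL : Module.finrank ℂ L.direction = n - dim n V) (hf : (V ∩ ↑L).Finite) :
    (V ∩ ↑L).ncard ≤ degree n V :=
  le_csSup (deg_bdd hc0 hCP hV) ⟨L, hL, hf, rfl⟩

lemma hilbert_point {n : ℕ} (p : Fin n → ℂ) (m : ℕ) : hilbert n {p} m ≤ 1 := by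
  rw [hilbert_eq]
  refine finrank_le_one ⟨1, mem_FV.2 ⟨1, by simp, rfl⟩⟩ ?_
  rintro ⟨w, hw⟩
  obtain ⟨f, hf, rfl⟩ := mem_FV.1 hw
  refine ⟨eval p f, Subtype.ext ?_⟩
  change eval p f • (1 : MvPolynomial (Fin n) ℂ ⧸ vanishingIdeal n {p}) = _
  rw [← Algebra.algebraMap_eq_smul_one]
  change Ideal.Quotient.mk (vanishingIdeal n {p}) (C (eval p f)) = _
  rw [Ideal.Quotient.eq]
  rintro x rfl
  simp

lemma c0_le_one {n : ℕ} {c0 : ℝ} (hCP : ChardinPhilippon n c0) : c0 ≤ 1 := by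
  have h := hCP {0} 0 (by have := algOfDim_irr (irr_point (0 : Fin n → ℂ)); rwa [dim_point] at this) _ le_rfl
  rw [degreeSum_irr (irr_point _), degree_point] at h
  have h2 : (hilbert n {0} (2 * (n - 0) * deltaSet n {0}) : ℝ) ≤ 1 := by
    exact_mod_cast hilbert_point _ _
  simp only [pow_zero, mul_one, Nat.cast_one] at h
  linarith

/-- Taylor shift hom -/
def tay {e : ℕ} (c : Fin e → ℂ) : MvPolynomial (Fin e) ℂ →ₐ[ℂ] Polynomial (MvPolynomial (Fin e) ℂ) :=
  aeval (fun i => Polynomial.C (C (c i)) + Polynomial.X * Polynomial.C (X i))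

def Ord {e : ℕ} (c : Fin e → ℂ) (r : ℕ) (a : MvPolynomial (Fin e) ℂ) : Prop := Polynomial.X ^ r ∣ tay c a

lemma tay_coeff {e : ℕ} (c : Fin e → ℂ) (a : MvPolynomial (Fin e) ℂ) : (tay c a).coeff 0 = C (eval c a) := by
  have : (Polynomial.constantCoeff.comp (tay c).toRingHom) = (C.comp (eval c) : MvPolynomial (Fin e) ℂ →+* MvPolynomial (Fin e) ℂ) := by
    apply MvPolynomial.ringHom_ext
    · intro z; simp [tay, MvPolynomial.algebraMap_eq]
      
    · intro i; simp [tay]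
  exact RingHom.congr_fun this a

lemma ord_one {e : ℕ} {c : Fin e → ℂ} {a : MvPolynomial (Fin e) ℂ} : Ord c 1 a ↔ eval c a = 0 := by
  rw [Ord, pow_one, Polynomial.X_dvd_iff, tay_coeff]
  simp

lemma ord_mul_unit {e : ℕ} {c : Fin e → ℂ} {a h : MvPolynomial (Fin e) ℂ} {r : ℕ} (hh : eval c h ≠ 0)
    (H : Ord c r (h * a)) : Ord c r a := by
  rw [Ord, map_mul] at H
  refine Prime.pow_dvd_of_dvd_mul_left Polynomial.prime_X r ?_ H
  rw [Polynomial.X_dvd_iff, tay_coeff]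
  simpa using hh

lemma ord_div {e : ℕ} {c : Fin e → ℂ} {a : MvPolynomial (Fin e) ℂ} {r : ℕ} (i : Fin e)
    (H : Ord c (r + 1) ((X i - C (c i)) * a)) : Ord c r a := by
  have h1 : tay c (X i - C (c i)) = Polynomial.X * Polynomial.C (X i) := by
    simp [tay, ← MvPolynomial.algebraMap_eq]
  rw [Ord, map_mul, h1, pow_succ', mul_assoc] at H
  have H := (mul_dvd_mul_iff_left Polynomial.X_ne_zero).1 H
  refine Prime.pow_dvd_of_dvd_mul_left Polynomial.prime_X r ?_ H
  rw [Polynomial.X_dvd_iff]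
  simp

/-- restriction to first coordinate -/
def rst {e : ℕ} (z : ℂ) : MvPolynomial (Fin (e+1)) ℂ →ₐ[ℂ] MvPolynomial (Fin e) ℂ :=
  aeval (Fin.cons (C z) X)

lemma aeval_deg_le {σ τ : Type*} {R : Type*} [CommRing R] (g : σ → MvPolynomial τ R) (hg : ∀ i, (g i).totalDegree ≤ 1)
    (f : MvPolynomial σ R) : (aeval g f).totalDegree ≤ f.totalDegree := by
  rw [aeval_def, eval₂_eq]
  apply totalDegree_finsetSum_le
  intro d hd
  refine (totalDegree_mul _ _).trans ?_
  rw [MvPolynomial.algebraMap_eq, totalDegree_C, zero_add]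
  refine (totalDegree_finsetProd _ _).trans ?_
  refine le_trans ?_ (le_totalDegree hd)
  apply Finset.sum_le_sum
  intro i _
  refine (totalDegree_pow _ _).trans ?_
  calc _ ≤ d i * 1 := Nat.mul_le_mul_left _ (hg i)
    _ = _ := mul_one _

lemma rst_deg {e : ℕ} (z : ℂ) (a : MvPolynomial (Fin (e+1)) ℂ) : (rst z a).totalDegree ≤ a.totalDegree := by
  apply aeval_deg_le
  intro i
  refine Fin.cases ?_ (fun i => ?_) i
  · simp
  · simp

lemma rst_ord {e : ℕ} (z : ℂ) (c : Fin e → ℂ) (r : ℕ) (a : MvPolynomial (Fin (e+1)) ℂ) (h : Ord (Fin.cons z c : Fin (e+1) → ℂ) r a) :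
    Ord c r (rst z a) := by
  have : (Polynomial.mapAlgHom (rst (e := e) 0)).comp (tay (Fin.cons z c : Fin (e+1) → ℂ)) = (tay c).comp (rst z) := by
    apply MvPolynomial.algHom_ext
    intro i
    refine Fin.cases ?_ (fun i => ?_) i
    · simp [tay, rst, MvPolynomial.algebraMap_eq]
      
    · simp [tay, rst]
  have h2 := map_dvd (Polynomial.mapAlgHom (rst (e := e) 0)) h
  rw [map_pow] at h2
  have h3 := AlgHom.congr_fun this a
  simp only [AlgHom.comp_apply] at h3
  rw [h3] at h2
  simpa [Ord] using h2

lemma rst_dvd {e : ℕ} (z : ℂ) (a : MvPolynomial (Fin (e+1)) ℂ) (h : rst z a = 0) : (X 0 - C z) ∣ a := by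
  have : ∀ a : MvPolynomial (Fin (e+1)) ℂ, (X 0 - C z) ∣ a - rename Fin.succ (rst z a) := by
    intro a
    induction a using MvPolynomial.induction_on with
    | C x => simp [rst, MvPolynomial.algebraMap_eq]
    | add p q hp hq =>
      have := dvd_add hp hq
      simp only [map_add]
      convert this using 1; ring
    | mul_X p i hp =>
      simp only [map_mul]
      have h2 : (X 0 - C z : MvPolynomial (Fin (e+1)) ℂ) ∣ X i - rename Fin.succ (rst z (X i)) := by
        refine Fin.cases ?_ (fun i => ?_) i
        · simp [rst]
        · simp [rst]
      have := dvd_add (dvd_mul_of_dvd_left hp (X i)) (dvd_mul_of_dvd_right h2 (rename Fin.succ (rst z p)))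
      convert this using 1; ring
  have h2 := this a
  rwa [h, map_zero, sub_zero] at h2

lemma xsub_ne {e : ℕ} (i : Fin e) (z : ℂ) : (X i - C z : MvPolynomial (Fin e) ℂ) ≠ 0 := by
  intro h
  have := congrArg (eval (fun _ => z + 1)) h
  simp at this

lemma xsub_deg {e : ℕ} (i : Fin e) (z : ℂ) : (X i - C z : MvPolynomial (Fin e) ℂ).totalDegree = 1 := by
  apply le_antisymm
  · refine (totalDegree_sub _ _).trans ?_
    simp
  · by_contra h
    have h0 : (X i - C z : MvPolynomial (Fin e) ℂ).totalDegree = 0 := by omega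
    rw [totalDegree_eq_zero_iff_eq_C] at h0
    have h1 := congrArg (eval (fun _ => z)) h0
    have h2 := congrArg (eval (fun _ => z + 1)) h0
    simp only [eval_C, map_sub, eval_X] at h1 h2
    rw [← h1] at h2
    simp at h2

lemma mult_sz (e : ℕ) : ∀ (N r : ℕ) (G : Fin e → Finset ℂ), (∀ i, (G i).card = N) → ∀ a : MvPolynomial (Fin e) ℂ,
    a.totalDegree < r * N → (∀ c : Fin e → ℂ, (∀ i, c i ∈ G i) → Ord c r a) → a = 0 := by
  induction e with
  | zero =>
    intro N r G hG a ha h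
    have h1 := h Fin.elim0 (fun i => i.elim0)
    obtain ⟨z, rfl⟩ := C_surjective (Fin 0) a
    have hr : 1 ≤ r := by
      rcases Nat.eq_zero_or_pos r with rfl | hr
      · simp at ha
      · exact hr
    have h2 : Ord (Fin.elim0 : Fin 0 → ℂ) 1 (C z) := dvd_trans (pow_dvd_pow _ hr) h1
    rw [ord_one, eval_C] at h2
    rw [h2, map_zero]
  | succ e ih =>
    intro N r0 G hG
    have key : ∀ s : ℕ, ∀ r : ℂ → ℕ, ∑ z ∈ G 0, r z = s → ∀ a : MvPolynomial (Fin (e+1)) ℂ,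
      a.totalDegree < s → (∀ c : Fin (e+1) → ℂ, (∀ i, c i ∈ G i) → Ord c (r (c 0)) a) → a = 0 := by
      classical
      intro s
      induction s with
      | zero => intro r _ a ha; omega
      | succ s ihs =>
        intro r hr a ha h
        have hne : (G 0).Nonempty := by
          rw [Finset.nonempty_iff_ne_empty]
          intro h0; rw [h0] at hr; simp at hr
        obtain ⟨z, hz, hmax⟩ := Finset.exists_max_image (G 0) r hne
        have hle : s + 1 ≤ r z * N := by
          rw [← hr, ← hG 0, mul_comm]
          exact Finset.sum_le_card_nsmul _ _ _ hmax
        have h0 : rst z a = 0 := by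
          refine ih N (r z) (fun i => G i.succ) (fun i => hG _) _ (lt_of_le_of_lt (rst_deg z a) (by omega)) ?_
          intro c hc
          apply rst_ord
          have := h (Fin.cons z c) (by
            intro i
            refine Fin.cases ?_ (fun i => ?_) i
            · simpa using hz
            · simpa using hc i)
          simpa using this
        obtain ⟨b, rfl⟩ := rst_dvd z a h0
        by_cases hb : b = 0
        · rw [hb, mul_zero]
        have hd : ((X 0 - C z) * b : MvPolynomial (Fin (e+1)) ℂ).totalDegree = 1 + b.totalDegree := by
          rw [totalDegree_mul_of_isDomain (xsub_ne 0 z) hb, xsub_deg]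
        have hrz : 1 ≤ r z := by
          by_contra hcon
          have : r z = 0 := by omega
          rw [this] at hle; omega
        exfalso
        apply hb
        refine ihs (Function.update r z (r z - 1)) ?_ b (by omega) ?_
        · rw [← Finset.add_sum_erase _ _ hz] at hr
          rw [← Finset.add_sum_erase _ _ hz]
          rw [Function.update_self, Finset.sum_congr rfl (g := fun x => r x)]
          · omega
          · intro x hx
            rw [Function.update_of_ne (Finset.ne_of_mem_erase hx)]
        · intro c hc
          have h3 := h c hc
          by_cases hcz : c 0 = z
          · rw [hcz, Function.update_self]
            rw [hcz] at h3
            refine ord_div 0 (r := r z - 1) ?_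
            rw [hcz, Nat.sub_add_cancel hrz]; exact h3
          · rw [Function.update_of_ne hcz]
            refine ord_mul_unit ?_ h3
            simpa [sub_eq_zero] using hcz
    intro a ha h
    exact key (r0 * N) (fun _ => r0) (by simp [hG, mul_comm]) a ha h

lemma coeff_line {σ : Type*} [Finite σ] (b : σ → ℂ) (F : MvPolynomial σ ℂ) (D : ℕ) :
    (aeval (fun i => Polynomial.C (b i) * Polynomial.X) F : Polynomial ℂ).coeff D = eval b (homogeneousComponent D F) := by
  induction F using MvPolynomial.induction_on' with
  | monomial u a =>
    rw [aeval_monomial, homogeneousComponent_of_mem (n := u.degree) (isHomogeneous_monomial a rfl)]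
    have : (u.prod fun i k => (Polynomial.C (b i) * Polynomial.X) ^ k : Polynomial ℂ) =
        Polynomial.C (u.prod fun i k => b i ^ k) * Polynomial.X ^ u.degree := by
      simp only [mul_pow, Finsupp.prod_mul]
      congr 1
      · simp [Finsupp.prod, map_prod]
      · rw [Finsupp.prod, Finset.prod_pow_eq_pow_sum]; rfl
    rw [this, ← Polynomial.C_eq_algebraMap, ← mul_assoc, ← Polynomial.C_mul, Polynomial.coeff_C_mul_X_pow]
    by_cases h : D = u.degree
    · rw [if_pos h, if_pos h, eval_monomial]
    · rw [if_neg h, if_neg h, map_zero]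
  | add p q hp hq => simp [hp, hq]

/-- weighted degree control -/
def Wt {n : ℕ} (g : MvPolynomial (Fin n) ℂ) (k N : ℕ) : Prop := g ≠ 0 → g.totalDegree + k ≤ N

lemma Wt.add {n : ℕ} {g h : MvPolynomial (Fin n) ℂ} {k N : ℕ} (hg : Wt g k N) (hh : Wt h k N) : Wt (g + h) k N := by
  intro hne
  by_cases h1 : g = 0
  · rw [h1, zero_add] at hne ⊢; exact hh hne
  by_cases h2 : h = 0
  · rw [h2, add_zero] at hne ⊢; exact hg hne
  have := totalDegree_add g h
  have := hg h1
  have := hh h2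
  omega

lemma Wt.mul {n : ℕ} {g h : MvPolynomial (Fin n) ℂ} {k N k' N' : ℕ} (hg : Wt g k N) (hh : Wt h k' N') : Wt (g * h) (k + k') (N + N') := by
  intro hne
  have h1 := hg (left_ne_zero_of_mul hne)
  have h2 := hh (right_ne_zero_of_mul hne)
  have := totalDegree_mul g h
  omega

lemma pow_red {S : Type*} [CommRing S] [Algebra ℂ S] {n : ℕ} (x : Fin n → S) (s : S) (D : ℕ)
    (q : ℕ → MvPolynomial (Fin n) ℂ) (hq : ∀ k, Wt (q k) k (D + 1))
    (hs : s ^ (D + 1) = ∑ k ∈ Finset.range (D + 1), aeval x (q k) * s ^ k) (N : ℕ) :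
    ∃ g : ℕ → MvPolynomial (Fin n) ℂ, (∀ k, Wt (g k) k N) ∧ s ^ N = ∑ k ∈ Finset.range (D + 1), aeval x (g k) * s ^ k := by
  induction N with
  | zero =>
    refine ⟨fun k => if k = 0 then 1 else 0, ?_, ?_⟩
    · intro k
      by_cases h : k = 0
      · simp [h, Wt]
      · simp [h, Wt]
    · rw [Finset.sum_range_succ']
      simp
  | succ N ih =>
    obtain ⟨g, hg, h⟩ := ih
    refine ⟨fun k => (if k = 0 then 0 else g (k - 1)) + g D * q k, ?_, ?_⟩
    · intro k
      apply Wt.add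
      · by_cases hk : k = 0
        · simp [hk, Wt]
        · simp only [hk, if_false]
          intro h1
          have := hg (k-1) h1
          omega
      · intro h1
        have := ((hg D).mul (hq k)) h1
        omega
    · rw [pow_succ, h, Finset.sum_mul]
      have h1 : ∀ k, aeval x (g k) * s ^ k * s = aeval x (g k) * s ^ (k + 1) := fun k => by ring
      simp only [h1]
      rw [Finset.sum_range_succ, hs]
      simp only [map_add, add_mul, Finset.sum_add_distrib]
      congr 1
      · rw [Finset.sum_range_succ']
        simp
      · rw [Finset.mul_sum]
        apply Finset.sum_congr rfl
        intro k _
        rw [map_mul]; ring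

lemma lin_norm {S : Type} [CommRing S] [IsDomain S] [Algebra ℂ S] (n : ℕ) : ∀ (x : Fin n → S), 
    ∃ (e : ℕ) (y : Fin e → S), (∀ k, y k ∈ Submodule.span ℂ (Set.range x)) ∧ AlgebraicIndependent ℂ y ∧
      ∃ (w : Finset S), ∀ f : MvPolynomial (Fin n) ℂ,
        ∃ g : S → MvPolynomial (Fin e) ℂ, (∀ l, (g l).totalDegree ≤ f.totalDegree) ∧
          aeval x f = ∑ l ∈ w, aeval y (g l) * l := by
  induction n with
  | zero =>
    intro x
    refine ⟨0, x, fun k => k.elim0, ?_, {1}, fun f => ⟨fun _ => f, fun _ => le_rfl, by simp⟩⟩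
    exact algebraicIndependent_empty_type_iff.2 (FaithfulSMul.algebraMap_injective ℂ S)
  | succ n ih =>
    intro x
    by_cases hx : AlgebraicIndependent ℂ x
    · exact ⟨n + 1, x, fun k => Submodule.subset_span ⟨k, rfl⟩, hx, {1}, fun f => ⟨fun _ => f, fun _ => le_rfl, by simp⟩⟩
    rw [algebraicIndependent_iff] at hx
    push Not at hx
    obtain ⟨F, hF, hF0⟩ := hx
    have hD : F.totalDegree ≠ 0 := by
      intro h
      rw [totalDegree_eq_zero_iff_eq_C] at h
      rw [h, aeval_C] at hF
      have := (map_eq_zero_iff _ (FaithfulSMul.algebraMap_injective ℂ S)).1 hF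
      rw [this, map_zero] at h
      exact hF0 h
    obtain ⟨D, hD⟩ := Nat.exists_eq_succ_of_ne_zero hD
    have htop : homogeneousComponent (D+1) F ≠ 0 := by
      have hne : F.support.Nonempty := by rwa [Finset.nonempty_iff_ne_empty, ne_eq, support_eq_empty]
      obtain ⟨d, hd, h⟩ := Finset.exists_mem_eq_sup F.support hne (fun d => d.sum fun _ k => k)
      intro h0
      have h1 := congrArg (coeff d) h0
      have h2 : d.degree = D + 1 := by
        change F.totalDegree = _ at h
        rw [hD] at h
        exact h.symm
      rw [coeff_homogeneousComponent, if_pos h2, coeff_zero] at h1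
      exact (mem_support_iff.1 hd) h1
    obtain ⟨b, hb⟩ : ∃ b, eval b (homogeneousComponent (D+1) F * X 0) ≠ 0 := by
      by_contra hcon
      push Not at hcon
      have : homogeneousComponent (D+1) F * X 0 = 0 := MvPolynomial.funext (fun b => by rw [hcon, map_zero])
      rw [mul_eq_zero] at this
      exact this.elim htop (X_ne_zero _)
    rw [map_mul, eval_X] at hb
    have hb0 := right_ne_zero_of_mul hb
    have hb1 := left_ne_zero_of_mul hb
    set s : S := (b 0)⁻¹ • x 0 with hs
    set x' : Fin n → S := fun i => x i.succ - b i.succ • s with hx'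
    let ψ : MvPolynomial (Fin (n+1)) ℂ →ₐ[ℂ] MvPolynomial (Fin (n+1)) ℂ :=
      aeval (Fin.cons (C (b 0) * X 0) (fun i => X i.succ + C (b i.succ) * X 0))
    have hψd : ∀ f, (ψ f).totalDegree ≤ f.totalDegree := by
      apply aeval_deg_le
      have hcx : ∀ z : ℂ, (C z * X 0 : MvPolynomial (Fin (n+1)) ℂ).totalDegree ≤ 1 := by
        intro z
        refine (totalDegree_mul _ _).trans ?_
        simp
      intro i
      refine Fin.cases ?_ (fun i => ?_) i
      · simpa using hcx _
      · simp only [Fin.cons_succ]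
        refine (totalDegree_add _ _).trans ?_
        simp [hcx]
    have hψ : ∀ f, aeval x f = aeval (Fin.cons s x' : Fin (n+1) → S) (ψ f) := by
      intro f
      have : aeval x = (aeval (Fin.cons s x' : Fin (n+1) → S)).comp ψ := by
        apply MvPolynomial.algHom_ext
        intro i
        refine Fin.cases ?_ (fun i => ?_) i
        · simp [ψ, hs, ← Algebra.smul_def, smul_smul, hb0]
        · simp [ψ, hx', ← Algebra.smul_def]
      rw [this]; rfl
    have hfs : ∀ f : MvPolynomial (Fin (n+1)) ℂ, ∀ m, f.totalDegree ≤ m → aeval (Fin.cons s x' : Fin (n+1) → S) f =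
        ∑ k ∈ Finset.range (m + 1), aeval x' ((finSuccEquiv ℂ n f).coeff k) * s ^ k := by
      intro f m hm
      have h1 : (aeval (Fin.cons s x' : Fin (n+1) → S)).toRingHom =
          (Polynomial.eval₂RingHom (aeval x').toRingHom s).comp (finSuccEquiv ℂ n).toRingEquiv.toRingHom := by
        apply MvPolynomial.ringHom_ext
        · intro z; simp [finSuccEquiv_apply]
        · intro i
          refine Fin.cases ?_ (fun i => ?_) i
          · simp [finSuccEquiv_apply]
          · simp [finSuccEquiv_apply]
      have h2 := RingHom.congr_fun h1 f
      refine h2.trans ?_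
      change Polynomial.eval₂ _ _ (finSuccEquiv ℂ n f) = _
      rw [Polynomial.eval₂_eq_sum_range' _ (n := m + 1)]
      · rfl
      · rw [natDegree_finSuccEquiv]
        have := degreeOf_le_totalDegree f 0
        omega
    have hwt : ∀ f : MvPolynomial (Fin (n+1)) ℂ, ∀ k, Wt ((finSuccEquiv ℂ n f).coeff k) k f.totalDegree := by
      intro f k h
      exact totalDegree_coeff_finSuccEquiv_add_le f k h
    obtain ⟨κ, hκ0, hκ⟩ : ∃ κ : ℂ, κ ≠ 0 ∧ (finSuccEquiv ℂ n (ψ F)).coeff (D+1) = C κ := by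
      have h0 : ((finSuccEquiv ℂ n (ψ F)).coeff (D+1)).totalDegree = 0 := by
        by_cases h : (finSuccEquiv ℂ n (ψ F)).coeff (D+1) = 0
        · rw [h]; simp
        · have h1 := hwt (ψ F) (D+1) h
          have h2 := hψd F
          omega
      rw [totalDegree_eq_zero_iff_eq_C] at h0
      refine ⟨_, ?_, h0⟩
      intro hc
      rw [hc, map_zero] at h0
      have h1 : (Polynomial.mapRingHom (eval (0 : Fin n → ℂ))).comp ((finSuccEquiv ℂ n).toRingEquiv.toRingHom.comp ψ.toRingHom) =
          (aeval (fun i => Polynomial.C (b i) * Polynomial.X) : MvPolynomial (Fin (n+1)) ℂ →ₐ[ℂ] Polynomial ℂ).toRingHom := by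
        apply MvPolynomial.ringHom_ext
        · intro z
          simp [finSuccEquiv_apply, Polynomial.algebraMap_eq, MvPolynomial.algebraMap_eq]
        · intro i
          refine Fin.cases ?_ (fun i => ?_) i
          · simp [ψ, finSuccEquiv_apply]
          · simp [ψ, finSuccEquiv_apply]
      have h2 := congrArg (fun q => Polynomial.coeff q (D+1)) (RingHom.congr_fun h1 F)
      change Polynomial.coeff (Polynomial.map (eval 0) (finSuccEquiv ℂ n (ψ F))) (D+1) = Polynomial.coeff (aeval _ F) (D+1) at h2
      rw [coeff_line, Polynomial.coeff_map, h0, map_zero] at h2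
      exact hb1 h2.symm
    have hred : s ^ (D + 1) = ∑ k ∈ Finset.range (D + 1), aeval x' (C (-κ⁻¹) * (finSuccEquiv ℂ n (ψ F)).coeff k) * s ^ k := by
      have h1 := hfs (ψ F) (D+1) ((hψd F).trans hD.le)
      rw [← hψ, hF, Finset.sum_range_succ, hκ, aeval_C] at h1
      have h2 : s ^ (D+1) = - (algebraMap ℂ S κ⁻¹ * ∑ k ∈ Finset.range (D + 1), aeval x' ((finSuccEquiv ℂ n (ψ F)).coeff k) * s ^ k) := by
        rw [eq_neg_of_add_eq_zero_left h1.symm, mul_neg, neg_neg, ← mul_assoc, ← map_mul, inv_mul_cancel₀ hκ0, map_one, one_mul]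
      rw [h2, Finset.mul_sum, ← Finset.sum_neg_distrib]
      apply Finset.sum_congr rfl
      intro k _
      rw [map_mul, aeval_C, map_neg]; ring
    have hpow := pow_red x' s D (fun k => C (-κ⁻¹) * (finSuccEquiv ℂ n (ψ F)).coeff k) (by
      intro k
      have h1 : Wt (C (-κ⁻¹) : MvPolynomial (Fin n) ℂ) 0 0 := fun _ => by simp
      have h2 := hwt (ψ F) k
      intro h3
      have h4 := (h1.mul h2) h3
      have h5 := hψd F
      omega) hred
    choose g hg hgs using hpow
    obtain ⟨e, y, hy, hyi, w, hw⟩ := ih x'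
    have hspan : Submodule.span ℂ (Set.range x') ≤ Submodule.span ℂ (Set.range x) := by
      rw [Submodule.span_le]
      rintro _ ⟨i, rfl⟩
      exact Submodule.sub_mem _ (Submodule.subset_span ⟨_, rfl⟩) (Submodule.smul_mem _ _ (Submodule.smul_mem _ _ (Submodule.subset_span ⟨_, rfl⟩)))
    refine ⟨e, y, fun k => hspan (hy k), hyi, ?_⟩
    classical
    -- module generators
    have hmain : ∀ f : MvPolynomial (Fin (n+1)) ℂ, ∃ G : ℕ → S → MvPolynomial (Fin e) ℂ, (∀ k l, (G k l).totalDegree ≤ f.totalDegree) ∧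
        aeval x f = ∑ k ∈ Finset.range (D + 1), ∑ l ∈ w, aeval y (G k l) * (l * s ^ k) := by
      intro f
      let u : ℕ → MvPolynomial (Fin n) ℂ := fun k => ∑ N ∈ Finset.range (f.totalDegree + 1), (finSuccEquiv ℂ n (ψ f)).coeff N * g N k
      have hu : ∀ k, (u k).totalDegree ≤ f.totalDegree := by
        intro k
        apply totalDegree_finsetSum_le
        intro N _
        by_cases h0 : (finSuccEquiv ℂ n (ψ f)).coeff N * g N k = 0
        · rw [h0]; simp
        have h1 := ((hwt (ψ f) N).mul (hg N k)) h0
        have h2 := hψd f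
        omega
      choose G hG1 hG2 using fun k => hw (u k)
      refine ⟨G, fun k l => (hG1 k l).trans (hu k), ?_⟩
      rw [hψ, hfs (ψ f) f.totalDegree (hψd f)]
      have : ∀ N, aeval x' ((finSuccEquiv ℂ n (ψ f)).coeff N) * s ^ N = ∑ k ∈ Finset.range (D+1), aeval x' ((finSuccEquiv ℂ n (ψ f)).coeff N * g N k) * s ^ k := by
        intro N
        rw [hgs N, Finset.mul_sum]
        apply Finset.sum_congr rfl
        intro k _
        rw [map_mul]; ring
      simp only [this]
      rw [Finset.sum_comm]
      apply Finset.sum_congr rfl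
      intro k _
      rw [← Finset.sum_mul, ← map_sum, hG2 k, Finset.sum_mul]
      apply Finset.sum_congr rfl
      intro l _
      ring
    refine ⟨(Finset.range (D+1) ×ˢ w).image (fun p => p.2 * s ^ p.1), ?_⟩
    intro f
    obtain ⟨G, hG1, hG2⟩ := hmain f
    refine ⟨fun z => ∑ p ∈ (Finset.range (D+1) ×ˢ w) with p.2 * s ^ p.1 = z, G p.1 p.2, ?_, ?_⟩
    · intro z
      exact totalDegree_finsetSum_le (fun p _ => hG1 _ _)
    · rw [hG2, ← Finset.sum_product', ← Finset.sum_fiberwise_of_maps_to (t := (Finset.range (D+1) ×ˢ w).image (fun p => p.2 * s ^ p.1)) (g := fun p => p.2 * s ^ p.1) (fun p hp => Finset.mem_image_of_mem _ hp)]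
      apply Finset.sum_congr rfl
      intro z _
      rw [map_sum, Finset.sum_mul]
      apply Finset.sum_congr rfl
      intro p hp
      rw [(Finset.mem_filter.1 hp).2]

lemma prim_struct {A S : Type*} [CommRing A] [IsDomain A] [IsIntegrallyClosed A] [CharZero A] [CommRing S] [IsDomain S]
    [Algebra A S] [FaithfulSMul A S] [Module.Finite A S] (w : Finset S) :
    ∃ (u : S) (h1 h2 : A), h1 ≠ 0 ∧ h2 ≠ 0 ∧
      (∃ a b : Polynomial A, a * minpoly A u + b * Polynomial.derivative (minpoly A u) = Polynomial.C h1) ∧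
      ∀ s ∈ w, ∃ P : Polynomial A, algebraMap A S h2 * s = Polynomial.aeval u P := by
  classical
  let K := FractionRing A
  let L := FractionRing S
  letI : Algebra K L := FractionRing.liftAlgebra A L
  haveI : IsScalarTower A K L := FractionRing.isScalarTower_liftAlgebra A L
  haveI : Module.Finite K L := Module.Finite.of_isLocalization A S (nonZeroDivisors A)
  have hint : ∀ s : S, IsIntegral A s := fun s => Algebra.IsIntegral.isIntegral s
  haveI : CharZero K := IsFractionRing.charZero_of_isFractionRing A (K := K)
  have hAS : Function.Injective (algebraMap A S) := FaithfulSMul.algebraMap_injective A S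
  have hAL : ∀ a : A, algebraMap A L a = algebraMap S L (algebraMap A S a) := fun a =>
    IsScalarTower.algebraMap_apply A S L a
  obtain ⟨α, hα⟩ := Field.exists_primitive_element K L
  obtain ⟨⟨s, t⟩, hst⟩ := IsLocalization.surj (nonZeroDivisors S) α
  obtain ⟨u, d, hd, hu⟩ := Algebra.IsAlgebraic.exists_smul_eq_mul A s (nonZeroDivisors.coe_ne_zero t)
  have hα2 : algebraMap A K d • α = algebraMap S L u := by
    have ht : algebraMap S L t ≠ 0 := by
      simp
    apply mul_right_cancel₀ ht
    rw [smul_mul_assoc]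
    simp only at hst
    rw [hst, algebraMap_smul, ← map_mul, mul_comm u, ← hu, Algebra.smul_def, Algebra.smul_def, map_mul, hAL]
  have hdK : algebraMap A K d ≠ 0 := by simpa using hd
  have hu2 : IntermediateField.adjoin K {algebraMap S L u} = ⊤ := by
    rw [eq_top_iff, ← hα, IntermediateField.adjoin_le_iff, Set.singleton_subset_iff]
    have : α = (algebraMap A K d)⁻¹ • algebraMap S L u := by
      rw [← hα2, smul_smul, inv_mul_cancel₀ hdK, one_smul]
    rw [this]
    exact IntermediateField.smul_mem _ (IntermediateField.mem_adjoin_simple_self _ _)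
  have hmin := minpoly.isIntegrallyClosed_eq_field_fractions K L (hint u)
  have hui : IsIntegral K (algebraMap S L u) := Algebra.IsIntegral.isIntegral _
  have hadj : Algebra.adjoin K {algebraMap S L u} = ⊤ :=
    (IntermediateField.adjoin_simple_eq_top_iff_of_isAlgebraic hui.isAlgebraic).1 hu2
  have hinjp : Function.Injective (Polynomial.map (algebraMap A K)) :=
    Polynomial.map_injective _ (IsFractionRing.injective A K)
  have hsep : (minpoly K (algebraMap S L u)).Separable := Algebra.IsSeparable.isSeparable K _
  have key : ∀ s : S, ∃ (b : A) (P : Polynomial A), b ≠ 0 ∧ algebraMap A S b * s = Polynomial.aeval u P := by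
    intro s
    have : algebraMap S L s ∈ Algebra.adjoin K {algebraMap S L u} := by rw [hadj]; trivial
    rw [Algebra.adjoin_singleton_eq_range_aeval] at this
    obtain ⟨Q, hQ⟩ := this
    obtain ⟨b, hb, hbQ⟩ := IsLocalization.integerNormalization_spec (nonZeroDivisors A) Q
    refine ⟨b, IsLocalization.integerNormalization (nonZeroDivisors A) Q, nonZeroDivisors.ne_zero hb, IsFractionRing.injective S L ?_⟩
    rw [map_mul, ← hAL, ← Polynomial.aeval_algebraMap_apply, ← Polynomial.aeval_map_algebraMap K, hbQ, ← algebraMap_smul K, map_smul, ← hQ, Algebra.smul_def, ← IsScalarTower.algebraMap_apply]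
    rfl
  choose b P hb hP using key
  obtain ⟨a1, b1, hab⟩ := hsep
  obtain ⟨x, hx, hxa⟩ := IsLocalization.integerNormalization_spec (nonZeroDivisors A) a1
  obtain ⟨y, hy, hyb⟩ := IsLocalization.integerNormalization_spec (nonZeroDivisors A) b1
  refine ⟨u, x * y, ∏ s ∈ w, b s, mul_ne_zero (nonZeroDivisors.ne_zero hx) (nonZeroDivisors.ne_zero hy),
    Finset.prod_ne_zero_iff.2 fun s _ => hb s, ?_, ?_⟩
  · refine ⟨y • IsLocalization.integerNormalization (nonZeroDivisors A) a1, x • IsLocalization.integerNormalization (nonZeroDivisors A) b1, hinjp ?_⟩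
    rw [Polynomial.map_add, Polynomial.map_mul, Polynomial.map_mul, ← Polynomial.derivative_map, ← hmin,
      Polynomial.map_smul, Polynomial.map_smul, hxa, hyb, Polynomial.map_C]
    rw [← algebraMap_smul K x, ← algebraMap_smul K y, smul_smul, smul_smul, smul_mul_assoc, smul_mul_assoc, mul_comm (algebraMap A K y), ← smul_add, hab, ← map_mul, Polynomial.smul_eq_C_mul, mul_one]
  · intro s hs
    refine ⟨Polynomial.C (∏ s ∈ w.erase s, b s) * P s, ?_⟩
    rw [map_mul, Polynomial.aeval_C, ← hP, ← Finset.mul_prod_erase w b hs, map_mul]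
    ring

lemma exists_hom {R S : Type*} [CommRing R] [CommRing S] [Algebra ℂ R] [Algebra ℂ S]
    [Algebra.FiniteType ℂ S] (g : R →ₐ[ℂ] S) (hg : g.IsIntegral) (ψ : R →ₐ[ℂ] ℂ)
    (hk : ∀ r, g r = 0 → ψ r = 0) : ∃ φ : S →ₐ[ℂ] ℂ, ∀ r, φ (g r) = ψ r := by
  letI := g.toRingHom.toAlgebra
  haveI : Algebra.IsIntegral R S := ⟨hg⟩
  haveI : (RingHom.ker ψ).IsMaximal := RingHom.ker_isMaximal_of_surjective ψ (fun z => ⟨algebraMap ℂ R z, by simp⟩)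
  obtain ⟨Q, hQ, hQ2⟩ := Ideal.exists_ideal_over_maximal_of_isIntegral (S := S) (RingHom.ker ψ) (fun r hr => hk r hr)
  letI := Ideal.Quotient.field Q
  haveI : Module.Finite ℂ (S ⧸ Q) := finite_of_finite_type_of_isJacobsonRing ℂ (S ⧸ Q)
  have hb := IsAlgClosed.algebraMap_bijective_of_isIntegral (k := ℂ) (K := S ⧸ Q)
  let eqv := AlgEquiv.ofBijective (Algebra.ofId ℂ (S ⧸ Q)) hb
  refine ⟨eqv.symm.toAlgHom.comp (Ideal.Quotient.mkₐ ℂ Q), fun r => ?_⟩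
  have h1 : r - algebraMap ℂ R (ψ r) ∈ RingHom.ker ψ := by simp [RingHom.mem_ker]
  rw [← hQ2, Ideal.mem_comap] at h1
  have h2 : Ideal.Quotient.mkₐ ℂ Q (g (r - algebraMap ℂ R (ψ r))) = 0 := Ideal.Quotient.eq_zero_iff_mem.2 h1
  rw [map_sub, map_sub, sub_eq_zero] at h2
  rw [AlgHom.comp_apply, h2]
  simp

lemma fib_vanish {e : ℕ} {S : Type} [CommRing S] [IsDomain S] [Algebra ℂ S]
    [Algebra (MvPolynomial (Fin e) ℂ) S] [IsScalarTower ℂ (MvPolynomial (Fin e) ℂ) S] [FaithfulSMul (MvPolynomial (Fin e) ℂ) S]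
    [Module.Finite (MvPolynomial (Fin e) ℂ) S] (u : S) (h1 h2 : MvPolynomial (Fin e) ℂ)
    (hab : ∃ a b : Polynomial (MvPolynomial (Fin e) ℂ), a * minpoly _ u + b * Polynomial.derivative (minpoly _ u) = Polynomial.C h1)
    (c : Fin e → ℂ) (hc1 : eval c h1 ≠ 0) (f : S) (P : Polynomial (MvPolynomial (Fin e) ℂ))
    (hP : algebraMap _ S h2 * f = Polynomial.aeval u P) (hdeg : P.natDegree < (minpoly (MvPolynomial (Fin e) ℂ) u).natDegree)
    (hv : ∀ φ : S →ₐ[ℂ] ℂ, (∀ a : MvPolynomial (Fin e) ℂ, φ (algebraMap _ S a) = eval c a) → φ f = 0) :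
    ∀ i, eval c (P.coeff i) = 0 := by
  classical
  haveI : Algebra.FiniteType ℂ S := Algebra.FiniteType.trans (S := MvPolynomial (Fin e) ℂ) inferInstance inferInstance
  have hint : ∀ s : S, IsIntegral (MvPolynomial (Fin e) ℂ) s := fun s => Algebra.IsIntegral.isIntegral s
  set p := minpoly (MvPolynomial (Fin e) ℂ) u with hp
  have hmon : p.Monic := minpoly.monic (hint u)
  have hmc := hmon.map (eval c)
  have hsep : (p.map (eval c)).Separable := by
    obtain ⟨a, b, hab⟩ := hab
    have := congrArg (Polynomial.map (eval c)) hab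
    rw [Polynomial.map_add, Polynomial.map_mul, Polynomial.map_mul, ← Polynomial.derivative_map, Polynomial.map_C] at this
    refine ⟨Polynomial.C (eval c h1)⁻¹ * a.map (eval c), Polynomial.C (eval c h1)⁻¹ * b.map (eval c), ?_⟩
    rw [mul_assoc, mul_assoc, ← mul_add, this, ← Polynomial.C_mul, inv_mul_cancel₀ hc1, Polynomial.C_1]
  suffices h : P.map (eval c) = 0 by
    intro i; simpa using congrArg (fun q => Polynomial.coeff q i) h
  apply Polynomial.eq_zero_of_natDegree_lt_card_of_eval_eq_zero' _ (p.map (eval c)).roots.toFinset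
  · intro t ht
    rw [Multiset.mem_toFinset, Polynomial.mem_roots hmc.ne_zero] at ht
    have htr : Polynomial.eval₂ (eval c) t p = 0 := by rw [← Polynomial.eval_map]; exact ht
    let g : Polynomial (MvPolynomial (Fin e) ℂ) →ₐ[ℂ] S := (Polynomial.aeval u).restrictScalars ℂ
    have hgC : ∀ a, g (Polynomial.C a) = algebraMap _ S a := fun a => Polynomial.aeval_C u a
    let ψ : Polynomial (MvPolynomial (Fin e) ℂ) →ₐ[ℂ] ℂ := 
      { Polynomial.eval₂RingHom (eval c) t with
        commutes' := fun z => by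
          rw [IsScalarTower.algebraMap_apply ℂ (MvPolynomial (Fin e) ℂ) (Polynomial (MvPolynomial (Fin e) ℂ))]
          simp [MvPolynomial.algebraMap_eq] }
    have hψ : ∀ q, ψ q = Polynomial.eval₂ (eval c) t q := fun q => rfl
    have hgi : g.IsIntegral := by
      intro s
      have : (algebraMap (MvPolynomial (Fin e) ℂ) S) = g.toRingHom.comp Polynomial.C := by
        exact RingHom.ext fun a => (hgC a).symm
      have h3 : (algebraMap (MvPolynomial (Fin e) ℂ) S).IsIntegralElem s := hint s
      rw [this] at h3
      exact RingHom.IsIntegralElem.of_comp h3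
    obtain ⟨φ, hφ⟩ := exists_hom g hgi ψ (fun q hq => by
      obtain ⟨q', hq'⟩ := minpoly.isIntegrallyClosed_dvd (hint u) (p := q) hq
      rw [hψ, hq', Polynomial.eval₂_mul, ← hp, htr, zero_mul])
    have hφA : ∀ a : MvPolynomial (Fin e) ℂ, φ (algebraMap _ S a) = eval c a := by
      intro a; rw [← hgC, hφ, hψ, Polynomial.eval₂_C]
    rw [Polynomial.eval_map, ← hψ, ← hφ]
    change φ (Polynomial.aeval u P) = 0
    rw [← hP, map_mul, hv φ hφA, mul_zero]
  · rw [Multiset.toFinset_card_of_nodup (Polynomial.nodup_roots hsep), ← (IsAlgClosed.splits _).natDegree_eq_card_roots,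
      hmon.natDegree_map]
    exact lt_of_le_of_lt Polynomial.natDegree_map_le hdeg

lemma modpow_ord {e : ℕ} (c : Fin e → ℂ) (P p : Polynomial (MvPolynomial (Fin e) ℂ)) (hp : p.Monic)
    (h : ∀ i, eval c (P.coeff i) = 0) (r : ℕ) (i : ℕ) : Ord c r (((P ^ r) %ₘ p).coeff i) := by
  have h1 : (Polynomial.C Polynomial.X) ∣ P.map (tay c).toRingHom := by
    rw [Polynomial.C_dvd_iff_dvd_coeff]
    intro j
    rw [Polynomial.coeff_map, ← pow_one Polynomial.X]
    exact ord_one.2 (h j)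
  obtain ⟨Q, hQ⟩ := h1
  have h2 : ((P ^ r) %ₘ p).map (tay c).toRingHom = (Polynomial.X ^ r : Polynomial (MvPolynomial (Fin e) ℂ)) • (Q ^ r %ₘ p.map (tay c).toRingHom) := by
    have h4 : (Polynomial.C Polynomial.X * Q) ^ r = (Polynomial.X ^ r : Polynomial (MvPolynomial (Fin e) ℂ)) • Q ^ r := by
      rw [Polynomial.smul_eq_C_mul, Polynomial.C_pow]; exact mul_pow (M := Polynomial (Polynomial (MvPolynomial (Fin e) ℂ))) _ _ _
    rw [Polynomial.map_modByMonic _ hp, Polynomial.map_pow, hQ, h4, Polynomial.smul_modByMonic]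
  have h3 := congrArg (fun q => Polynomial.coeff q i) h2
  simp only [Polynomial.coeff_map, Polynomial.coeff_smul, smul_eq_mul] at h3
  exact ⟨_, h3⟩

lemma determ {e n : ℕ} {S : Type} [CommRing S] [IsDomain S] [Algebra ℂ S]
    [Algebra (MvPolynomial (Fin e) ℂ) S] [IsScalarTower ℂ (MvPolynomial (Fin e) ℂ) S] [FaithfulSMul (MvPolynomial (Fin e) ℂ) S]
    [Module.Finite (MvPolynomial (Fin e) ℂ) S] (x : Fin n → S) (w : Finset S)
    (hw : ∀ f : MvPolynomial (Fin n) ℂ,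
        ∃ g : S → MvPolynomial (Fin e) ℂ, (∀ l, (g l).totalDegree ≤ f.totalDegree) ∧
          aeval x f = ∑ l ∈ w, algebraMap _ S (g l) * l) :
    ∃ h : MvPolynomial (Fin e) ℂ, h ≠ 0 ∧ ∀ (M : ℕ) (G : Fin e → Finset ℂ), (∀ i, (G i).card = M + 1) →
      (∀ c : Fin e → ℂ, (∀ i, c i ∈ G i) → eval c h ≠ 0) → ∀ F : MvPolynomial (Fin n) ℂ, F.totalDegree ≤ M →
      (∀ c : Fin e → ℂ, (∀ i, c i ∈ G i) → ∀ φ : S →ₐ[ℂ] ℂ, (∀ a : MvPolynomial (Fin e) ℂ, φ (algebraMap _ S a) = eval c a) →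
        φ (aeval x F) = 0) → aeval x F = 0 := by
  classical
  obtain ⟨u, h1, h2, hh1, hh2, hab, hB⟩ := prim_struct (A := MvPolynomial (Fin e) ℂ) w
  have hint : ∀ s : S, IsIntegral (MvPolynomial (Fin e) ℂ) s := fun s => Algebra.IsIntegral.isIntegral s
  set p := minpoly (MvPolynomial (Fin e) ℂ) u with hp
  have hmon : p.Monic := minpoly.monic (hint u)
  have hp1 : p ≠ 1 := minpoly.ne_one _ _
  have hB2 : ∀ s : S, ∃ P : Polynomial (MvPolynomial (Fin e) ℂ), P.natDegree < p.natDegree ∧ 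
      (s ∈ w → algebraMap _ S h2 * s = Polynomial.aeval u P) := by
    intro s
    by_cases hs : s ∈ w
    · obtain ⟨P, hP⟩ := hB s hs
      refine ⟨P %ₘ p, Polynomial.natDegree_modByMonic_lt _ hmon hp1, fun _ => ?_⟩
      rw [hP, Polynomial.aeval_modByMonic_eq_self_of_root (minpoly.aeval _ _)]
    · exact ⟨0, by simpa using hmon.natDegree_pos.2 hp1, fun h => absurd h hs⟩
  choose B hBd hB using hB2
  refine ⟨h1 * h2, mul_ne_zero hh1 hh2, fun M G hG hGh F hF hv => ?_⟩
  let K := ∑ l ∈ w, ∑ i ∈ Finset.range p.natDegree, ((B l).coeff i).totalDegree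
  have hK : ∀ l ∈ w, ∀ i, ((B l).coeff i).totalDegree ≤ K := by
    intro l hl i
    by_cases hi : i < p.natDegree
    · exact (Finset.single_le_sum (f := fun i => ((B l).coeff i).totalDegree) (fun _ _ => Nat.zero_le _) (Finset.mem_range.2 hi)).trans
        (Finset.single_le_sum (f := fun l => ∑ i ∈ Finset.range p.natDegree, ((B l).coeff i).totalDegree) (fun _ _ => Nat.zero_le _) hl)
    · rw [Polynomial.coeff_eq_zero_of_natDegree_lt ((hBd l).trans_le (not_lt.1 hi))]; simp
  have hrep : ∀ f : MvPolynomial (Fin n) ℂ, ∃ β : Polynomial (MvPolynomial (Fin e) ℂ), β.natDegree < p.natDegree ∧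
      (∀ i, (β.coeff i).totalDegree ≤ f.totalDegree + K) ∧ algebraMap _ S h2 * aeval x f = Polynomial.aeval u β := by
    intro f
    obtain ⟨g, hg, hgf⟩ := hw f
    refine ⟨∑ l ∈ w, Polynomial.C (g l) * B l, ?_, ?_, ?_⟩
    · refine lt_of_le_of_lt (Polynomial.natDegree_sum_le_of_forall_le (n := p.natDegree - 1) _ _ fun l hl => ?_) 
        (Nat.sub_lt (hmon.natDegree_pos.2 hp1) one_pos)
      have := Polynomial.natDegree_C_mul_le (g l) (B l)
      have := hBd l
      omega
    · intro i
      rw [Polynomial.finsetSum_coeff]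
      refine totalDegree_finsetSum_le fun l hl => ?_
      rw [Polynomial.coeff_C_mul]
      exact (totalDegree_mul _ _).trans (add_le_add (hg l) (hK l hl i))
    · rw [hgf, Finset.mul_sum, map_sum]
      refine Finset.sum_congr rfl fun l hl => ?_
      rw [map_mul, Polynomial.aeval_C, ← hB l hl]; ring
  obtain ⟨P, hPd, -, hP⟩ := hrep F
  obtain ⟨β, hβd, hβt, hβ⟩ := hrep (F ^ (K + 1))
  have hfin : (h2 ^ K) • β = P ^ (K + 1) %ₘ p := by
    rw [← sub_eq_zero]
    by_contra hne
    have h3 : Polynomial.aeval u ((h2 ^ K) • β - P ^ (K + 1) %ₘ p) = 0 := by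
      rw [map_sub, map_smul, ← hβ, Polynomial.aeval_modByMonic_eq_self_of_root (minpoly.aeval _ _), map_pow, map_pow, ← hP, Algebra.smul_def,
        map_pow]
      ring
    have h4 := minpoly.IsIntegrallyClosed.degree_le_of_ne_zero hne h3
    have h5 := Polynomial.natDegree_le_natDegree h4
    have h6 := Polynomial.natDegree_sub_le ((h2 ^ K) • β) (P ^ (K + 1) %ₘ p)
    have h7 := Polynomial.natDegree_modByMonic_lt (P ^ (K + 1)) hmon hp1
    have h8 := Polynomial.natDegree_smul_le (h2 ^ K) β
    rw [← hp] at h5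
    omega
  have hz : β = 0 := by
    ext1 i
    rw [Polynomial.coeff_zero]
    refine mult_sz e (M + 1) (K + 1) G hG _ ?_ ?_
    · have h9 := hβt i
      have h10 := totalDegree_pow F (K + 1)
      nlinarith
    · intro c hc
      have h0 := hGh c hc
      rw [map_mul] at h0
      have hva := fib_vanish u h1 h2 hab c (left_ne_zero_of_mul h0) (aeval x F) P hP hPd (hv c hc)
      have ho := modpow_ord c P p hmon hva (K + 1) i
      rw [← hfin, Polynomial.coeff_smul, smul_eq_mul] at ho
      refine ord_mul_unit ?_ ho
      rw [map_pow]
      exact pow_ne_zero _ (right_ne_zero_of_mul h0)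
  rw [hz, map_zero, map_pow] at hβ
  rcases mul_eq_zero.1 hβ with h | h
  · exact absurd ((FaithfulSMul.algebraMap_injective (MvPolynomial (Fin e) ℂ) S) (h.trans (map_zero _).symm)) hh2
  · exact pow_eq_zero_iff (Nat.succ_ne_zero K) |>.1 h

lemma exists_grid {e : ℕ} (h : MvPolynomial (Fin e) ℂ) (hh : h ≠ 0) (N : ℕ) :
    ∃ G : Fin e → Finset ℂ, (∀ i, (G i).card = N) ∧ ∀ c : Fin e → ℂ, (∀ i, c i ∈ G i) → eval c h ≠ 0 := by
  classical
  let q : (Fin e → Fin N) → MvPolynomial (Fin e) ℂ := fun j => aeval (fun i => X i + C ((j i : ℕ) : ℂ)) h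
  have hq : ∀ j z, eval z (q j) = eval (fun i => z i + ((j i : ℕ) : ℂ)) h := by
    intro j z
    simp only [q, aeval_def, ← coe_eval₂Hom]
    rw [← RingHom.comp_apply]
    congr 1
    apply ringHom_ext <;> intros <;> simp [MvPolynomial.algebraMap_eq]
  have hne : ∏ j, q j ≠ 0 := Finset.prod_ne_zero_iff.2 fun j _ h0 => hh <| MvPolynomial.funext fun z => by
    have := hq j (fun i => z i - ((j i : ℕ) : ℂ))
    rw [h0] at this
    simpa using this.symm
  have : ∃ z, eval z (∏ j, q j) ≠ 0 := by
    by_contra! h0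
    exact hne (MvPolynomial.funext fun z => by rw [h0, map_zero])
  obtain ⟨z, hz⟩ := this
  rw [map_prod, Finset.prod_ne_zero_iff] at hz
  refine ⟨fun i => Finset.univ.image fun j : Fin N => z i + ((j : ℕ) : ℂ), fun i => ?_, fun c hc => ?_⟩
  · rw [Finset.card_image_of_injective, Finset.card_univ, Fintype.card_fin]
    intro a b hab
    simpa [Fin.ext_iff] using hab
  · have : ∀ i, ∃ j : Fin N, z i + ((j : ℕ) : ℂ) = c i := fun i => by simpa using hc i
    choose j hj using this
    have := hz j (Finset.mem_univ _)
    rw [hq] at this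
    rwa [show (fun i => z i + ((j i : ℕ) : ℂ)) = c from funext hj] at this

lemma hilbert_le_aux {n : ℕ} {c0 : ℝ} (hc0 : 0 < c0) (hCP : ChardinPhilippon n c0) {V : Set (Fin n → ℂ)} (hV : IsIrredVariety n V) (M : ℕ)
    {S : Type} [CommRing S] [IsDomain S] [Algebra ℂ S] (π : MvPolynomial (Fin n) ℂ →ₐ[ℂ] S) (hπ : Function.Surjective π)
    (hk : ∀ f, π f = 0 ↔ f ∈ vanishingIdeal n V) (htd : dim n V = td S) :
    Module.finrank ℂ (Submodule.map π.toLinearMap (restrictTotalDegree (Fin n) ℂ M)) ≤ (M + 1) ^ dim n V * degree n V := by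
  classical
  let x : Fin n → S := fun i => π (X i)
  have hx : ∀ f, aeval x f = π f := by
    have : (aeval x : _ →ₐ[ℂ] S) = π := by
      apply MvPolynomial.algHom_ext; intro i; simp [x]
    intro f; rw [this]
  obtain ⟨e, y, hyx, hy, w, hw⟩ := lin_norm n x
  let g : MvPolynomial (Fin e) ℂ →ₐ[ℂ] S := aeval y
  have hginj : Function.Injective g := hy
  letI := g.toRingHom.toAlgebra
  haveI : IsScalarTower ℂ (MvPolynomial (Fin e) ℂ) S := IsScalarTower.of_algHom g
  haveI : FaithfulSMul (MvPolynomial (Fin e) ℂ) S := (faithfulSMul_iff_algebraMap_injective _ _).2 hginj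
  haveI : Module.Finite (MvPolynomial (Fin e) ℂ) S := by
    refine ⟨⟨w, ?_⟩⟩
    rw [eq_top_iff]
    rintro s -
    obtain ⟨f, rfl⟩ := hπ s
    obtain ⟨gg, -, hgg⟩ := hw f
    rw [← hx, hgg]
    refine Submodule.sum_mem _ fun l hl => ?_
    exact Submodule.smul_mem _ (gg l) (Submodule.subset_span hl)
  haveI : Algebra.FiniteType ℂ S := Algebra.FiniteType.of_surjective π hπ
  have hgint : g.IsIntegral := fun s => Algebra.IsIntegral.isIntegral (R := MvPolynomial (Fin e) ℂ) s
  have hdim : dim n V = e := by rw [htd]; exact td_eq g hginj hgint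
  obtain ⟨h, hh, hdet⟩ := determ x w hw
  obtain ⟨G, hG, hGh⟩ := exists_grid h hh (M + 1)
  -- evaluation at points
  have hev0 : ∀ v : Fin n → ℂ, v ∈ V → ∃ φ : S →ₐ[ℂ] ℂ, ∀ f, φ (π f) = eval v f := by
    intro v hv
    refine exists_hom π (RingHom.isIntegral_of_surjective _ hπ) (aeval v) (fun f hf => ?_)
    have := (hk f).1 hf v hv
    rwa [← aeval_eq_eval] at this
  choose ev hev using hev0
  have hpt : ∀ φ : S →ₐ[ℂ] ℂ, ∃ v, ∃ hv : v ∈ V, φ = ev v hv := by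
    intro φ
    have h1 : ∀ f, φ (π f) = eval (fun i => φ (x i)) f := by
      intro f
      rw [← hx, ← aeval_eq_eval, ← AlgHom.comp_apply]
      congr 1
      apply MvPolynomial.algHom_ext; intro i; simp
    have hv : (fun i => φ (x i)) ∈ V := by
      rw [← zl_vi hV.1]
      intro f hf
      rw [← h1, (hk f).2 hf, map_zero]
    refine ⟨_, hv, ?_⟩
    ext s
    obtain ⟨f, rfl⟩ := hπ s
    rw [h1, hev]
  have hlam : ∀ k, ∃ c : Fin n → ℂ, ∑ i, c i • x i = y k := fun k =>
    (Submodule.mem_span_range_iff_exists_fun ℂ).1 (hyx k)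
  choose lam hlam using hlam
  let Λ : (Fin n → ℂ) →ₗ[ℂ] (Fin e → ℂ) := Matrix.mulVecLin (Matrix.of lam)
  have hΛ : ∀ v (hv : v ∈ V) k, ev v hv (y k) = Λ v k := by
    intro v hv k
    rw [← hlam, map_sum]
    simp only [map_smul, x, hev, eval_X, smul_eq_mul]
    rfl
  have hΛs : Function.Surjective Λ := by
    intro c
    obtain ⟨φ, hφ⟩ := exists_hom g hgint (aeval c) (fun r hr => by
      rw [hginj (hr.trans (map_zero g).symm), map_zero])
    obtain ⟨v, hv, rfl⟩ := hpt φ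
    refine ⟨v, funext fun k => ?_⟩
    rw [← hΛ v hv, ← show g (X k) = y k by simp [g], hφ, aeval_X]
  have hker : Module.finrank ℂ (LinearMap.ker Λ) = n - e := by
    have := LinearMap.finrank_range_add_finrank_ker Λ
    rw [LinearMap.range_eq_top.2 hΛs, finrank_top] at this
    simp at this
    omega
  have hevg : ∀ v (hv : v ∈ V) (a : MvPolynomial (Fin e) ℂ), ev v hv (g a) = eval (Λ v) a := by
    intro v hv a
    rw [← aeval_eq_eval, ← AlgHom.comp_apply]
    congr 1
    apply MvPolynomial.algHom_ext; intro k; simp [g, hΛ]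
  have hfib : ∀ c : Fin e → ℂ, (V ∩ Λ ⁻¹' {c}).Finite := by
    intro c
    have hsub : V ∩ Λ ⁻¹' {c} ⊆ Set.pi Set.univ (fun i => {z : ℂ | ((minpoly (MvPolynomial (Fin e) ℂ) (x i)).map (eval c)).IsRoot z}) := by
      rintro v ⟨hv, hvc⟩ i -
      have hvc : Λ v = c := hvc
      have h0 := congrArg (ev v hv) (minpoly.aeval (MvPolynomial (Fin e) ℂ) (x i))
      rw [map_zero] at h0
      have : (ev v hv : S →+* ℂ).comp (algebraMap (MvPolynomial (Fin e) ℂ) S) = eval c := by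
        refine RingHom.ext fun a => ?_
        rw [← hvc]; exact hevg v hv a
      rw [Polynomial.aeval_def, ← AlgHom.coe_toRingHom, Polynomial.hom_eval₂, this] at h0
      rw [mem_ofPred_eq, Polynomial.IsRoot, Polynomial.eval_map]
      rw [← h0]; congr 1
      simp [x, hev]
    refine Set.Finite.subset (Set.Finite.pi fun i => ?_) hsub
    exact Polynomial.finite_setOfPred_isRoot ((minpoly.monic (Algebra.IsIntegral.isIntegral (x i))).map (eval c)).ne_zero
  have hcard : ∀ c : Fin e → ℂ, (V ∩ Λ ⁻¹' {c}).ncard ≤ degree n V := by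
    intro c
    obtain ⟨v0, hv0⟩ := hΛs c
    have hL : Λ ⁻¹' {c} = (AffineSubspace.mk' v0 (LinearMap.ker Λ) : Set (Fin n → ℂ)) := by
      ext v
      rw [SetLike.mem_coe, AffineSubspace.mem_mk', vsub_eq_sub, LinearMap.mem_ker, map_sub, hv0, sub_eq_zero]
      rfl
    have h2 := hfib c
    rw [hL] at h2 ⊢
    exact le_degree hc0 hCP hV _ (by rw [AffineSubspace.direction_mk', hker, hdim]) h2
  let T : Finset (Fin n → ℂ) := (Fintype.piFinset G).biUnion fun c => (hfib c).toFinset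
  have hTV : ∀ v ∈ T, v ∈ V := by
    intro v hv
    simp only [T, Finset.mem_biUnion, Set.Finite.mem_toFinset] at hv
    obtain ⟨c, -, hv⟩ := hv
    exact hv.1
  have hT : T.card ≤ (M + 1) ^ e * degree n V := by
    refine Finset.card_biUnion_le.trans ?_
    calc _ ≤ ∑ c ∈ Fintype.piFinset G, degree n V := Finset.sum_le_sum fun c _ => by
            rw [← Set.ncard_eq_toFinset_card _ (hfib c)]; exact hcard c
      _ = _ := by rw [Finset.sum_const, Fintype.card_piFinset, Finset.prod_congr rfl (fun i _ => hG i)]; simp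
  rw [hdim]
  refine le_trans ?_ hT
  let Φ : Submodule.map π.toLinearMap (restrictTotalDegree (Fin n) ℂ M) →ₗ[ℂ] (T → ℂ) := (LinearMap.pi fun v : T => (ev v.1 (hTV v.1 v.2)).toLinearMap).comp (Submodule.subtype _)
  have hΦ : Function.Injective Φ := by
    rw [← LinearMap.ker_eq_bot, LinearMap.ker_eq_bot']
    rintro ⟨s, hs⟩ h0
    obtain ⟨f, hf, rfl⟩ := hs
    replace hf := (mem_restrictTotalDegree _ _ _).1 hf
    have h1 : aeval x f = 0 := by
      refine hdet M G hG hGh f hf fun c hc φ hφ => ?_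
      obtain ⟨v, hv, rfl⟩ := hpt φ
      have hvT : v ∈ T := by
        simp only [T, Finset.mem_biUnion, Set.Finite.mem_toFinset]
        refine ⟨c, Fintype.mem_piFinset.2 hc, hv, ?_⟩
        refine funext fun k => ?_
        rw [← hΛ v hv, ← show g (X k) = y k by simp [g]]
        exact (hφ (X k)).trans (by simp)
      have := congrFun h0 ⟨v, hvT⟩
      rw [hx]
      exact this
    rw [hx] at h1
    exact Subtype.ext h1
  have := LinearMap.finrank_le_finrank_of_injective hΦ
  simpa using this

lemma hilbert_le {n : ℕ} {c0 : ℝ} (hc0 : 0 < c0) (hCP : ChardinPhilippon n c0) {V : Set (Fin n → ℂ)} (hV : IsIrredVariety n V) (M : ℕ) :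
    hilbert n V M ≤ (M + 1) ^ dim n V * degree n V := by
  haveI := vi_prime hV
  exact hilbert_le_aux hc0 hCP hV M (Ideal.Quotient.mkₐ ℂ (vanishingIdeal n V)) (Ideal.Quotient.mk_surjective)
    (fun f => Ideal.Quotient.eq_zero_iff_mem) (dim_eq hV)

lemma degree_pos {n : ℕ} {c0 : ℝ} (hc0 : 0 < c0) (hCP : ChardinPhilippon n c0) {V : Set (Fin n → ℂ)} (hV : IsIrredVariety n V) :
    1 ≤ degree n V := by
  have h1 := hilbert_le hc0 hCP hV 0
  have h2 := hilbert_pos hV.2.1 0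
  simp at h1
  omega

def KK (n : ℕ) : ℝ := 2 ^ n * (2 ^ n) ^ (n + 1)

lemma KK_one (n : ℕ) : 1 ≤ KK n := by
  have h : (1:ℝ) ≤ 2 ^ n := one_le_pow₀ (by norm_num)
  exact one_le_mul_of_one_le_of_one_le h (one_le_pow₀ h)

lemma lbA {n : ℕ} {c0 : ℝ} (hc0 : 0 < c0) (hCP : ChardinPhilippon n c0) {V W : Set (Fin n → ℂ)} {m : ℕ}
    (hW : IsIrredComponent n W (Xle V m)) (hVW : V ⊆ W) :
    c0 * (m:ℝ) ^ dim n W * degree n W ≤ (2 ^ n) ^ (n + 1) * hilbert n V m := by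
  have h1 := hCP W _ (algOfDim_irr hW.1) (2 ^ (n+1) * m) (by
    apply Nat.mul_le_mul _ (deltaSet_le hW)
    have := (Nat.lt_two_pow_self (n := n)).le
    rw [pow_succ, mul_comm]
    exact Nat.mul_le_mul ((Nat.sub_le _ _).trans this) le_rfl)
  rw [degreeSum_irr hW.1] at h1
  have h2 : (hilbert n W (2 ^ (n+1) * m) : ℝ) ≤ (2 ^ n) ^ (n + 1) * hilbert n W m := by
    exact_mod_cast hilbert_pow W m (n+1)
  rw [hilbert_congr hVW m hW.2.1]
  refine le_trans ?_ (h1.trans h2)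
  gcongr
  push_cast
  exact le_mul_of_one_le_left (by positivity) (one_le_pow₀ (by norm_num))

lemma lbB {n : ℕ} {c0 : ℝ} (hc0 : 0 < c0) (hCP : ChardinPhilippon n c0) {V W : Set (Fin n → ℂ)} {m M : ℕ} (hM : 1 ≤ M)
    (hW : IsIrredComponent n W (Xle V m)) (hVW : V ⊆ W) :
    hilbert n V M * (c0 * (m:ℝ) ^ dim n W) ≤ KK n * M ^ dim n W * hilbert n V m := by
  have h1 : (hilbert n V M : ℝ) ≤ (M + 1) ^ dim n W * degree n W := by
    exact_mod_cast (hilbert_anti hVW M).trans (hilbert_le hc0 hCP hW.1 M)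
  have hM' : (1:ℝ) ≤ M := by exact_mod_cast hM
  have h2 : ((M:ℝ) + 1) ^ dim n W ≤ 2 ^ n * M ^ dim n W := by
    calc ((M:ℝ) + 1) ^ dim n W ≤ (2 * M) ^ dim n W := by gcongr; linarith
      _ = 2 ^ dim n W * M ^ dim n W := mul_pow _ _ _
      _ ≤ _ := by gcongr; norm_num; exact dim_le hW.1
  have h3 := lbA hc0 hCP hW hVW
  calc (hilbert n V M : ℝ) * (c0 * (m:ℝ) ^ dim n W) ≤ (2 ^ n * M ^ dim n W * degree n W) * (c0 * (m:ℝ) ^ dim n W) := by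
        gcongr; exact h1.trans (by gcongr)
    _ = (2 ^ n * M ^ dim n W) * (c0 * (m:ℝ) ^ dim n W * degree n W) := by ring
    _ ≤ (2 ^ n * M ^ dim n W) * ((2 ^ n) ^ (n + 1) * hilbert n V m) := by gcongr
    _ = _ := by unfold KK; ring

lemma pd_zero {n : ℕ} (V : Set (Fin n → ℂ)) : partialDeg n V 0 = 0 := by simp [partialDeg]

lemma lbG {n : ℕ} {c0 : ℝ} (hc0 : 0 < c0) (hCP : ChardinPhilippon n c0) {V : Set (Fin n → ℂ)} (hV : IsIrredVariety n V)
    {k m M : ℕ} (hk : k ≤ n - dim n V) (hm : 1 ≤ m) (hkm : partialDeg n V k ≤ m) (hmM : m ≤ M) :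
    hilbert n V M * (c0 * (m:ℝ) ^ (n - k)) ≤ KK n * M ^ (n - k) * hilbert n V m := by
  obtain ⟨W, hW, hVW⟩ := exists_comp hV (sub_Xle V m)
  have hd : dim n W ≤ n - k := by
    rcases Nat.eq_zero_or_pos k with rfl | h
    · exact dim_le hW.1
    · exact (pd_le_iff hV h hk m).1 hkm W hW.1 hVW hW.2.1
  obtain ⟨r, hr⟩ := Nat.exists_eq_add_of_le hd
  have h := lbB hc0 hCP (hm.trans hmM) hW hVW
  rw [hr, pow_add, pow_add]
  have hmM' : (m:ℝ) ≤ M := by exact_mod_cast hmM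
  have := KK_one n
  calc (hilbert n V M : ℝ) * (c0 * ((m:ℝ) ^ dim n W * m ^ r)) = hilbert n V M * (c0 * (m:ℝ) ^ dim n W) * m ^ r := by ring
    _ ≤ KK n * M ^ dim n W * hilbert n V m * M ^ r := by gcongr
    _ = _ := by ring

lemma lbT {n : ℕ} {c0 : ℝ} (hc0 : 0 < c0) (hCP : ChardinPhilippon n c0) {V : Set (Fin n → ℂ)} (hV : IsIrredVariety n V)
    {m : ℕ} (hm : partialDeg n V (n - dim n V) ≤ m) :
    c0 * (m:ℝ) ^ dim n V * degree n V ≤ KK n * hilbert n V m := by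
  have hc : IsIrredComponent n V (Xle V m) :=
    ⟨hV, sub_Xle V m, fun W h1 h2 h3 => (comp_top hV).2.2 W h1 h2 (h3.trans (Xle_anti V hm))⟩
  refine (lbA hc0 hCP hc subset_rfl).trans ?_
  unfold KK
  gcongr
  exact le_mul_of_one_le_left (by positivity) (one_le_pow₀ (by norm_num))

lemma lbD {n : ℕ} {c0 : ℝ} (hc0 : 0 < c0) (hCP : ChardinPhilippon n c0) {V : Set (Fin n → ℂ)} (hV : IsIrredVariety n V)
    (j : ℕ) : ∀ {i m : ℕ}, i + j = n - dim n V → 1 ≤ m → partialDeg n V i ≤ m → (i < n - dim n V → m ≤ partialDeg n V (i+1)) →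
    c0 ^ (j + 1) * (m:ℝ) ^ (n - i) * degree n V ≤ KK n ^ (j + 1) * hilbert n V m *
      ∏ k ∈ Finset.Icc (i+1) (n - dim n V), (partialDeg n V k : ℝ) := by
  have hdn := dim_le hV
  have hK := KK_one n
  induction j with
  | zero =>
    intro i m hi hm1 hm _
    have hi' : i = n - dim n V := by omega
    subst hi'
    rw [show n - (n - dim n V) = dim n V by omega]
    simpa using lbT hc0 hCP hV hm
  | succ j ih =>
    intro i m hi hm1 hm hm2
    have hlt : i < n - dim n V := by omega
    have hm2 := hm2 hlt
    set D := partialDeg n V (i+1) with hD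
    have hD1 : 1 ≤ D := hm1.trans hm2
    have h1 := @ih (i+1) D (by omega) hD1 le_rfl (fun h => pd_mono hV (by omega) (by omega))
    have h2 := lbG hc0 hCP hV hlt.le hm1 hm hm2
    rw [← Finset.prod_Ioc_mul_eq_prod_Icc (by omega : i+1 ≤ n - dim n V),
      show Finset.Ioc (i+1) (n - dim n V) = Finset.Icc (i+1+1) (n - dim n V) from by ext; simp, ← hD]
    set P := ∏ k ∈ Finset.Icc (i+1+1) (n - dim n V), (partialDeg n V k : ℝ)
    have hP : 0 ≤ P := by positivity
    have hDp : (0:ℝ) < (D:ℝ) ^ (n - (i+1)) := by positivity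
    rw [show n - i = n - (i+1) + 1 by omega] at h2 ⊢
    set e := n - (i+1)
    rw [← mul_le_mul_iff_right₀ hDp]
    calc (D:ℝ) ^ e * (c0 ^ (j+1+1) * (m:ℝ) ^ (e+1) * degree n V) =
        (c0 ^ (j+1) * (D:ℝ) ^ e * degree n V) * (c0 * (m:ℝ) ^ (e+1)) := by ring
      _ ≤ (KK n ^ (j+1) * hilbert n V D * P) * (c0 * (m:ℝ) ^ (e+1)) := by gcongr
      _ = (KK n ^ (j+1) * P) * (hilbert n V D * (c0 * (m:ℝ) ^ (e+1))) := by ring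
      _ ≤ (KK n ^ (j+1) * P) * (KK n * D ^ (e+1) * hilbert n V m) := by gcongr
      _ = _ := by ring

/-- Lower bound by `m^{n-i}`. -/
lemma lbE {n : ℕ} {c0 : ℝ} (hc0 : 0 < c0) (hCP : ChardinPhilippon n c0) {V : Set (Fin n → ℂ)} (hV : IsIrredVariety n V)
    {i m : ℕ} (hi : i ≤ n - dim n V) (hm1 : 1 ≤ m) (hm : partialDeg n V i ≤ m) (hm2 : i < n - dim n V → m ≤ partialDeg n V (i+1)) :
    c0 * (m:ℝ) ^ (n - i) ≤ KK n * hilbert n V m := by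
  have hdn := dim_le hV
  have hK := KK_one n
  have hH : (1:ℝ) ≤ hilbert n V m := by exact_mod_cast hilbert_pos hV.2.1 m
  rcases Nat.lt_or_ge i (n - dim n V) with h | h
  · rcases Nat.eq_or_lt_of_le hm1 with h1 | h1
    · rw [← h1] at hH ⊢
      have := c0_le_one hCP
      simp only [Nat.cast_one, one_pow, mul_one]
      nlinarith
    · obtain ⟨W, hW, hVW, hd⟩ := pd_lt hV (k := i+1) (by omega) h (m := m - 1) (by have := hm2 h; omega)
      have h3 := lbA hc0 hCP hW hVW
      have h4 : (1:ℝ) ≤ degree n W := by exact_mod_cast degree_pos hc0 hCP hW.1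
      have h5 : (hilbert n V (m-1) : ℝ) ≤ hilbert n V m := by exact_mod_cast hilbert_mono V (Nat.sub_le _ _)
      have h6 : (m:ℝ) ≤ 2 * (m - 1 : ℕ) := by exact_mod_cast (by omega : m ≤ 2 * (m-1))
      have h7 : (1:ℝ) ≤ (m - 1 : ℕ) := by exact_mod_cast (by omega : 1 ≤ m-1)
      have h8 : n - i ≤ dim n W := by omega
      calc c0 * (m:ℝ) ^ (n - i) ≤ c0 * (2 * (m - 1 : ℕ)) ^ (n - i) := by gcongr
        _ = c0 * (2 ^ (n - i) * ((m-1 : ℕ):ℝ) ^ (n - i)) := by rw [mul_pow]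
        _ ≤ c0 * (2 ^ n * ((m-1 : ℕ):ℝ) ^ dim n W) := by
            gcongr
            · norm_num
            · exact Nat.sub_le _ _
        _ = 2 ^ n * (c0 * ((m-1 : ℕ):ℝ) ^ dim n W * 1) := by ring
        _ ≤ 2 ^ n * (c0 * ((m-1 : ℕ):ℝ) ^ dim n W * degree n W) := by gcongr
        _ ≤ 2 ^ n * ((2 ^ n) ^ (n + 1) * hilbert n V (m-1)) := by gcongr
        _ ≤ 2 ^ n * ((2 ^ n) ^ (n + 1) * hilbert n V m) := by gcongr
        _ = _ := by unfold KK; ring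
  · have hi' : i = n - dim n V := by omega
    subst hi'
    have h4 : (1:ℝ) ≤ degree n V := by exact_mod_cast degree_pos hc0 hCP hV
    have := lbT hc0 hCP hV hm
    rw [show n - (n - dim n V) = dim n V by omega]
    refine le_trans ?_ this
    exact le_mul_of_one_le_right (by positivity) h4

/-- Combined. -/
lemma lbF {n : ℕ} {c0 : ℝ} (hc0 : 0 < c0) (hCP : ChardinPhilippon n c0) {V : Set (Fin n → ℂ)} (hV : IsIrredVariety n V)
    {i m : ℕ} (hi : i ≤ n - dim n V) (hm1 : 1 ≤ m) (hm : partialDeg n V i ≤ m) (hm2 : i < n - dim n V → m ≤ partialDeg n V (i+1)) :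
    (c0 / KK n) ^ (n + 1) * ((m:ℝ) ^ (n - i) * Delta n V i) ≤ hilbert n V m := by
  have hdn := dim_le hV
  have hK := KK_one n
  have hK0 : 0 < KK n := by linarith
  have hc := c0_le_one hCP
  have hq : c0 / KK n ≤ 1 := (div_le_one hK0).2 (by linarith)
  have hq0 : 0 < c0 / KK n := by positivity
  have hP : (0:ℝ) < ∏ k ∈ Finset.Icc (i+1) (n - dim n V), (partialDeg n V k : ℝ) := by
    apply Finset.prod_pos
    intro k hk
    rw [Finset.mem_Icc] at hk
    exact_mod_cast pd_pos hV (by omega) hk.2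
  rw [Delta, mul_max_of_nonneg _ _ (by positivity), mul_max_of_nonneg _ _ (by positivity)]
  apply max_le
  · have h := lbD hc0 hCP hV (n - dim n V - i) (i := i) (m := m) (by omega) hm1 hm hm2
    calc _ ≤ (c0 / KK n) ^ (n - dim n V - i + 1) * ((m:ℝ) ^ (n - i) * (degree n V / ∏ k ∈ Finset.Icc (i+1) (n - dim n V), (partialDeg n V k : ℝ))) := by
          have : (c0 / KK n) ^ (n + 1) ≤ (c0 / KK n) ^ (n - dim n V - i + 1) := pow_le_pow_of_le_one hq0.le hq (by omega)
          gcongr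
      _ ≤ _ := by
          rw [div_pow]
          field_simp
          linarith
  · have h := lbE hc0 hCP hV hi hm1 hm hm2
    rw [mul_one]
    have : (c0 / KK n) ^ (n + 1) ≤ (c0 / KK n) ^ 1 := pow_le_pow_of_le_one hq0.le hq (by omega)
    calc _ ≤ (c0 / KK n) ^ 1 * (m:ℝ) ^ (n - i) := by gcongr
      _ ≤ _ := by
        rw [pow_one]; field_simp; linarith

def rho : ℕ → ℕ
  | 0 => 1
  | 1 => 1
  | (k+2) => 2 * (k+1) * rho (k+1)

lemma rho_succ {k : ℕ} (hk : 1 ≤ k) : rho (k+1) = 2 * k * rho k := by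
  obtain ⟨k, rfl⟩ := Nat.exists_eq_add_of_le' hk
  rfl

lemma rho_pos (k : ℕ) : 1 ≤ rho k := by
  induction k with
  | zero => exact le_rfl
  | succ k ih =>
    rcases Nat.eq_zero_or_pos k with rfl | h
    · exact le_rfl
    · rw [rho_succ h]; exact Nat.mul_pos (by omega) ih

lemma rho_mono : Monotone rho := by
  apply monotone_nat_of_le_succ
  intro k
  rcases Nat.eq_zero_or_pos k with rfl | h
  · exact le_rfl
  · rw [rho_succ h]; exact Nat.le_mul_of_pos_left _ (by omega)

def bb (D : ℕ) (k : ℕ) : ℕ := ∏ i ∈ Finset.range k, D * rho (i+1)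

lemma bb_pos {D : ℕ} (hD : 1 ≤ D) (k : ℕ) : 1 ≤ bb D k :=
  Finset.prod_pos (fun i _ => Nat.mul_pos hD (rho_pos _))

lemma bb_succ (D k : ℕ) : bb D (k+1) = bb D k * (D * rho (k+1)) := Finset.prod_range_succ _ _

lemma bb_mono {D : ℕ} (hD : 1 ≤ D) : Monotone (bb D) := by
  apply monotone_nat_of_le_succ
  intro k
  rw [bb_succ]
  exact Nat.le_mul_of_pos_right _ (Nat.mul_pos hD (rho_pos _))

section
variable {N : ℕ}

def WW (N D k : ℕ) : Set (Fin (N+1) → ℂ) := {x | ∀ i : Fin (N+1), i.val ≤ k → x i = x 0 ^ bb D i}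

def ph (D k : ℕ) (x : Fin (N+1) → ℂ) : Fin (N+1) → ℂ := fun i => if i.val ≤ k then x 0 ^ bb D i else x i

lemma ph_mem (D k : ℕ) (x : Fin (N+1) → ℂ) : ph D k x ∈ WW N D k := by
  intro i hi
  simp [ph, hi, bb]

lemma ph_eq {D k : ℕ} {x : Fin (N+1) → ℂ} (hx : x ∈ WW N D k) : ph D k x = x := by
  funext i
  unfold ph
  split_ifs with h
  · exact (hx i h).symm
  · rfl

lemma WW_vi (D k : ℕ) (f : MvPolynomial (Fin (N+1)) ℂ) : f ∈ vanishingIdeal (N+1) (WW N D k) ↔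
    bind₁ (fun i : Fin (N+1) => if i.val ≤ k then (X 0 : MvPolynomial (Fin (N+1)) ℂ) ^ bb D i else X i) f = 0 := by
  have key : ∀ x : Fin (N+1) → ℂ, eval x (bind₁ (fun i : Fin (N+1) => if i.val ≤ k then (X 0 : MvPolynomial (Fin (N+1)) ℂ) ^ bb D i else X i) f) =
      eval (ph D k x) f := by
    intro x
    rw [← coe_aeval_eq_eval, ← coe_aeval_eq_eval]
    simp only [RingHom.coe_coe, aeval_bind₁]
    congr 2
    funext i
    unfold ph
    split_ifs <;> simp
  constructor
  · intro h
    apply MvPolynomial.funext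
    intro x
    rw [key, map_zero]
    exact h _ (ph_mem D k x)
  · intro h x hx
    rw [← ph_eq hx, ← key, h, map_zero]

lemma WW_irr (D k : ℕ) : IsIrredVariety (N+1) (WW N D k) := by
  apply irr_of_prime
  · refine ⟨{f | ∃ i : Fin (N+1), i.val ≤ k ∧ f = X i - X 0 ^ bb D i}, ?_⟩
    ext x
    constructor
    · rintro hx f ⟨i, hi, rfl⟩
      simp [← hx i hi]
    · intro hx i hi
      have := hx _ ⟨i, hi, rfl⟩
      simpa [sub_eq_zero] using this
  · exact ⟨_, ph_mem D k 0⟩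
  · have : vanishingIdeal (N+1) (WW N D k) = RingHom.ker (bind₁ (fun i : Fin (N+1) => if i.val ≤ k then (X 0 : MvPolynomial (Fin (N+1)) ℂ) ^ bb D i else X i)).toRingHom := by
      ext f
      exact WW_vi D k f
    rw [this]
    exact RingHom.ker_isPrime _

lemma WW_sub {D k l : ℕ} (h : k ≤ l) : WW N D l ⊆ WW N D k := fun _ hx i hi => hx i (hi.trans h)

lemma WW_dim {D : ℕ} (hD : 1 ≤ D) {k : ℕ} (hk : k ≤ N) : dim (N+1) (WW N D k) = N + 1 - k := by
  have hlt : ∀ k, k < N → dim (N+1) (WW N D (k+1)) < dim (N+1) (WW N D k) := by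
    intro k hk
    apply dim_lt (WW_irr _ _) (WW_irr _ _)
    refine ⟨WW_sub (by omega), fun h => ?_⟩
    have h1 : (fun i : Fin (N+1) => if i.val ≤ k then (1:ℂ) else 0) ∈ WW N D k := by
      intro i hi
      simp [hi]
    have h2 := h h1 ⟨k+1, by omega⟩ le_rfl
    simp at h2
  have h0 : ∀ k, k ≤ N → dim (N+1) (WW N D k) + k ≤ N + 1 := by
    intro k
    induction k with
    | zero => intro _; exact dim_le (WW_irr _ _)
    | succ k ih =>
      intro hk
      have := hlt k (by omega)
      have := ih (by omega)
      omega
  have h1 : ∀ j, j ≤ N → j + 1 ≤ dim (N+1) (WW N D (N-j)) := by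
    intro j
    induction j with
    | zero =>
      intro _
      have : dim (N+1) {(0 : Fin (N+1) → ℂ)} < dim (N+1) (WW N D (N-0)) := by
        apply dim_lt (irr_point _) (WW_irr _ _)
        constructor
        · rintro x rfl i _
          simp [Nat.one_le_iff_ne_zero.1 (bb_pos hD i)]
        · intro h
          have h2 : (1 : Fin (N+1) → ℂ) ∈ WW N D (N-0) := by intro i _; simp
          have := h h2
          simp at this
      omega
    | succ j ih =>
      intro hj
      have h3 := ih (by omega)
      have h4 := hlt (N-(j+1)) (by omega)
      rw [show N - (j+1) + 1 = N - j by omega] at h4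
      omega
  have h2 := h0 k hk
  have h3 := h1 (N-k) (by omega)
  rw [show N - (N-k) = k by omega] at h3
  omega

lemma Xle_WW {D j k : ℕ} (hD : 1 ≤ D) (hkj : k ≤ j) : Xle (WW N D j) (D * rho k) ⊆ WW N D k := by
  intro x hx
  have hstep : ∀ i, i + 1 ≤ k → ∀ h : i + 1 < N + 1, x ⟨i+1, h⟩ = x ⟨i, by omega⟩ ^ (D * rho (i+1)) := by
    intro i hi h
    have := hx (X ⟨i+1, h⟩ - X ⟨i, by omega⟩ ^ (D * rho (i+1))) ⟨?_, ?_⟩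
    · simpa [sub_eq_zero] using this
    · intro y hy
      have h1 := hy ⟨i+1, h⟩ (hi.trans hkj)
      have h2 := hy ⟨i, by omega⟩ (by simp; omega)
      simp only [map_sub, map_pow, eval_X, h1, h2, sub_eq_zero]
      rw [← pow_mul, bb_succ]
    · refine (totalDegree_sub _ _).trans (max_le ?_ ?_)
      · rw [totalDegree_X]; exact Nat.mul_pos hD (rho_pos _)
      · rw [totalDegree_X_pow]; exact Nat.mul_le_mul_left _ (rho_mono hi)
  rintro ⟨i, hi⟩ hik
  simp only at hik
  induction i with
  | zero => simp [bb]
  | succ i ih => rw [hstep i hik hi, ih (by omega) (by omega), ← pow_mul, bb_succ]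

lemma WW_low {D l : ℕ} (hD : 1 ≤ D) (hl : l + 1 ≤ N) {f : MvPolynomial (Fin (N+1)) ℂ}
    (hf : f ∈ vanishingIdeal (N+1) (WW N D (l+1))) (hd : f.totalDegree < D * rho (l+1)) :
    f ∈ vanishingIdeal (N+1) (WW N D l) := by
  intro x hx
  let p : ℂ → ℂ → Fin (N+1) → ℂ := fun t y i => if i.val ≤ l then t ^ bb D i else if i.val = l+1 then y else x i
  have hpx : p (x 0) (x ⟨l+1, by omega⟩) = x := by
    funext i
    simp only [p]
    split_ifs with h1 h2
    · exact (hx i h1).symm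
    · congr 1; ext; exact h2.symm
    · rfl
  have hb := bb_pos hD (l+1)
  have h1 : ∀ y, y ≠ 0 → ∀ t, eval (p t y) f = 0 := by
    intro y hy
    let q : Polynomial ℂ := aeval (fun i : Fin (N+1) => if i.val ≤ l then (Polynomial.X : Polynomial ℂ) ^ bb D i else
      if i.val = l+1 then Polynomial.C y else Polynomial.C (x i)) f
    have hq : ∀ t, q.eval t = eval (p t y) f := by
      intro t
      rw [← Polynomial.coe_evalRingHom, ← coe_aeval_eq_eval]
      simp only [q]
      rw [← Polynomial.coe_aeval_eq_evalRingHom]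
      simp only [RingHom.coe_coe]
      rw [comp_aeval_apply]
      congr 2
      funext i
      simp only [p]
      split_ifs <;> simp
    have hdeg : q.natDegree < bb D (l+1) := by
      have : q.natDegree ≤ f.totalDegree * bb D l := by
        apply MvPolynomial.aeval_natDegree_le f le_rfl
        intro i
        split_ifs with h1 h2
        · rw [Polynomial.natDegree_X_pow]; exact bb_mono hD h1
        · simp
        · simp
      refine this.trans_lt ?_
      rw [bb_succ, mul_comm]
      exact Nat.mul_lt_mul_of_pos_left hd (bb_pos hD l)
    have hq0 : q = 0 := by
      have hz : ∃ ζ : ℂ, IsPrimitiveRoot ζ (bb D (l+1)) := ⟨_, Complex.isPrimitiveRoot_exp _ (by omega)⟩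
      obtain ⟨ζ, hζ⟩ := hz
      obtain ⟨s, hs⟩ := IsAlgClosed.exists_pow_nat_eq y (n := bb D (l+1)) (by omega)
      have hs0 : s ≠ 0 := by
        rintro rfl
        rw [zero_pow (by omega)] at hs
        exact hy hs.symm
      apply Polynomial.eq_zero_of_natDegree_lt_card_of_eval_eq_zero q (ι := Fin (bb D (l+1))) (f := fun i => s * ζ ^ i.val)
      · intro i j hij
        have := mul_left_cancel₀ hs0 hij
        exact Fin.ext (hζ.pow_inj i.2 j.2 this)
      · intro i
        rw [hq]
        apply hf
        intro a ha
        have hpow : (s * ζ ^ i.val) ^ bb D (l+1) = y := by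
          rw [mul_pow, hs, ← pow_mul, mul_comm i.val, pow_mul, hζ.pow_eq_one, one_pow, mul_one]
        have h00 : p (s * ζ ^ i.val) y 0 = s * ζ ^ i.val := by simp [p, bb]
        rw [h00]
        simp only [p]
        split_ifs with h1 h2
        · rfl
        · rw [h2, hpow]
        · omega
      · simpa using hdeg
    intro t
    rw [← hq, hq0, Polynomial.eval_zero]
  let r : Polynomial ℂ := aeval (fun i : Fin (N+1) => if i.val ≤ l then Polynomial.C (x 0 ^ bb D i) else
      if i.val = l+1 then (Polynomial.X : Polynomial ℂ) else Polynomial.C (x i)) f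
  have hr : ∀ y, r.eval y = eval (p (x 0) y) f := by
    intro t
    rw [← Polynomial.coe_evalRingHom, ← coe_aeval_eq_eval]
    simp only [r]
    rw [← Polynomial.coe_aeval_eq_evalRingHom]
    simp only [RingHom.coe_coe]
    rw [comp_aeval_apply]
    congr 2
    funext i
    simp only [p]
    split_ifs <;> simp
  have hr0 : r = 0 := by
    apply Polynomial.eq_zero_of_infinite_isRoot
    refine Set.Infinite.mono ?_ (Set.Finite.infinite_compl (Set.finite_singleton (0:ℂ)))
    intro y hy
    change r.eval y = 0
    rw [hr, h1 y hy]
  rw [← hpx, ← hr, hr0, Polynomial.eval_zero]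

lemma WW_pd {D j k : ℕ} (hD : 1 ≤ D) (hj : j ≤ N) (hk : 1 ≤ k) (hkj : k ≤ j) :
    partialDeg (N+1) (WW N D j) k = D * rho k := by
  have hdj := WW_dim hD hj
  apply le_antisymm
  · rw [pd_le_iff (WW_irr _ _) hk (by omega)]
    intro W hW _ hX
    have := dim_mono hW (WW_irr _ _) (hX.trans (Xle_WW hD hkj))
    rwa [WW_dim hD (by omega)] at this
  · by_contra hcon
    push Not at hcon
    have h1 := (pd_le_iff (WW_irr (N := N) D j) hk (by omega) _).1 le_rfl (WW N D (k-1)) (WW_irr _ _) (WW_sub (by omega)) (by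
      apply sub_zl.2
      rintro f ⟨hf, hd⟩
      have : ∀ i, i ≤ j - (k-1) → f ∈ vanishingIdeal (N+1) (WW N D (j - i)) := by
        intro i
        induction i with
        | zero => intro _; exact hf
        | succ i ih =>
          intro hi
          apply WW_low hD (by omega)
          · rw [show j - (i+1) + 1 = j - i by omega]
            exact ih (by omega)
          · refine (hd.trans_lt hcon).trans_le ?_
            exact Nat.mul_le_mul_left _ (rho_mono (by omega))
      have := this _ le_rfl
      rwa [show j - (j - (k-1)) = k-1 by omega] at this)
    rw [WW_dim hD (by omega)] at h1
    omega

lemma WW_deg {c0 : ℝ} (hc0 : 0 < c0) (hCP : ChardinPhilippon (N+1) c0) {D j : ℕ} (hD : 1 ≤ D) (hj : j ≤ N) :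
    bb D j ≤ degree (N+1) (WW N D j) := by
  have hdj := WW_dim hD hj
  let U : Submodule ℂ (Fin (N+1) → ℂ) := ⨅ i ∈ {i : Fin (N+1) | j ≤ i.val}, LinearMap.ker (LinearMap.proj i)
  have hU : Module.finrank ℂ U = j := by
    rw [(LinearMap.iInfKerProjEquiv ℂ (fun _ : Fin (N+1) => ℂ) (I := {i : Fin (N+1) | i.val < j}) (J := {i : Fin (N+1) | j ≤ i.val})
      (by rw [Set.disjoint_left]; intro a h1 h2; simp at h1 h2; omega) (by intro a _; simp; omega)).finrank_eq]
    rw [Module.finrank_pi, Fintype.card_subtype]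
    simp only [Set.mem_ofPred_eq]
    rw [show (Finset.univ.filter fun i : Fin (N+1) => i.val < j) = Finset.Iio (⟨j, by omega⟩ : Fin (N+1)) by ext; simp [Fin.lt_def]]
    simp
  let p : Fin (N+1) → ℂ := fun i => if i.val = j then 1 else 0
  have hmem : ∀ x, x ∈ AffineSubspace.mk' p U ↔ ∀ i : Fin (N+1), j ≤ i.val → x i = p i := by
    intro x
    rw [AffineSubspace.mem_mk']
    simp [U, Submodule.mem_iInf, sub_eq_zero]
  have hb := bb_pos hD j
  let q : ℂ → Fin (N+1) → ℂ := fun t i => if i.val ≤ j then t ^ bb D i else 0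
  have heq : WW N D j ∩ (AffineSubspace.mk' p U : Set (Fin (N+1) → ℂ)) = q '' (Polynomial.nthRootsFinset (bb D j) (1:ℂ)) := by
    ext x
    simp only [Set.mem_inter_iff, SetLike.mem_coe, hmem, Set.mem_image, Polynomial.mem_nthRootsFinset hb]
    constructor
    · rintro ⟨h1, h2⟩
      refine ⟨x 0, ?_, ?_⟩
      · have := h2 ⟨j, by omega⟩ le_rfl
        rw [h1 ⟨j, by omega⟩ le_rfl] at this
        simpa [p] using this
      · funext i
        simp only [q]
        split_ifs with h
        · exact (h1 i h).symm
        · rw [h2 i (by omega)]; simp only [p]; rw [if_neg (by omega)]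
    · rintro ⟨t, ht, rfl⟩
      constructor
      · intro i hi
        simp [q, hi, bb]
      · intro i hi
        simp only [q, p]
        rcases eq_or_lt_of_le hi with h | h
        · rw [if_pos h.ge, if_pos h.symm, ← h, ht]
        · rw [if_neg (by omega), if_neg (by omega)]
  have hinj : Function.Injective q := by
    intro s t h
    have := congrFun h 0
    simpa [q, bb] using this
  have := le_degree hc0 hCP (WW_irr D j) (AffineSubspace.mk' p U) (by rw [AffineSubspace.direction_mk', hU, hdj]; omega)
    (by rw [heq]; exact (Finset.finite_toSet _).image _)
  refine le_trans ?_ this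
  rw [heq, Set.ncard_image_of_injective _ hinj, Set.ncard_coe_finset]
  rw [(Complex.isPrimitiveRoot_exp _ (by omega)).card_nthRootsFinset]
end

lemma adm_lt_iff {n : ℕ} {V : Set (Fin n → ℂ)} {i : ℕ} (h : i < n - dim n V) :
    Admissible n V i ↔ 2 * i * partialDeg n V i < partialDeg n V (i+1) := by
  unfold Admissible partialDegE
  rw [if_pos h.le, if_pos (by omega)]
  exact_mod_cast Iff.rfl

lemma adm_top {n : ℕ} (V : Set (Fin n → ℂ)) : Admissible n V (n - dim n V) := by
  unfold Admissible partialDegE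
  rw [if_pos le_rfl, if_neg (by omega)]
  exact_mod_cast ENat.natCast_lt_top _

lemma adm_zero {n : ℕ} {V : Set (Fin n → ℂ)} (hV : IsIrredVariety n V) : Admissible n V 0 := by
  rcases Nat.eq_zero_or_pos (n - dim n V) with h | h
  · have := adm_top V
    rwa [h] at this
  · rw [adm_lt_iff h]
    simpa [Nat.one_le_iff_ne_zero, Nat.pos_iff_ne_zero] using pd_pos hV (k := 1) le_rfl h

lemma Delta_pos {n : ℕ} (V : Set (Fin n → ℂ)) (i : ℕ) : 0 < Delta n V i := lt_of_lt_of_le one_pos (le_max_right _ _)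

lemma c1_le_one {N : ℕ} {c0 c1 : ℝ} (hCP : ChardinPhilippon (N+1) c0)
    (hcov : CoversPositiveIntegers (N+1) c0 c1) : c1 ≤ 1 := by
  have hV := irr_point (0 : Fin (N+1) → ℂ)
  have hd := dim_point (0 : Fin (N+1) → ℂ)
  set V : Set (Fin (N+1) → ℂ) := {0} with hVd
  have hpd : ∀ k, 1 ≤ k → k ≤ N+1 → partialDeg (N+1) V k = 1 := by
    intro k h1 h2
    refine le_antisymm ((pd_le_iff hV h1 (by omega) 1).2 ?_) (pd_pos hV h1 (by omega))
    intro W hW _ hX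
    have : W ⊆ V := by
      intro x hx
      rw [hVd, Set.mem_singleton_iff]
      funext i
      have := hX hx (X i) ⟨by rintro y rfl; simp, by rw [totalDegree_X]⟩
      simpa using this
    have := dim_mono hW hV this
    omega
  obtain ⟨i, hi, hR⟩ := hcov V hV 1 one_pos
  have hile := adm_le hi
  unfold RSet at hR
  have hdeg : degree (N+1) V = 1 := degree_point 0
  have hP : ∀ i, ∏ j ∈ Finset.Icc (i + 1) (N + 1 - dim (N+1) V), (partialDeg (N+1) V j : ℝ) = 1 := by
    intro i
    apply Finset.prod_eq_one
    intro j hj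
    rw [Finset.mem_Icc] at hj
    rw [hpd j (by omega) (by omega), Nat.cast_one]
  have hDl : ∀ i, Delta (N+1) V i = 1 := by
    intro i
    rw [Delta, hP, hdeg]; simp
  rw [hDl] at hR
  split_ifs at hR with h
  · rw [hd, Nat.sub_zero] at h
    rw [h, hpd _ (by omega) le_rfl] at hR
    simpa using hR
  · exfalso
    rcases Nat.eq_zero_or_pos i with rfl | h0
    · have := hR.2
      have h1 := c0_le_one hCP
      rw [hpd _ (by omega) (by omega)] at this
      simp at this
      linarith
    · rw [adm_lt_iff (by omega), hpd _ h0 (by omega), hpd _ (by omega) (by omega)] at hi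
      omega

lemma c1_rho {N : ℕ} {c0 c1 : ℝ} (hc0 : 0 < c0) (hc1 : 0 < c1) (hCP : ChardinPhilippon (N+1) c0)
    (hcov : CoversPositiveIntegers (N+1) c0 c1) {j : ℕ} (hj1 : 1 ≤ j) (hj : j ≤ N) :
    c1 * (rho j : ℝ) ^ (N + 1 - j) ≤ c0 / 2 := by
  have main : ∀ D : ℕ, 1 ≤ D → c1 * (rho j : ℝ) ^ (N + 1 - j) ≤ c0 / 2 + 1 / D := by
    intro D hD
    have hV := WW_irr (N := N) D j
    have hd := WW_dim hD hj
    have hdeg := WW_deg hc0 hCP hD hj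
    have hpd := fun k (h1 : 1 ≤ k) (h2 : k ≤ j) => WW_pd (N := N) hD hj h1 h2
    set V := WW N D j with hVd
    have hnd : N + 1 - dim (N+1) V = j := by omega
    set g : ℝ := (degree (N+1) V : ℝ) with hg
    have hb := bb_pos hD j
    have hb' : (0:ℝ) < bb D j := by exact_mod_cast hb
    have hgb : (bb D j : ℝ) ≤ g := by rw [hg]; exact_mod_cast hdeg
    have hg1 : 1 ≤ g := le_trans (by exact_mod_cast hb) hgb
    have hP : ∏ k ∈ Finset.Icc (0 + 1) (N + 1 - dim (N+1) V), (partialDeg (N+1) V k : ℝ) = bb D j := by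
      rw [hnd, bb, Nat.cast_prod, Finset.range_eq_Ico, Finset.prod_Ico_add' (fun k => ((D * rho k : ℕ) : ℝ)) 0 j 1]
      apply Finset.prod_congr
      · ext; simp
      · intro k hk
        rw [Finset.mem_Ico] at hk
        rw [hpd k (by omega) (by omega)]
    have hD0 : Delta (N+1) V 0 = g / bb D j := by
      rw [Delta, hP, max_eq_left]
      rw [le_div_iff₀ hb']; linarith
    have hDj : Delta (N+1) V j = g := by
      rw [Delta, hnd, Finset.Icc_eq_empty (by omega), Finset.prod_empty, div_one, max_eq_left hg1]
    set u := (c0 / 2) * (D:ℝ) ^ (N + 1) * (g / bb D j) with hu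
    have hu0 : 0 ≤ u := by positivity
    obtain ⟨i, hi, hR⟩ := hcov V hV (⌊u⌋₊ + 1) (by omega)
    have hile := adm_le hi
    have hgt : u < ((⌊u⌋₊ + 1 : ℕ) : ℝ) := by push_cast; exact Nat.lt_floor_add_one u
    have hij : i = j := by
      by_contra hne
      rcases Nat.eq_zero_or_pos i with rfl | h0
      · rw [RSet, if_neg (by omega)] at hR
        have := hR.2
        rw [hpd _ (by omega) (by omega), hD0] at this
        have e : ((D * rho (0+1) : ℕ) : ℝ) = D := by simp [rho]
        rw [e, Nat.sub_zero] at this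
        linarith
      · rw [adm_lt_iff (by omega), hpd _ h0 (by omega), hpd _ (by omega) (by omega), rho_succ h0] at hi
        nlinarith
    subst hij
    rw [RSet, if_pos hnd.symm, Set.mem_Ici, hpd i hj1 le_rfl, hDj] at hR
    have hle : ((⌊u⌋₊ + 1 : ℕ) : ℝ) ≤ u + 1 := by push_cast; linarith [Nat.floor_le hu0]
    have hDp : (1:ℝ) ≤ D := by exact_mod_cast hD
    have hbD : (D:ℝ) ^ i ≤ bb D i := by
      have : D ^ i ≤ bb D i := by
        unfold bb
        rw [← Finset.card_range i, ← Finset.prod_const, Finset.card_range]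
        exact Finset.prod_le_prod' (fun k _ => Nat.le_mul_of_pos_right _ (rho_pos _))
      exact_mod_cast this
    have hu2 : u ≤ (c0 / 2) * D ^ (N + 1 - i) * g := by
      rw [hu, ← mul_div_assoc, div_le_iff₀ hb']
      calc c0 / 2 * (D:ℝ) ^ (N + 1) * g = c0 / 2 * D ^ (N + 1 - i) * g * D ^ i := by
            rw [show (D:ℝ) ^ (N+1) = D ^ (N + 1 - i) * D ^ i by rw [← pow_add]; congr 1; omega]; ring
        _ ≤ _ := by gcongr
    have hDe : (D:ℝ) ≤ D ^ (N + 1 - i) := le_self_pow₀ hDp (by omega)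
    have h3 : (c1 * (rho i : ℝ) ^ (N + 1 - i)) * (D ^ (N + 1 - i) * g) ≤ (c0 / 2 + 1 / D) * (D ^ (N + 1 - i) * g) := by
      have : 1 ≤ (1 / (D:ℝ)) * (D ^ (N + 1 - i) * g) := by
        rw [one_div, ← div_eq_inv_mul, le_div_iff₀ (by linarith), one_mul]
        nlinarith
      push_cast at hR
      rw [mul_pow] at hR
      push_cast at hle
      nlinarith
    exact le_of_mul_le_mul_right h3 (by positivity)
  have hlim : Filter.Tendsto (fun D : ℕ => c0 / 2 + 1 / (D:ℝ)) Filter.atTop (nhds (c0 / 2 + 0)) :=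
    tendsto_const_nhds.add tendsto_one_div_atTop_nhds_zero_nat
  rw [add_zero] at hlim
  exact ge_of_tendsto hlim (Filter.eventually_atTop.2 ⟨1, main⟩)

lemma iV_mem {N n : ℕ} (hn : n = N + 1) {c0 c1 : ℝ} (hc0 : 0 < c0) (hc1 : 0 < c1) (hCP : ChardinPhilippon n c0)
    (hcov : CoversPositiveIntegers n c0 c1) {V : Set (Fin n → ℂ)} (hV : IsIrredVariety n V) (M : ℕ) :
    {i | Admissible n V i ∧ (M : ℝ) ^ (n - i) * Delta n V i ∈ RSet n c0 c1 V i}.Nonempty := by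
  classical
  by_contra hcon
  rw [Set.not_nonempty_iff_eq_empty, Set.eq_empty_iff_forall_notMem] at hcon
  have hdn := dim_le hV
  set k := n - dim n V with hk
  let P : ℕ → Prop := fun i => Admissible n V i ∧ c1 * (partialDeg n V i : ℝ) ^ (n - i) ≤ (M:ℝ) ^ (n - i)
  have hP0 : P 0 := ⟨adm_zero hV, by rw [pd_zero]; simp [hn]⟩
  set i := Nat.findGreatest P k with hi
  have hPi : P i := Nat.findGreatest_spec (Nat.zero_le _) hP0
  have hik : i ≤ k := adm_le hPi.1
  have hΔ := Delta_pos V i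
  have hlt : i < k := by
    rcases hik.lt_or_eq with h | h
    · exact h
    · refine absurd ⟨hPi.1, ?_⟩ (hcon i)
      rw [RSet, if_pos h]
      exact mul_le_mul_of_nonneg_right hPi.2 hΔ.le
  have hgt : c0 / 2 * (partialDeg n V (i+1) : ℝ) ^ (n - i) < (M:ℝ) ^ (n - i) := by
    by_contra h
    push Not at h
    refine absurd ⟨hPi.1, ?_⟩ (hcon i)
    rw [RSet, if_neg hlt.ne]
    exact ⟨mul_le_mul_of_nonneg_right hPi.2 hΔ.le, mul_le_mul_of_nonneg_right h hΔ.le⟩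
  have hex : ∃ j, i < j ∧ Admissible n V j := ⟨k, hlt, adm_top V⟩
  set j := Nat.find hex with hj
  obtain ⟨hij, hadj⟩ := Nat.find_spec hex
  rw [← hj] at hij hadj
  have hjk : j ≤ k := adm_le hadj
  have hPj : (M:ℝ) ^ (n - j) < c1 * (partialDeg n V j : ℝ) ^ (n - j) := by
    by_contra h
    push Not at h
    exact Nat.findGreatest_is_greatest hij hjk ⟨hadj, h⟩
  have hc1' : c1 ≤ 1 := by subst hn; exact c1_le_one hCP hcov
  have hjn : j < n := by
    by_contra h
    rw [show n - j = 0 by omega] at hPj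
    simp at hPj
    linarith
  have hδ : ∀ l, i + 1 + l ≤ j → partialDeg n V (i+1+l) ≤ rho (i+1+l) * partialDeg n V (i+1) := by
    intro l
    induction l with
    | zero => intro _; exact Nat.le_mul_of_pos_left _ (rho_pos _)
    | succ l ih =>
      intro hl
      have h1 := ih (by omega)
      have h2 : ¬ Admissible n V (i+1+l) := fun h => Nat.find_min hex (m := i+1+l) (by omega) ⟨by omega, h⟩
      rw [adm_lt_iff (by omega)] at h2
      push Not at h2
      refine h2.trans ?_
      rw [← add_assoc, rho_succ (by omega), mul_assoc (2 * (i+1+l))]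
      exact Nat.mul_le_mul_left _ h1
  have hδj : (partialDeg n V j : ℝ) ≤ rho j * partialDeg n V (i+1) := by
    have := hδ (j - (i+1)) (by omega)
    rw [show i + 1 + (j - (i+1)) = j by omega] at this
    exact_mod_cast this
  set δ : ℝ := (partialDeg n V (i+1) : ℝ) with hδd
  have hδ1 : 1 ≤ δ := by rw [hδd]; exact_mod_cast pd_pos hV (k := i+1) (by omega) hlt
  have h4 : (M:ℝ) ^ (n - j) < c0 / 2 * δ ^ (n - j) := by
    calc (M:ℝ) ^ (n - j) < c1 * (partialDeg n V j : ℝ) ^ (n - j) := hPj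
      _ ≤ c1 * (rho j * δ) ^ (n - j) := by gcongr
      _ = (c1 * (rho j:ℝ) ^ (n - j)) * δ ^ (n - j) := by rw [mul_pow]; ring
      _ ≤ _ := by
        gcongr
        subst hn
        exact c1_rho hc0 hc1 hCP hcov (by omega) (by omega)
  have hc0' := c0_le_one hCP
  have h5 : (M:ℝ) < δ := by
    apply lt_of_pow_lt_pow_left₀ (n - j) (by linarith)
    refine h4.trans_le ?_
    have : 0 < δ ^ (n - j) := by positivity
    nlinarith
  have h6 : (M:ℝ) ^ (n - i) ≤ c0 / 2 * δ ^ (n - i) := by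
    rw [show n - i = (n - j) + (j - i) by omega, pow_add, pow_add, ← mul_assoc]
    gcongr
  linarith

/-- The main lower bound. -/
lemma lb_main {n : ℕ} {c0 c1 : ℝ} (hc0 : 0 < c0) (hc1 : 0 < c1) (hCP : ChardinPhilippon n c0)
    (hcov : CoversPositiveIntegers n c0 c1) : ∃ (C : ℕ) (c : ℝ), 1 ≤ C ∧ 0 < c ∧ 
    ∀ V, IsIrredVariety n V → ∀ M : ℕ, 1 ≤ M →
      c * ((M:ℝ) ^ (n - iV n c0 c1 V M) * Delta n V (iV n c0 c1 V M)) ≤ hilbert n V (C * M) := by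
  have hK := KK_one n
  have hK0 : 0 < KK n := by linarith
  have hc := c0_le_one hCP
  have hq : c0 / KK n ≤ 1 := (div_le_one hK0).2 (by linarith)
  have hq0 : 0 < c0 / KK n := by positivity
  have hq1 : (c0 / KK n) ^ (n + 1) ≤ 1 := pow_le_one₀ hq0.le hq
  have hpt : ∀ V : Set (Fin n → ℂ), IsIrredVariety n V → dim n V = 0 → ∀ i, n ≤ i → Delta n V i = 1 := by
    intro V hV hd i hi
    obtain ⟨p, hp⟩ := hV.2.1
    have := eq_of_dim (irr_point p) hV (by simpa using hp) (by omega)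
    rw [Delta, ← this, degree_point, Finset.Icc_eq_empty (by omega)]
    simp
  refine ⟨⌈1 / c1⌉₊ + 1, (c0 / KK n) ^ (n + 1), by omega, by positivity, ?_⟩
  intro V hV M hM
  have hdn := dim_le hV
  have hHp : (1:ℝ) ≤ hilbert n V ((⌈1 / c1⌉₊ + 1) * M) := by exact_mod_cast hilbert_pos hV.2.1 _
  cases n with
  | zero =>
    rw [hpt V hV (by omega) _ (Nat.zero_le _), Nat.zero_sub, pow_zero]
    linarith
  | succ N =>
    obtain ⟨hadm, hR⟩ := Nat.sInf_mem (iV_mem rfl hc0 hc1 hCP hcov hV M)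
    change Admissible (N+1) V (iV (N+1) c0 c1 V M) at hadm
    change (M:ℝ) ^ (N + 1 - iV (N+1) c0 c1 V M) * Delta (N+1) V (iV (N+1) c0 c1 V M) ∈ RSet (N+1) c0 c1 V (iV (N+1) c0 c1 V M) at hR
    set i := iV (N+1) c0 c1 V M with hi
    have hΔ := Delta_pos V i
    have hile := adm_le hadm
    rcases Nat.eq_zero_or_pos (N + 1 - i) with he | he
    · rw [hpt V hV (by omega) i (by omega), he, pow_zero]
      linarith
    have hc1' := c1_le_one hCP hcov
    have hlow : c1 * (partialDeg (N+1) V i : ℝ) ^ (N + 1 - i) ≤ (M:ℝ) ^ (N + 1 - i) := by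
      refine le_of_mul_le_mul_right ?_ hΔ
      rw [RSet] at hR
      split_ifs at hR
      · exact hR
      · exact hR.1
    have hup : i < N + 1 - dim (N+1) V → M ≤ partialDeg (N+1) V (i+1) := by
      intro h
      rw [RSet, if_neg h.ne] at hR
      have h2 := le_of_mul_le_mul_right hR.2 hΔ
      have : (M:ℝ) ≤ partialDeg (N+1) V (i+1) := by
        apply le_of_pow_le_pow_left₀ he.ne' (by positivity)
        refine h2.trans ?_
        have : (0:ℝ) ≤ (partialDeg (N+1) V (i+1) : ℝ) ^ (N + 1 - i) := by positivity
        nlinarith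
      exact_mod_cast this
    have hδM : partialDeg (N+1) V i ≤ (⌈1 / c1⌉₊ + 1) * M := by
      have h1 : c1 * (partialDeg (N+1) V i : ℝ) ≤ M := by
        apply le_of_pow_le_pow_left₀ he.ne' (by positivity)
        refine le_trans ?_ hlow
        rw [mul_pow]
        gcongr
        exact pow_le_of_le_one hc1.le hc1' he.ne'
      have h2 : (partialDeg (N+1) V i : ℝ) ≤ (⌈1 / c1⌉₊ + 1) * M := by
        have h3 : 1 / c1 ≤ ⌈1 / c1⌉₊ := Nat.le_ceil _
        calc (partialDeg (N+1) V i : ℝ) = (1 / c1) * (c1 * partialDeg (N+1) V i) := by field_simp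
          _ ≤ (⌈1 / c1⌉₊ + 1) * M := by gcongr; linarith
      exact_mod_cast h2
    have hF := lbF hc0 hCP hV hile (m := max M (partialDeg (N+1) V i)) (hM.trans (le_max_left _ _)) (le_max_right _ _) (by
      intro h
      exact max_le (hup h) (pd_mono hV (by omega) (by omega)))
    calc _ ≤ (c0 / KK (N+1)) ^ (N + 1 + 1) * (((max M (partialDeg (N+1) V i) : ℕ):ℝ) ^ (N + 1 - i) * Delta (N+1) V i) := by
          gcongr
          exact_mod_cast le_max_left _ _
      _ ≤ _ := hF
      _ ≤ _ := by
        exact_mod_cast hilbert_mono V (max_le (Nat.le_mul_of_pos_left _ (by omega)) hδM)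

section chains
open Classical

abbrev Ch (E : Type) := Multiset E →₀ ZMod 2

variable {E : Type}

lemma ch_self (z : Ch E) : z + z = 0 := by
  rw [← two_smul (ZMod 2) z, show (2 : ZMod 2) = 0 from rfl, zero_smul]

def bd : Ch E →ₗ[ZMod 2] Ch E :=
  Finsupp.linearCombination (ZMod 2) (fun s : Multiset E => (s.map (fun v => (Finsupp.single (s.erase v) 1 : Ch E))).sum)

def cone (v : E) : Ch E →ₗ[ZMod 2] Ch E := Finsupp.lmapDomain (ZMod 2) (ZMod 2) (fun s => v ::ₘ s)

lemma cone_single (v : E) (s : Multiset E) : cone v (Finsupp.single s 1) = Finsupp.single (v ::ₘ s) 1 := by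
  simp [cone, Finsupp.mapDomain_single]

lemma bd_single (s : Multiset E) : bd (Finsupp.single s 1) = (s.map (fun v => (Finsupp.single (s.erase v) 1 : Ch E))).sum := by
  simp [bd]

lemma ch_ext {F : Type*} [AddCommGroup F] [Module (ZMod 2) F] {f g : Ch E →ₗ[ZMod 2] F} (h : ∀ s, f (Finsupp.single s 1) = g (Finsupp.single s 1)) (z : Ch E) : f z = g z := by
  have : f = g := Finsupp.lhom_ext' (fun s => LinearMap.ext_ring (h s))
  rw [this]

lemma ch_ext2 (a b c d : Ch E →ₗ[ZMod 2] Ch E) (h : ∀ s, a (b (Finsupp.single s 1)) = c (d (Finsupp.single s 1))) (z : Ch E) : a (b z) = c (d z) :=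
  ch_ext (f := a ∘ₗ b) (g := c ∘ₗ d) h z

lemma bd_cone (v : E) (z : Ch E) : bd (cone v z) = z + cone v (bd z) := by
  refine ch_ext (f := bd ∘ₗ cone v) (g := LinearMap.id + cone v ∘ₗ bd) (fun s => ?_) z
  simp only [LinearMap.comp_apply, LinearMap.add_apply, LinearMap.id_apply]
  rw [cone_single, bd_single, bd_single, Multiset.map_cons, Multiset.sum_cons, Multiset.erase_cons_head, map_multiset_sum, Multiset.map_map]
  congr 2
  apply Multiset.map_congr rfl
  intro u hu
  simp only [Function.comp, cone_single]
  by_cases h : u = v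
  · subst h; rw [Multiset.erase_cons_head, Multiset.cons_erase hu]
  · rw [Multiset.erase_cons_tail _ (Ne.symm h)]

lemma bd_zero : bd (Finsupp.single (0 : Multiset E) 1) = 0 := by simp [bd_single]

lemma bd_bd (z : Ch E) : bd (bd z) = 0 := by
  refine ch_ext (f := bd ∘ₗ bd) (g := 0) (fun s => ?_) z
  simp only [LinearMap.comp_apply, LinearMap.zero_apply]
  induction s using Multiset.induction_on with
  | empty => rw [bd_zero, map_zero]
  | cons v s ih => rw [← cone_single, bd_cone, map_add, bd_cone, ih, map_zero, add_zero, ch_self]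

variable [NormedAddCommGroup E] [NormedSpace ℝ E]

def Tm : Ch E →ₗ[ZMod 2] Ch E := Finsupp.lmapDomain (ZMod 2) (ZMod 2) (fun s => s.map Neg.neg)

lemma Tm_single (s : Multiset E) : Tm (Finsupp.single s 1) = Finsupp.single (s.map Neg.neg) 1 := by
  simp [Tm, Finsupp.mapDomain_single]

lemma Tm_cone (v : E) (z : Ch E) : Tm (cone v z) = cone (-v) (Tm z) := by
  refine ch_ext (f := Tm ∘ₗ cone v) (g := cone (-v) ∘ₗ Tm) (fun s => ?_) z
  simp [cone_single, Tm_single]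

lemma Tm_bd (z : Ch E) : Tm (bd z) = bd (Tm z) := by
  refine ch_ext2 Tm (bd) (bd) Tm (fun s => ?_) z
  induction s using Multiset.induction_on with
  | empty => rw [bd_zero, Tm_single, Multiset.map_zero, bd_zero, map_zero]
  | cons v s ih => rw [← cone_single, bd_cone, map_add, Tm_cone, Tm_cone, bd_cone, ih]

lemma Tm_Tm (z : Ch E) : Tm (Tm z) = z := by
  refine ch_ext (f := Tm ∘ₗ Tm) (g := LinearMap.id) (fun s => ?_) z
  simp [Tm_single, Multiset.map_map, Function.comp]

def bary (s : Multiset E) : E := (1 / (s.card : ℝ)) • s.sum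

def sd : ℕ → (Ch E →ₗ[ZMod 2] Ch E)
  | 0 => LinearMap.id
  | (k+1) => Finsupp.linearCombination (ZMod 2) (fun s => cone (bary s) (sd k (bd (Finsupp.single s 1))))

lemma sd_single (k : ℕ) (s : Multiset E) : sd (k+1) (Finsupp.single s 1) = cone (bary s) (sd k (bd (Finsupp.single s 1))) := by
  simp [sd]

lemma bd_sd (k : ℕ) : ∀ z : Ch E, bd (sd (k+1) z) = sd k (bd z) := by
  induction k with
  | zero =>
    intro z
    refine ch_ext2 bd (sd 1) (sd 0) bd (fun s => ?_) z
    rw [sd_single, bd_cone]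
    simp [sd, bd_bd]
  | succ k ih =>
    intro z
    refine ch_ext2 bd (sd (k+1+1)) (sd (k+1)) bd (fun s => ?_) z
    rw [sd_single, bd_cone, ih, bd_bd, map_zero, map_zero, add_zero]

lemma Tm_sd (k : ℕ) : ∀ z : Ch E, Tm (sd k z) = sd k (Tm z) := by
  induction k with
  | zero => intro z; rfl
  | succ k ih =>
    intro z
    refine ch_ext2 Tm (sd (k+1)) (sd (k+1)) Tm (fun s => ?_) z
    rw [sd_single, Tm_cone, ih, Tm_bd, Tm_single, sd_single]
    have : (s.map Neg.neg).sum = -s.sum := (map_multiset_sum (negAddMonoidHom (α := E)) s).symm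
    congr 2
    simp [bary, this]

lemma sup_map {A B : Set (Multiset E)} (L : Ch E →ₗ[ZMod 2] Ch E)
    (h : ∀ s ∈ A, L (Finsupp.single s 1) ∈ Finsupp.supported (ZMod 2) (ZMod 2) B) {z : Ch E}
    (hz : z ∈ Finsupp.supported (ZMod 2) (ZMod 2) A) : L z ∈ Finsupp.supported (ZMod 2) (ZMod 2) B := by
  have : Finsupp.supported (ZMod 2) (ZMod 2) A ≤ (Finsupp.supported (ZMod 2) (ZMod 2) B).comap L := by
    rw [Finsupp.supported_eq_span_single, Submodule.span_le]
    rintro _ ⟨s, hs, rfl⟩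
    exact h s hs
  exact this hz

def AA (k : ℕ) (r : ℝ) (C : Set E) : Set (Multiset E) :=
  {s | s.card = k ∧ (∀ x ∈ s, x ∈ C) ∧ ∀ x ∈ s, ∀ y ∈ s, dist x y ≤ r}

lemma bary_dist {K : ℕ} {r : ℝ} {s : Multiset E} {x : E} (hx : x ∈ s) (hs : s.card ≤ K)
    (hr : ∀ x ∈ s, ∀ y ∈ s, dist x y ≤ r) : dist (bary s) x ≤ (1 - 1 / K) * r := by
  obtain ⟨t, rfl⟩ := Multiset.exists_cons_of_mem hx
  have hr0 : 0 ≤ r := dist_nonneg.trans (hr x hx x hx)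
  rw [Multiset.card_cons] at hs
  have h1 : bary (x ::ₘ t) - x = (1 / ((t.card : ℝ) + 1)) • (t.map (fun y => y - x)).sum := by
    have : (t.map (fun y => y - x)).sum = t.sum - (t.card : ℝ) • x := by
      rw [Multiset.sum_map_sub, Multiset.map_id', Multiset.map_const', Multiset.sum_replicate, Nat.cast_smul_eq_nsmul]
    rw [this, bary, Multiset.card_cons, Multiset.sum_cons]
    have h2 : ((t.card : ℝ) + 1) ≠ 0 := by positivity
    push_cast
    rw [smul_sub, smul_smul, smul_add]
    have h3 : x = (1 / ((t.card : ℝ) + 1)) • x + (1 / ((t.card : ℝ) + 1) * t.card) • x := by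
      rw [← add_smul]
      rw [show 1 / ((t.card : ℝ) + 1) + 1 / ((t.card : ℝ) + 1) * t.card = 1 by field_simp; ring, one_smul]
    nth_rw 2 [h3]
    abel
  have h4 : ‖(t.map (fun y => y - x)).sum‖ ≤ t.card * r := by
    have h5 : ∀ u : Multiset E, u ≤ t → ‖(u.map (fun y => y - x)).sum‖ ≤ u.card * r := by
      intro u
      induction u using Multiset.induction_on with
      | empty => simp
      | cons y u ih =>
        intro hu
        rw [Multiset.map_cons, Multiset.sum_cons, Multiset.card_cons]
        have h6 := ih ((Multiset.le_cons_self _ _).trans hu)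
        have h7 : ‖y - x‖ ≤ r := by
          rw [← dist_eq_norm]
          exact hr _ (Multiset.mem_cons_of_mem (Multiset.mem_of_le hu (Multiset.mem_cons_self _ _))) _ hx
        push_cast
        linarith [norm_add_le (y - x) (u.map (fun y => y - x)).sum]
    exact h5 t le_rfl
  rw [dist_eq_norm, h1, norm_smul, Real.norm_of_nonneg (by positivity)]
  have hK : ((t.card : ℝ) + 1) ≤ K := by exact_mod_cast hs
  have h6 : 1 / (K:ℝ) ≤ 1 / ((t.card : ℝ) + 1) := by gcongr
  calc _ ≤ 1 / ((t.card : ℝ) + 1) * (t.card * r) := by gcongr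
    _ = (1 - 1 / ((t.card : ℝ) + 1)) * r := by field_simp; ring
    _ ≤ _ := by gcongr

lemma bary_mem {C : Set E} (hC : Convex ℝ C) {s : Multiset E} (hs : s ≠ 0) (h : ∀ x ∈ s, x ∈ C) : bary s ∈ C := by
  have h1 : ∀ u : Multiset E, u ≠ 0 → (∀ x ∈ u, x ∈ C) → bary u ∈ C := by
    intro u
    induction u using Multiset.induction_on with
    | empty => intro h; exact absurd rfl h
    | cons x u ih =>
      intro _ hu
      rcases eq_or_ne u 0 with rfl | h0
      · simpa [bary] using hu x (by simp)
      · have hb := ih h0 (fun y hy => hu y (Multiset.mem_cons_of_mem hy))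
        have hc : (0:ℝ) < u.card := by exact_mod_cast Multiset.card_pos.2 h0
        have := hC (hu x (Multiset.mem_cons_self _ _)) hb (a := 1 / (u.card + 1)) (b := u.card / (u.card + 1)) (by positivity) (by positivity) (by field_simp; ring)
        convert this using 1
        rw [bary, bary, smul_smul, Multiset.card_cons, Multiset.sum_cons, smul_add]
        congr 2
        · push_cast; rfl
        · push_cast; field_simp
  exact h1 s hs h

lemma sd_supp {K : ℕ} {r : ℝ} (hK : 1 ≤ K) (k : ℕ) : ∀ (C : Set E), Convex ℝ C → k ≤ K → ∀ z : Ch E,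
    z ∈ Finsupp.supported (ZMod 2) (ZMod 2) (AA k r C) → sd k z ∈ Finsupp.supported (ZMod 2) (ZMod 2) (AA k ((1 - 1 / K) * r) C) := by
  induction k with
  | zero =>
    intro C _ _ z hz
    refine Finsupp.supported_mono ?_ hz
    rintro s ⟨h1, h2, h3⟩
    rw [Multiset.card_eq_zero] at h1
    subst h1
    exact ⟨rfl, h2, by simp⟩
  | succ k ih =>
    intro C hC hk z hz
    refine sup_map _ ?_ hz
    rintro s ⟨h1, h2, h3⟩
    rw [sd_single]
    have hC' : Convex ℝ (C ∩ Metric.closedBall (bary s) ((1 - 1 / K) * r)) := hC.inter (convex_closedBall _ _)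
    have h4 : bd (Finsupp.single s 1) ∈ Finsupp.supported (ZMod 2) (ZMod 2) (AA k r (C ∩ Metric.closedBall (bary s) ((1 - 1 / K) * r))) := by
      rw [bd_single]
      apply multiset_sum_mem
      intro c hc
      rw [Multiset.mem_map] at hc
      obtain ⟨v, hv, rfl⟩ := hc
      apply Finsupp.single_mem_supported
      refine ⟨by rw [Multiset.card_erase_of_mem hv, h1]; rfl, ?_, ?_⟩
      · intro x hx
        have hx' := Multiset.mem_of_mem_erase hx
        exact ⟨h2 x hx', by rw [Metric.mem_closedBall, dist_comm]; exact bary_dist hx' (by omega) h3⟩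
      · intro x hx y hy
        exact h3 x (Multiset.mem_of_mem_erase hx) y (Multiset.mem_of_mem_erase hy)
    have h5 := ih _ hC' (by omega) _ h4
    refine sup_map (cone (bary s)) ?_ h5
    rintro t ⟨g1, g2, g3⟩
    rw [cone_single]
    apply Finsupp.single_mem_supported
    have hs0 : s ≠ 0 := by rintro rfl; simp at h1
    have hnn : 0 ≤ (1 - 1 / (K:ℝ)) * r := by
      obtain ⟨x, hx⟩ := Multiset.exists_mem_of_ne_zero hs0
      exact dist_nonneg.trans (bary_dist hx (by omega) h3)
    refine ⟨by rw [Multiset.card_cons, g1], ?_, ?_⟩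
    · intro x hx
      rcases Multiset.mem_cons.1 hx with rfl | hx
      · exact bary_mem hC hs0 h2
      · exact (g2 x hx).1
    · intro x hx y hy
      rcases Multiset.mem_cons.1 hx with rfl | hx <;> rcases Multiset.mem_cons.1 hy with rfl | hy
      · simpa using hnn
      · rw [dist_comm]; exact (g2 y hy).2
      · exact (g2 x hx).2
      · exact g3 x hx y hy

end chains

section fan

def BB : ℕ → Bool → Multiset (ℕ × Bool) → ZMod 2
  | 0, _, t => if t = 0 then 1 else 0
  | (k+1), σ, t => if (k, !σ) ∈ t then 0 else if t.count (k, σ) = 0 then BB k σ t else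
      if t.count (k, σ) = 1 then BB k (!σ) (t.erase (k, σ)) else 0

lemma BB_zero (k : ℕ) : ∀ σ, BB k σ 0 = 1 := by
  induction k with
  | zero => intro σ; simp [BB]
  | succ k ih => intro σ; simp [BB, ih]

lemma BB_card (k : ℕ) : ∀ σ t, k < t.card → BB k σ t = 0 := by
  induction k with
  | zero =>
    intro σ t h
    have : t ≠ 0 := by rintro rfl; simp at h
    simp [BB, this]
  | succ k ih =>
    intro σ t h
    rw [BB]
    split_ifs with h1 h2 h3
    · rfl
    · exact ih _ _ (by omega)
    · have : (k, σ) ∈ t := Multiset.count_pos.1 (by omega)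
      exact ih _ _ (by rw [Multiset.card_erase_of_mem this, Nat.pred_eq_sub_one]; omega)
    · rfl

def fl (x : ℕ × Bool) : ℕ × Bool := (x.1, !x.2)

lemma fl_inj : Function.Injective fl := by
  rintro ⟨a, b⟩ ⟨c, d⟩ h
  simpa [fl] using h

lemma BB_fl (k : ℕ) : ∀ σ t, BB k (!σ) t = BB k σ (t.map fl) := by
  induction k with
  | zero => intro σ t; simp [BB]
  | succ k ih =>
    intro σ t
    have h1 : (t.map fl).count (k, σ) = t.count (k, !σ) := by
      rw [← Multiset.count_map_eq_count' fl t fl_inj]; simp [fl]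
    have h2 : ((k, !σ) ∈ t.map fl) ↔ (k, σ) ∈ t := by
      rw [show (k, !σ) = fl (k, σ) from rfl, Multiset.mem_map_of_injective fl_inj]
    have h3 : (t.map fl).erase (k, σ) = (t.erase (k, !σ)).map fl := by
      rw [Multiset.map_erase _ fl_inj]; simp [fl]
    rw [BB, BB, h1, h3, ← ih, ← ih]
    simp only [h2, Bool.not_not]

lemma BB_bd (k : ℕ) : ∀ σ (t : Multiset (ℕ × Bool)), t ≠ 0 → (∀ x ∈ t, x.1 < k) → (∀ x ∈ t, fl x ∉ t) →
    (t.map (fun z => BB k σ (t.erase z))).sum = BB k σ t + BB k (!σ) t := by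
  induction k with
  | zero =>
    intro σ t h0 h1 _
    obtain ⟨x, hx⟩ := Multiset.exists_mem_of_ne_zero h0
    exact absurd (h1 x hx) (by omega)
  | succ k ih =>
    intro σ t h0 h1 h2
    have e0 : ∀ σ (u : Multiset (ℕ × Bool)), (k, !σ) ∉ u → (k, σ) ∉ u → BB (k+1) σ u = BB k σ u := by
      intro σ u g1 g2
      rw [BB, if_neg g1, if_pos (Multiset.count_eq_zero.2 g2)]
    have e1 : ∀ σ (u : Multiset (ℕ × Bool)), (k, !σ) ∈ u → BB (k+1) σ u = 0 := by
      intro σ u g1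
      rw [BB, if_pos g1]
    have e2 : ∀ σ (u : Multiset (ℕ × Bool)), (k, !σ) ∉ u → (k, σ) ∉ u → BB (k+1) σ ((k, σ) ::ₘ u) = BB k (!σ) u := by
      intro σ u g1 g2
      rw [BB, if_neg (by simpa using g1), if_neg (by simp), if_pos (by simp [g2]), Multiset.erase_cons_head]
    have e3 : ∀ σ (u : Multiset (ℕ × Bool)), 2 ≤ u.count (k, σ) → BB (k+1) σ u = 0 := by
      intro σ u g
      rw [BB]
      split_ifs <;> first | rfl | omega
    have lt : ∀ u : Multiset (ℕ × Bool), u ≤ t → (k, σ) ∉ u → (k, !σ) ∉ u → ∀ x ∈ u, x.1 < k := by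
      intro u hu g1 g2 x hx
      have := h1 x (Multiset.mem_of_le hu hx)
      rcases Nat.lt_succ_iff_lt_or_eq.1 this with h | h
      · exact h
      · exfalso
        obtain ⟨a, b⟩ := x
        simp only at h
        subst h
        rcases Bool.eq_or_eq_not b σ with rfl | rfl
        · exact g1 hx
        · exact g2 hx
    by_cases ha : (k, σ) ∈ t
    · have hb : (k, !σ) ∉ t := h2 _ ha
      have hbu : ∀ z, (k, !σ) ∉ t.erase z := fun z h => hb (Multiset.mem_of_mem_erase h)
      rw [e1 (!σ) t (by simpa using ha), add_zero]
      obtain ⟨u, rfl⟩ := Multiset.exists_cons_of_mem ha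
      have hbu' : (k, !σ) ∉ u := fun h => hb (Multiset.mem_cons_of_mem h)
      rw [Multiset.map_cons, Multiset.sum_cons, Multiset.erase_cons_head]
      have hE : ∀ z ∈ u, ((k, σ) ::ₘ u).erase z = (k, σ) ::ₘ u.erase z := by
        intro z hz
        by_cases h : z = (k, σ)
        · subst h; rw [Multiset.erase_cons_head, Multiset.cons_erase hz]
        · rw [Multiset.erase_cons_tail _ (Ne.symm h)]
      rw [Multiset.map_congr rfl (fun z hz => by rw [hE z hz])]
      by_cases hu : (k, σ) ∈ u
      · obtain ⟨w, rfl⟩ := Multiset.exists_cons_of_mem hu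
        have hw : (k, !σ) ∉ w := fun h => hbu' (Multiset.mem_cons_of_mem h)
        rw [Multiset.map_cons, Multiset.sum_cons, Multiset.erase_cons_head, ← add_assoc, CharTwo.add_self_eq_zero, zero_add, e3 _ ((k, σ) ::ₘ (k, σ) ::ₘ w) (by simp)]
        apply Multiset.sum_eq_zero
        intro c hc
        obtain ⟨z, hz, rfl⟩ := Multiset.mem_map.1 hc
        have : ((k, σ) ::ₘ w).erase z = (k, σ) ::ₘ w.erase z := by
          by_cases h : z = (k, σ)
          · subst h; rw [Multiset.erase_cons_head, Multiset.cons_erase hz]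
          · rw [Multiset.erase_cons_tail _ (Ne.symm h)]
        rw [this]
        exact e3 _ _ (by simp)
      · rw [e0 _ _ hbu' hu, e2 _ _ hbu' hu]
        have hz' : ∀ z, (k, σ) ∉ u.erase z := fun z h => hu (Multiset.mem_of_mem_erase h)
        have hz'' : ∀ z, (k, !σ) ∉ u.erase z := fun z h => hbu' (Multiset.mem_of_mem_erase h)
        rw [Multiset.map_congr rfl (fun z hz => e2 _ _ (hz'' z) (hz' z))]
        rcases eq_or_ne u 0 with rfl | hu0
        · simp [BB_zero]
        · rw [ih (!σ) u hu0 (lt u (Multiset.le_cons_self _ _) hu hbu') (fun x hx h => h2 x (Multiset.mem_cons_of_mem hx) (Multiset.mem_cons_of_mem h)), Bool.not_not,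
            add_comm (BB k (!σ) u), ← add_assoc, CharTwo.add_self_eq_zero, zero_add]
    · by_cases hb : (k, !σ) ∈ t
      · rw [e1 σ t hb, zero_add]
        obtain ⟨u, rfl⟩ := Multiset.exists_cons_of_mem hb
        have hau : (k, σ) ∉ u := fun h => ha (Multiset.mem_cons_of_mem h)
        rw [Multiset.map_cons, Multiset.sum_cons, Multiset.erase_cons_head]
        have hs : (u.map (fun z => BB (k+1) σ (((k, !σ) ::ₘ u).erase z))).sum = 0 := by
          apply Multiset.sum_eq_zero
          intro c hc
          obtain ⟨z, hz, rfl⟩ := Multiset.mem_map.1 hc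
          have hE : ((k, !σ) ::ₘ u).erase z = (k, !σ) ::ₘ u.erase z := by
            by_cases h : z = (k, !σ)
            · subst h; rw [Multiset.erase_cons_head, Multiset.cons_erase hz]
            · rw [Multiset.erase_cons_tail _ (Ne.symm h)]
          rw [hE]
          exact e1 _ _ (by simp)
        rw [hs, add_zero]
        by_cases hu : (k, !σ) ∈ u
        · rw [e1 _ _ hu, e3 _ _ (by rw [Multiset.count_cons_self]; have := Multiset.count_pos.2 hu; omega)]
        · rw [e0 _ _ hu hau, e2 _ _ (by simpa using hau) hu, Bool.not_not]
      · rw [e0 _ _ hb ha, e0 _ _ (by simpa using ha) hb, Multiset.map_congr rfl (fun z hz => e0 σ (t.erase z) (fun h => hb (Multiset.mem_of_mem_erase h)) (fun h => ha (Multiset.mem_of_mem_erase h)))]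
        exact ih σ t h0 (lt t le_rfl ha hb) h2

end fan

section evs
open Classical
variable {E : Type} [NormedAddCommGroup E] [NormedSpace ℝ E]

def ev (k : ℕ) (l : E → ℕ × Bool) : Ch E →ₗ[ZMod 2] ZMod 2 :=
  Finsupp.linearCombination (ZMod 2) (fun s => BB k true (s.map l))

lemma ev_single (k : ℕ) (l : E → ℕ × Bool) (s : Multiset E) : ev k l (Finsupp.single s 1) = BB k true (s.map l) := by
  simp [ev]

lemma lin_on {A : Set (Multiset E)} (f g : Ch E →ₗ[ZMod 2] ZMod 2)
    (h : ∀ s ∈ A, f (Finsupp.single s 1) = g (Finsupp.single s 1)) {z : Ch E}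
    (hz : z ∈ Finsupp.supported (ZMod 2) (ZMod 2) A) : f z = g z := by
  rw [Finsupp.supported_eq_span_single] at hz
  refine LinearMap.eqOn_span ?_ hz
  rintro _ ⟨s, hs, rfl⟩
  exact h s hs

lemma ev_bd {k : ℕ} {l : E → ℕ × Bool} {z : Ch E} {A : Set (Multiset E)}
    (hA : ∀ s ∈ A, s ≠ 0 ∧ (∀ x ∈ s, (l x).1 < k ∧ l (-x) = fl (l x)) ∧ ∀ x ∈ s, ∀ y ∈ s, l x ≠ fl (l y))
    (hz : z ∈ Finsupp.supported (ZMod 2) (ZMod 2) A) : ev k l (bd z) = ev k l (z + Tm z) := by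
  refine lin_on (A := A) (ev k l ∘ₗ bd) (ev k l ∘ₗ (LinearMap.id + Tm)) (fun s hs => ?_) hz
  obtain ⟨h0, h1, h2⟩ := hA s hs
  simp only [LinearMap.comp_apply, LinearMap.add_apply, LinearMap.id_apply, map_add]
  rw [bd_single, Tm_single, ev_single, ev_single, map_multiset_sum, Multiset.map_map, Multiset.map_map]
  have e1 : s.map (l ∘ Neg.neg) = (s.map l).map fl := by
    rw [Multiset.map_map]
    exact Multiset.map_congr rfl (fun x hx => (h1 x hx).2)
  rw [e1, ← BB_fl, ← BB_bd k true (s.map l) (by simpa using h0), Multiset.map_map]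
  · congr 1
    apply Multiset.map_congr rfl
    intro x hx
    simp only [Function.comp, ev_single]
    rw [Multiset.map_erase_of_mem _ _ hx]
  · intro y hy
    obtain ⟨x, hx, rfl⟩ := Multiset.mem_map.1 hy
    exact (h1 x hx).1
  · intro y hy h
    obtain ⟨x, hx, rfl⟩ := Multiset.mem_map.1 hy
    obtain ⟨x', hx', e⟩ := Multiset.mem_map.1 h
    exact h2 x' hx' x hx e

end evs

section cross
open Classical

def ee (k i : ℕ) : Fin (k+1) → ℝ := fun j => if j.val = i then 1 else 0

def cc (k : ℕ) : ℕ → Ch (Fin (k+1) → ℝ)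
  | 0 => Finsupp.single {ee k 0} 1
  | (d+1) => cone (ee k (d+1)) (cc k d + Tm (cc k d))

lemma cc_succ (k d : ℕ) : cc k (d+1) = cone (ee k (d+1)) (cc k d + Tm (cc k d)) := rfl

lemma bd_cc0 (k : ℕ) : bd (cc k 0) = Finsupp.single 0 1 := by
  rw [cc, bd_single]; simp

lemma bd_cc_inv (k d : ℕ) : bd (cc k d) + Tm (bd (cc k d)) = 0 ∧ bd (cc k (d+1)) = cc k d + Tm (cc k d) := by
  induction d with
  | zero =>
    have h : bd (cc k 0) + Tm (bd (cc k 0)) = 0 := by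
      rw [bd_cc0, Tm_single, Multiset.map_zero, ch_self]
    refine ⟨h, ?_⟩
    rw [cc_succ, bd_cone, map_add, ← Tm_bd, h, map_zero, add_zero]
  | succ d ih =>
    have h : bd (cc k (d+1)) + Tm (bd (cc k (d+1))) = 0 := by
      rw [ih.2, map_add, Tm_Tm, add_comm (Tm (cc k d)), ch_self]
    refine ⟨h, ?_⟩
    rw [cc_succ, bd_cone, map_add, ← Tm_bd, h, map_zero, add_zero]

def Cs (k : ℕ) (σ : ℕ → ℝ) : Set (Fin (k+1) → ℝ) := {x | (∀ i : Fin (k+1), 0 ≤ σ i * x i) ∧ ∑ i : Fin (k+1), σ i * x i = 1}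
def Ks (k : ℕ) : Set (Fin (k+1) → ℝ) := {x | ∑ i, |x i| = 1}
def Sg (σ : ℕ → ℝ) : Prop := ∀ i, σ i = 1 ∨ σ i = -1
def DD (k d : ℕ) (r : ℝ) : Set (Multiset (Fin (k+1) → ℝ)) := {s | ∃ σ, Sg σ ∧ s ∈ AA (d+1) r (Cs k σ)}

lemma Cs_convex (k : ℕ) (σ : ℕ → ℝ) : Convex ℝ (Cs k σ) := by
  rintro x ⟨h1, h2⟩ y ⟨g1, g2⟩ a b ha hb hab
  constructor
  · intro i
    have := mul_nonneg ha (h1 i)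
    have := mul_nonneg hb (g1 i)
    simp only [Pi.add_apply, Pi.smul_apply, smul_eq_mul]
    linarith
  · have : ∀ i : Fin (k+1), σ i * (a • x + b • y) i = a * (σ i * x i) + b * (σ i * y i) := by
      intro i
      simp only [Pi.add_apply, Pi.smul_apply, smul_eq_mul]; ring
    rw [Finset.sum_congr rfl (fun i _ => this i), Finset.sum_add_distrib, ← Finset.mul_sum, ← Finset.mul_sum, h2, g2]
    linarith

lemma Cs_Ks {k : ℕ} {σ : ℕ → ℝ} (hσ : Sg σ) : Cs k σ ⊆ Ks k := by
  rintro x ⟨h1, h2⟩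
  show _ = _
  rw [← h2]
  refine Finset.sum_congr rfl (fun i _ => ?_)
  rw [← abs_of_nonneg (h1 i), abs_mul]
  rcases hσ i with h | h <;> simp [h]

lemma Ks_le {k : ℕ} {x : Fin (k+1) → ℝ} (hx : x ∈ Ks k) : ‖x‖ ≤ 1 := by
  rw [pi_norm_le_iff_of_nonneg zero_le_one]
  intro i
  have hx' : ∑ i, |x i| = 1 := hx
  rw [Real.norm_eq_abs, ← hx']
  exact Finset.single_le_sum (f := fun i => |x i|) (fun _ _ => abs_nonneg _) (Finset.mem_univ i)

def D0 (k d : ℕ) : Set (Multiset (Fin (k+1) → ℝ)) :=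
  {s | ∃ σ, Sg σ ∧ s.card = d + 1 ∧ ∀ x ∈ s, ∃ i ≤ d, x = σ i • ee k i}

lemma cc_supp (k d : ℕ) : cc k d ∈ Finsupp.supported (ZMod 2) (ZMod 2) (D0 k d) := by
  induction d with
  | zero =>
    apply Finsupp.single_mem_supported
    exact ⟨fun _ => 1, fun _ => Or.inl rfl, by simp, by simp⟩
  | succ d ih =>
    have h1 : Tm (cc k d) ∈ Finsupp.supported (ZMod 2) (ZMod 2) (D0 k d) := by
      refine sup_map _ ?_ ih
      rintro s ⟨σ, h1, h2, h3⟩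
      rw [Tm_single]
      apply Finsupp.single_mem_supported
      refine ⟨fun i => - σ i, fun i => by rcases h1 i with h | h <;> simp [h], by simpa using h2, ?_⟩
      intro x hx
      obtain ⟨y, hy, rfl⟩ := Multiset.mem_map.1 hx
      obtain ⟨i, hi, rfl⟩ := h3 y hy
      exact ⟨i, hi, by simp⟩
    refine sup_map (cone (ee k (d+1))) ?_ (Submodule.add_mem _ ih h1)
    rintro s ⟨σ, h1, h2, h3⟩
    rw [cone_single]
    apply Finsupp.single_mem_supported
    refine ⟨Function.update σ (d+1) 1, ?_, by simpa using h2, ?_⟩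
    · intro i
      by_cases h : i = d + 1
      · subst h; simp
      · simpa [h] using h1 i
    · intro x hx
      rcases Multiset.mem_cons.1 hx with rfl | hx
      · exact ⟨d+1, le_rfl, by simp⟩
      · obtain ⟨i, hi, rfl⟩ := h3 x hx
        refine ⟨i, by omega, ?_⟩
        rw [Function.update_of_ne (by omega)]

lemma ee_Cs {k i : ℕ} (hi : i ≤ k) {σ : ℕ → ℝ} (hσ : Sg σ) : σ i • ee k i ∈ Cs k σ := by
  have hs : σ i * σ i = 1 := by rcases hσ i with h | h <;> simp [h]
  constructor
  · intro j
    simp only [Pi.smul_apply, smul_eq_mul, ee]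
    split_ifs with h
    · rw [h, mul_one, hs]; exact zero_le_one
    · simp
  · rw [Finset.sum_eq_single ⟨i, by omega⟩]
    · simp [ee, hs]
    · intro j _ hj
      have : j.val ≠ i := fun h => hj (Fin.ext h)
      simp [ee, this]
    · simp

def Cm (k d m : ℕ) : Ch (Fin (k+1) → ℝ) := (sd (d+1))^[m] (cc k d)

lemma Cm_supp {k d : ℕ} (hd : d ≤ k) (m : ℕ) :
    Cm k d m ∈ Finsupp.supported (ZMod 2) (ZMod 2) (DD k d ((1 - 1 / (k+1 : ℕ))^m * 2)) := by
  induction m with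
  | zero =>
    refine Finsupp.supported_mono ?_ (cc_supp k d)
    rintro s ⟨σ, h1, h2, h3⟩
    have h4 : ∀ x ∈ s, x ∈ Cs k σ := by
      intro x hx
      obtain ⟨i, hi, rfl⟩ := h3 x hx
      exact ee_Cs (hi.trans hd) h1
    refine ⟨σ, h1, h2, h4, ?_⟩
    intro x hx y hy
    rw [dist_eq_norm]
    have := norm_sub_le x y
    have := Ks_le (Cs_Ks h1 (h4 x hx))
    have := Ks_le (Cs_Ks h1 (h4 y hy))
    simp only [pow_zero]
    linarith
  | succ m ih =>
    rw [Cm, Function.iterate_succ_apply']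
    refine sup_map _ ?_ ih
    rintro s ⟨σ, h1, h2⟩
    have := sd_supp (K := k+1) (by omega) (d+1) (Cs k σ) (Cs_convex k σ) (by omega) _ (Finsupp.single_mem_supported (ZMod 2) (1 : ZMod 2) h2)
    refine Finsupp.supported_mono ?_ this
    intro t ht
    refine ⟨σ, h1, ?_⟩
    rw [pow_succ', mul_assoc]
    exact ht

lemma bd_it (k d : ℕ) (m : ℕ) : ∀ z : Ch (Fin (k+1) → ℝ), bd ((sd (d+1))^[m] z) = (sd d)^[m] (bd z) := by
  induction m with
  | zero => intro z; rfl
  | succ m ih => intro z; rw [Function.iterate_succ_apply, ih, bd_sd, Function.iterate_succ_apply]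

lemma Tm_it (k d : ℕ) (m : ℕ) : ∀ z : Ch (Fin (k+1) → ℝ), Tm ((sd d)^[m] z) = (sd d)^[m] (Tm z) := by
  induction m with
  | zero => intro z; rfl
  | succ m ih => intro z; rw [Function.iterate_succ_apply, ih, Tm_sd, Function.iterate_succ_apply]

lemma bd_Cm0 (k m : ℕ) : bd (Cm k 0 m) = Finsupp.single 0 1 := by
  rw [Cm, bd_it, bd_cc0]
  induction m with
  | zero => rfl
  | succ m ih => rw [Function.iterate_succ_apply', ih]; rfl

lemma bd_Cm (k d m : ℕ) : bd (Cm k (d+1) m) = Cm k d m + Tm (Cm k d m) := by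
  rw [Cm, bd_it, (bd_cc_inv k d).2, Cm, Tm_it, ← Module.End.pow_apply, map_add, Module.End.pow_apply, Module.End.pow_apply]

lemma ls_core {k : ℕ} {l : (Fin (k+1) → ℝ) → ℕ × Bool} {ε : ℝ} (hε : 0 < ε)
    (h1 : ∀ x ∈ Ks k, (l x).1 < k ∧ l (-x) = fl (l x))
    (h2 : ∀ x ∈ Ks k, ∀ y ∈ Ks k, dist x y ≤ ε → l x ≠ fl (l y)) : False := by
  obtain ⟨m, hm⟩ := exists_pow_lt_of_lt_one (show 0 < ε / 2 by positivity) (show 1 - 1 / ((k+1 : ℕ) : ℝ) < 1 by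
    have : 0 < 1 / ((k+1 : ℕ) : ℝ) := by positivity
    linarith)
  have hg : ∀ d ≤ k, ∀ s ∈ DD k d ((1 - 1 / (k+1 : ℕ))^m * 2), s ≠ 0 ∧ (∀ x ∈ s, (l x).1 < k ∧ l (-x) = fl (l x)) ∧ ∀ x ∈ s, ∀ y ∈ s, l x ≠ fl (l y) := by
    rintro d hd s ⟨σ, g1, g2, g3, g4⟩
    refine ⟨by rintro rfl; simp at g2, fun x hx => h1 x (Cs_Ks g1 (g3 x hx)), fun x hx y hy => ?_⟩
    refine h2 x (Cs_Ks g1 (g3 x hx)) y (Cs_Ks g1 (g3 y hy)) ((g4 x hx y hy).trans ?_)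
    linarith
  have hev : ∀ d ≤ k, ev k l (Cm k d m + Tm (Cm k d m)) = 1 := by
    intro d
    induction d with
    | zero =>
      intro h
      rw [← ev_bd (hg 0 h) (Cm_supp h m), bd_Cm0, ev_single, Multiset.map_zero, BB_zero]
    | succ d ih =>
      intro h
      rw [← ev_bd (hg _ h) (Cm_supp h m), bd_Cm, ih (by omega)]
  have h0 : ev k l (Cm k k m + Tm (Cm k k m)) = 0 := by
    refine lin_on (ev k l ∘ₗ (LinearMap.id + Tm)) 0 (fun s hs => ?_) (Cm_supp (le_refl k) m)
    obtain ⟨σ, g1, g2, -⟩ := hs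
    simp only [LinearMap.comp_apply, LinearMap.add_apply, LinearMap.id_apply, map_add, LinearMap.zero_apply]
    rw [Tm_single, ev_single, ev_single, BB_card _ _ _ (by simp [g2]), BB_card _ _ _ (by simp [g2]), add_zero]
  have := hev k le_rfl
  rw [h0] at this
  exact absurd this (by decide)

end cross

section ls
open Classical

lemma LS {k : ℕ} (U : ℕ → Set (Fin (k+1) → ℝ)) (hU : ∀ j, IsOpen (U j)) (hd : ∀ j, ∀ x ∈ U j, -x ∉ U j) :
    ∃ x : Fin (k+1) → ℝ, x ≠ 0 ∧ ∀ j < k, x ∉ U j ∧ -x ∉ U j := by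
  by_contra hcon
  push Not at hcon
  let c : ℕ → Bool → Set (Fin (k+1) → ℝ) := fun j b => if b then U j else {x | -x ∈ U j}
  have hdis : ∀ j b x, x ∈ c j b → x ∉ c j (!b) := by
    rintro j (_|_) x h h'
    · exact hd j x h' h
    · exact hd j x h h'
  have hneg : ∀ j b x, -x ∈ c j b ↔ x ∈ c j (!b) := by
    rintro j (_|_) x <;> simp [c]
  have hKc : IsCompact (Ks k) := by
    refine Metric.isCompact_of_isClosed_isBounded (isClosed_eq (by fun_prop) continuous_const) ?_
    exact (Metric.isBounded_closedBall (x := 0) (r := 1)).subset (fun x hx => by simpa using Ks_le hx)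
  obtain ⟨δ, hδ, hL⟩ := lebesgue_number_lemma_of_metric (c := fun i : Fin k × Bool => c i.1 i.2) hKc (by
    rintro ⟨i, _|_⟩
    · exact (hU i).preimage continuous_neg
    · exact hU i) (by
    intro x hx
    have hx0 : x ≠ 0 := by
      rintro rfl
      simp [Ks] at hx
    obtain ⟨j, hj, h⟩ := hcon x hx0
    rw [mem_iUnion]
    by_cases h' : x ∈ U j
    · exact ⟨(⟨j, hj⟩, true), h'⟩
    · exact ⟨(⟨j, hj⟩, false), h h'⟩)
  let P : (Fin (k+1) → ℝ) → ℕ → Bool → Prop := fun x j b => Metric.ball x δ ⊆ c j b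
  have hPn : ∀ x j b, P (-x) j b ↔ P x j (!b) := by
    intro x j b
    constructor
    · intro h y hy
      rw [← hneg]
      apply h
      rw [Metric.mem_ball] at hy ⊢
      rwa [dist_neg_neg]
    · intro h y hy
      rw [← neg_neg y, hneg]
      apply h
      rw [Metric.mem_ball] at hy ⊢
      rwa [← dist_neg_neg, neg_neg]
  have hPd : ∀ x y j b, dist x y < δ → P x j b → ¬ P y j (!b) := by
    intro x y j b h h1 h2
    exact hdis j b y (h1 (by rw [Metric.mem_ball, dist_comm]; exact h)) (h2 (Metric.mem_ball_self hδ))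
  let N : (Fin (k+1) → ℝ) → Set ℕ := fun x => {j | ∃ b, P x j b}
  have hNn : ∀ x, N (-x) = N x := by
    intro x
    ext j
    constructor
    · rintro ⟨b, h⟩; exact ⟨!b, (hPn x j b).1 h⟩
    · rintro ⟨b, h⟩; exact ⟨!b, (hPn x j _).2 (by simpa using h)⟩
  let l : (Fin (k+1) → ℝ) → ℕ × Bool := fun x => (sInf (N x), decide (P x (sInf (N x)) true))
  have hl : ∀ x ∈ Ks k, (l x).1 < k ∧ P x (l x).1 (l x).2 := by
    intro x hx
    obtain ⟨⟨i, b⟩, hi⟩ := hL x hx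
    have hne : (i : ℕ) ∈ N x := ⟨b, hi⟩
    refine ⟨lt_of_le_of_lt (Nat.sInf_le hne) i.2, ?_⟩
    obtain ⟨b', hb'⟩ := Nat.sInf_mem ⟨_, hne⟩
    show P x (sInf (N x)) (decide (P x (sInf (N x)) true))
    by_cases h : P x (sInf (N x)) true
    · simpa [h] using h
    · cases b'
      · simpa [h] using hb'
      · exact absurd hb' h
  have hKn : ∀ x ∈ Ks k, -x ∈ Ks k := by
    intro x hx
    simpa [Ks] using hx
  refine ls_core (k := k) (l := l) (ε := δ / 2) (by positivity) ?_ ?_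
  · intro x hx
    refine ⟨(hl x hx).1, ?_⟩
    have e1 : (l (-x)).1 = (l x).1 := by show sInf _ = sInf _; rw [hNn]
    have h1 := (hl x hx).2
    have h2 := (hl _ (hKn x hx)).2
    rw [hPn, e1] at h2
    refine Prod.ext e1 ?_
    show _ = !(l x).2
    by_contra hne
    have : (l (-x)).2 = (l x).2 := by
      revert hne; cases (l (-x)).2 <;> cases (l x).2 <;> simp
    rw [this] at h2
    exact hPd x x _ _ (by simpa using hδ) h1 h2
  · intro x hx y hy hxy he
    have h1 := (hl x hx).2
    have h2 := (hl y hy).2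
    rw [he] at h1
    exact hPd y x _ _ (by rw [dist_comm]; linarith) h2 h1

lemma ham {X : Type*} {k : ℕ} (φ : Fin (k+1) → X → ℝ) (T : ℕ → Finset X) :
    ∃ a : Fin (k+1) → ℝ, a ≠ 0 ∧ ∀ j < k,
      2 * ((T j).filter (fun x => 0 < ∑ i, a i * φ i x)).card ≤ (T j).card ∧
      2 * ((T j).filter (fun x => ∑ i, a i * φ i x < 0)).card ≤ (T j).card := by
  have hneg : ∀ (a : Fin (k+1) → ℝ) x, ∑ i, (-a) i * φ i x = - ∑ i, a i * φ i x := by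
    intro a x
    simp [Finset.sum_neg_distrib]
  obtain ⟨a, h0, h⟩ := LS (k := k) (fun j => {a | (T j).card < 2 * ((T j).filter (fun x => 0 < ∑ i, a i * φ i x)).card}) (by
    intro j
    rw [isOpen_iff_mem_nhds]
    intro a ha
    have h1 : ∀ x ∈ (T j).filter (fun x => 0 < ∑ i, a i * φ i x), ∀ᶠ b in nhds a, 0 < ∑ i, b i * φ i x := by
      intro x hx
      have hc : Continuous (fun b : Fin (k+1) → ℝ => ∑ i, b i * φ i x) := by fun_prop
      exact hc.continuousAt.eventually (lt_mem_nhds (Finset.mem_filter.1 hx).2)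
    have h2 := (Filter.eventually_all_finset _).2 h1
    filter_upwards [h2] with b hb
    refine lt_of_lt_of_le ha (Nat.mul_le_mul_left _ (Finset.card_le_card ?_))
    intro x hx
    exact Finset.mem_filter.2 ⟨(Finset.mem_filter.1 hx).1, hb x hx⟩) (by
    intro j a ha hb
    have ha' : (T j).card < 2 * ((T j).filter (fun x => 0 < ∑ i, a i * φ i x)).card := ha
    have hb' : (T j).card < 2 * ((T j).filter (fun x => 0 < ∑ i, (-a) i * φ i x)).card := hb
    have hdj : Disjoint ((T j).filter (fun x => 0 < ∑ i, a i * φ i x)) ((T j).filter (fun x => 0 < ∑ i, (-a) i * φ i x)) := by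
      rw [Finset.disjoint_filter]
      intro x _ h1 h2
      rw [hneg] at h2
      linarith
    have := Finset.card_union_of_disjoint hdj
    have := Finset.card_le_card (Finset.union_subset (Finset.filter_subset (fun x => 0 < ∑ i, a i * φ i x) (T j)) (Finset.filter_subset (fun x => 0 < ∑ i, (-a) i * φ i x) (T j)))
    omega)
  refine ⟨a, h0, fun j hj => ?_⟩
  obtain ⟨h1, h2⟩ := h j hj
  refine ⟨not_lt.1 h1, ?_⟩
  have h3 : 2 * ((T j).filter (fun x => 0 < ∑ i, (-a) i * φ i x)).card ≤ (T j).card := not_lt.1 h2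
  simpa only [hneg, neg_pos] using h3

end ls

section part
open Classical

lemma hampoly {n : ℕ} (V : Set (Fin n → ℂ)) {k m : ℕ} (hk : k + 1 ≤ hilbert n V m) (T : ℕ → Finset (Fin n → ℝ)) :
    ∃ f : MvPolynomial (Fin n) ℝ, f.totalDegree ≤ m ∧ f ∉ vanishingIdealR n V ∧ ∀ j < k,
      2 * ((T j).filter (fun x => 0 < eval x f)).card ≤ (T j).card ∧
      2 * ((T j).filter (fun x => eval x f < 0)).card ≤ (T j).card := by
  rw [hilbert_ncard] at hk
  haveI := (stdLe_fin V m).fintype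
  rw [← Nat.card_coe_set_eq, Nat.card_eq_fintype_card] at hk
  obtain ⟨e⟩ : Nonempty (Fin (k+1) ↪ StdLe V m) := Function.Embedding.nonempty_of_card_le (by simpa using hk)
  obtain ⟨a, h0, h⟩ := ham (k := k) (fun i x => eval x (monomial (ofDegLex (e i).1) (1 : ℝ))) T
  have hev : ∀ x, eval x (∑ i, a i • monomial (ofDegLex (e i).1) (1 : ℝ)) = ∑ i, a i * eval x (monomial (ofDegLex (e i).1) (1 : ℝ)) := by
    intro x
    rw [map_sum]
    exact Finset.sum_congr rfl (fun i _ => by rw [smul_eval])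
  refine ⟨∑ i, a i • monomial (ofDegLex (e i).1) (1 : ℝ), ?_, ?_, ?_⟩
  · apply totalDegree_finsetSum_le
    intro i _
    refine (totalDegree_smul_le _ _).trans ?_
    rw [totalDegree_monomial _ one_ne_zero]
    exact (e i).2.2
  · intro hf
    have hf' : MvPolynomial.map (algebraMap ℝ ℂ) (∑ i, a i • monomial (ofDegLex (e i).1) (1 : ℝ)) ∈ vanishingIdeal n V := hf
    have h1 : MvPolynomial.map (algebraMap ℝ ℂ) (∑ i, a i • monomial (ofDegLex (e i).1) (1 : ℝ)) = ∑ i, (a i : ℂ) • monomial (ofDegLex (e i).1) (1 : ℂ) := by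
      rw [map_sum]
      refine Finset.sum_congr rfl (fun i _ => ?_)
      simp [smul_monomial, map_monomial]
    rw [h1, ← Ideal.Quotient.eq_zero_iff_mem] at hf'
    have h2 : ∑ i, (a i : ℂ) • mon V (e i).1 = 0 := by
      rw [← hf', map_sum]
      rfl
    have hli := (stdLe_indep V m).comp e e.injective
    rw [Fintype.linearIndependent_iff] at hli
    apply h0
    funext i
    have := hli (fun i => (a i : ℂ)) h2 i
    simpa using this
  · intro j hj
    simp only [hev]
    exact h j hj

def sgn (b : Bool) : ℝ := if b then 1 else -1

lemma partition {n : ℕ} (V : Set (Fin n → ℂ)) (S : Finset (Fin n → ℝ)) (m : ℕ → ℕ) (J : ℕ)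
    (hm : ∀ j < J, 2 ^ j + 1 ≤ hilbert n V (m j)) :
    ∃ F : ℕ → MvPolynomial (Fin n) ℝ, (∀ j < J, (F j).totalDegree ≤ m j ∧ F j ∉ vanishingIdealR n V) ∧
      ∀ σ : ℕ → Bool, 2 ^ J * (S.filter (fun x => ∀ j < J, 0 < sgn (σ j) * eval x (F j))).card ≤ S.card := by
  induction J with
  | zero => exact ⟨fun _ => 0, by simp, fun σ => by simp⟩
  | succ J ih =>
    obtain ⟨F, h1, h2⟩ := ih (fun j hj => hm j (by omega))
    obtain ⟨f, g1, g2, g3⟩ := hampoly V (hm J (by omega)) (fun c => S.filter (fun x => ∀ j < J, 0 < sgn (c.testBit j) * eval x (F j)))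
    refine ⟨Function.update F J f, ?_, ?_⟩
    · intro j hj
      rcases eq_or_ne j J with rfl | h
      · simpa using ⟨g1, g2⟩
      · rw [Function.update_of_ne h]; exact h1 j (by omega)
    · intro σ
      obtain ⟨c, hc, hcb⟩ : ∃ c < 2 ^ J, ∀ j < J, c.testBit j = σ j :=
        ⟨Nat.ofBits (fun i : Fin J => σ i), Nat.ofBits_lt_two_pow _, fun j hj => by rw [Nat.testBit_ofBits_lt _ _ hj]⟩
      have h3 := g3 c hc
      have e1 : S.filter (fun x => ∀ j < J, 0 < sgn (c.testBit j) * eval x (F j)) = S.filter (fun x => ∀ j < J, 0 < sgn (σ j) * eval x (F j)) := by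
        apply Finset.filter_congr
        intro x _
        constructor
        · intro h j hj; rw [← hcb j hj]; exact h j hj
        · intro h j hj; rw [hcb j hj]; exact h j hj
      rw [e1] at h3
      have h4 := h2 σ
      have h5 : 2 * (S.filter (fun x => ∀ j < J + 1, 0 < sgn (σ j) * eval x (Function.update F J f j))).card ≤ (S.filter (fun x => ∀ j < J, 0 < sgn (σ j) * eval x (F j))).card := by
        have hsub : ∀ x, (∀ j < J + 1, 0 < sgn (σ j) * eval x (Function.update F J f j)) → (∀ j < J, 0 < sgn (σ j) * eval x (F j)) ∧ 0 < sgn (σ J) * eval x f := by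
          intro x h
          refine ⟨fun j hj => ?_, ?_⟩
          · have := h j (by omega)
            rwa [Function.update_of_ne (by omega)] at this
          · simpa using h J (by omega)
        cases hs : σ J
        · refine le_trans (Nat.mul_le_mul_left _ (Finset.card_le_card ?_)) h3.2
          intro x hx
          rw [Finset.mem_filter] at hx
          obtain ⟨q1, q2⟩ := hsub x hx.2
          refine Finset.mem_filter.2 ⟨Finset.mem_filter.2 ⟨hx.1, q1⟩, ?_⟩
          simpa [hs, sgn] using q2
        · refine le_trans (Nat.mul_le_mul_left _ (Finset.card_le_card ?_)) h3.1
          intro x hx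
          rw [Finset.mem_filter] at hx
          obtain ⟨q1, q2⟩ := hsub x hx.2
          refine Finset.mem_filter.2 ⟨Finset.mem_filter.2 ⟨hx.1, q1⟩, ?_⟩
          simpa [hs, sgn] using q2
      calc _ = 2 ^ J * (2 * (S.filter (fun x => ∀ j < J + 1, 0 < sgn (σ j) * eval x (Function.update F J f j))).card) := by rw [pow_succ, mul_assoc]
        _ ≤ _ := (Nat.mul_le_mul_left _ h5).trans h4

lemma comp_cell {n : ℕ} (F : ℕ → MvPolynomial (Fin n) ℝ) (J : ℕ) (S : Finset (Fin n → ℝ)) (x : Fin n → ℝ)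
    (hx : x ∉ zeroSetR n (∏ j ∈ Finset.range J, F j)) : ∃ σ : ℕ → Bool,
    (↑S : Set (Fin n → ℝ)) ∩ connectedComponentIn (zeroSetR n (∏ j ∈ Finset.range J, F j))ᶜ x ⊆
      ↑(S.filter (fun x => ∀ j < J, 0 < sgn (σ j) * eval x (F j))) := by
  have hnz : ∀ y, y ∈ (zeroSetR n (∏ j ∈ Finset.range J, F j))ᶜ → ∀ j < J, eval y (F j) ≠ 0 := by
    intro y hy j hj h
    apply hy
    show eval y _ = 0
    rw [map_prod]
    exact Finset.prod_eq_zero (Finset.mem_range.2 hj) h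
  refine ⟨fun j => decide (0 < eval x (F j)), ?_⟩
  rintro y ⟨hyS, hy⟩
  rw [Finset.mem_coe, Finset.mem_filter]
  refine ⟨hyS, fun j hj => ?_⟩
  have hxc := mem_connectedComponentIn (show x ∈ (zeroSetR n (∏ j ∈ Finset.range J, F j))ᶜ from hx)
  have hsub := connectedComponentIn_subset (zeroSetR n (∏ j ∈ Finset.range J, F j))ᶜ x
  have hpc : IsPreconnected (connectedComponentIn (zeroSetR n (∏ j ∈ Finset.range J, F j))ᶜ x) := isPreconnected_connectedComponentIn
  have hc : Continuous (fun y => eval y (F j)) := MvPolynomial.continuous_eval _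
  have hno : ∀ a ∈ connectedComponentIn (zeroSetR n (∏ j ∈ Finset.range J, F j))ᶜ x, ∀ b ∈ connectedComponentIn (zeroSetR n (∏ j ∈ Finset.range J, F j))ᶜ x,
      ¬ (eval a (F j) < 0 ∧ 0 < eval b (F j)) := by
    rintro a ha b hb ⟨h1, h2⟩
    obtain ⟨z, hz, hz0⟩ := hpc.intermediate_value ha hb hc.continuousOn ⟨h1.le, h2.le⟩
    exact hnz z (hsub hz) j hj hz0
  have hy0 := hnz y (hsub hy) j hj
  have hx0 := hnz x hx j hj
  by_cases h : 0 < eval x (F j)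
  · have := hno y hy x hxc
    have : 0 < eval y (F j) := lt_of_le_of_ne (not_lt.1 (fun h' => this ⟨h', h⟩)) hy0.symm
    simpa [h, sgn] using this
  · have := hno x hxc y hy
    have : eval y (F j) < 0 := lt_of_le_of_ne (not_lt.1 (fun h' => this ⟨lt_of_le_of_ne (not_lt.1 h) hx0, h'⟩)) hy0
    simpa [h, sgn] using this

lemma sum_div (n T : ℕ) (g : ℕ → ℕ) : ∑ i ∈ Finset.range (n * T), g (i / n) = n * ∑ t ∈ Finset.range T, g t := by
  rcases Nat.eq_zero_or_pos n with rfl | hn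
  · simp
  induction T with
  | zero => simp
  | succ T ih =>
    rw [Nat.mul_succ, Finset.sum_range_add, ih, Finset.sum_range_succ, mul_add]
    congr 1
    rw [Finset.sum_congr rfl (fun x hx => by
      rw [Nat.mul_add_div hn, Nat.div_eq_of_lt (Finset.mem_range.1 hx), add_zero])]
    simp

lemma deg_part {n : ℕ} {V : Set (Fin n → ℂ)} (hV : IsIrredVariety n V) (S : Finset (Fin n → ℝ)) (L : ℕ) {A : ℕ} (hA : hilbert n V 1 ≤ A) (hA1 : 1 ≤ A) :
    ∃ g : MvPolynomial (Fin n) ℝ, g.totalDegree ≤ n * 2 ^ (L+1) ∧ g ∉ vanishingIdealR n V ∧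
      ∀ x ∉ zeroSetR n g, ((↑S : Set (Fin n → ℝ)) ∩ connectedComponentIn (zeroSetR n g)ᶜ x).ncard * hilbert n V (2 ^ L) ≤ 2 * A * S.card := by
  set h := hilbert n V (2 ^ L) with hh
  have hpos : 1 ≤ h := hilbert_pos hV.2.1 _
  set J := min (Nat.log 2 h) (n * (L + 1)) with hJ
  have hJ1 : J ≤ Nat.log 2 h := min_le_left _ _
  have hJ2 : J ≤ n * (L + 1) := min_le_right _ _
  have hlog : 2 ^ Nat.log 2 h ≤ h := Nat.pow_log_le_self 2 (by omega)
  have hbig : h ≤ 2 * A * 2 ^ J := by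
    rcases le_total (Nat.log 2 h) (n * (L + 1)) with h1 | h1
    · have : J = Nat.log 2 h := min_eq_left h1
      rw [this]
      have := Nat.lt_pow_succ_log_self (b := 2) (by norm_num) h
      rw [pow_succ] at this
      nlinarith [Nat.one_le_two_pow (n := Nat.log 2 h)]
    · have : J = n * (L + 1) := min_eq_right h1
      rw [this]
      have h2 := hilbert_pow V 1 L
      rw [mul_one, ← pow_mul] at h2
      have h3 : 2 ^ (n * L) ≤ 2 ^ (n * (L + 1)) := Nat.pow_le_pow_right (by norm_num) (by nlinarith)
      calc h ≤ 2 ^ (n * L) * hilbert n V 1 := h2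
        _ ≤ 2 ^ (n * (L+1)) * A := Nat.mul_le_mul h3 hA
        _ ≤ _ := by nlinarith [Nat.zero_le (2 ^ (n * (L+1)) * A)]
  obtain ⟨F, h1, h2⟩ := partition V S (fun j => 2 ^ (L - (J - 1 - j) / n)) J (by
    intro j hj
    have ht : (J - 1 - j) / n ≤ L := by
      apply Nat.le_of_lt_succ
      rw [Nat.div_lt_iff_lt_mul (by by_contra h; have : n = 0 := by omega
                                    rw [this] at hJ2; omega)]
      rw [mul_comm]; show _ < n * (L + 1); omega
    have h3 := hilbert_pow V (2 ^ (L - (J - 1 - j) / n)) ((J - 1 - j) / n)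
    rw [← pow_add, Nat.add_sub_cancel' ht, ← pow_mul] at h3
    have h4 : 2 ^ (n * ((J - 1 - j) / n)) * 2 ^ (j + 1) ≤ 2 ^ Nat.log 2 h := by
      rw [← pow_add]
      apply Nat.pow_le_pow_right (by norm_num)
      have := Nat.mul_div_le (J - 1 - j) n
      omega
    have h5 := Nat.le_of_mul_le_mul_left (h4.trans (hlog.trans h3)) (by positivity)
    rw [pow_succ] at h5
    have := Nat.one_le_two_pow (n := j)
    show 2 ^ j + 1 ≤ hilbert n V (2 ^ (L - (J - 1 - j) / n))
    omega)
  refine ⟨∏ j ∈ Finset.range J, F j, ?_, ?_, ?_⟩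
  · refine (totalDegree_finset_prod _ _).trans ?_
    refine (Finset.sum_le_sum (fun j hj => (h1 j (Finset.mem_range.1 hj)).1)).trans ?_
    rw [Finset.sum_range_reflect (fun i => 2 ^ (L - i / n)) J]
    refine (Finset.sum_le_sum_of_subset (Finset.range_mono hJ2)).trans ?_
    rw [sum_div n (L+1) (fun t => 2 ^ (L - t))]
    apply Nat.mul_le_mul_left
    have := Finset.sum_range_reflect (fun i => 2 ^ i) (L+1)
    simp only [Nat.add_sub_cancel] at this
    rw [this]
    exact (Nat.geomSum_lt (m := 2) (n := L+1) (s := Finset.range (L+1)) le_rfl (fun k hk => Finset.mem_range.1 hk)).le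
  · haveI := vi_prime hV
    haveI : (vanishingIdealR n V).IsPrime := Ideal.comap_isPrime _ _
    intro hg
    obtain ⟨j, hj, h3⟩ := (Ideal.IsPrime.prod_mem_iff (p := vanishingIdealR n V)).1 hg
    exact (h1 j (Finset.mem_range.1 hj)).2 h3
  · intro x hx
    obtain ⟨σ, hσ⟩ := comp_cell F J S x hx
    have h3 := Set.ncard_le_ncard hσ (Finset.finite_toSet _)
    rw [Set.ncard_coe_finset] at h3
    have h4 := h2 σ
    calc _ ≤ (S.filter (fun x => ∀ j < J, 0 < sgn (σ j) * eval x (F j))).card * (2 * A * 2 ^ J) := Nat.mul_le_mul h3 hbig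
      _ = 2 * A * (2 ^ J * (S.filter (fun x => ∀ j < J, 0 < sgn (σ j) * eval x (F j))).card) := by ring
      _ ≤ _ := Nat.mul_le_mul_left _ h4

lemma H1_bound (n : ℕ) : ∃ A : ℕ, 1 ≤ A ∧ ∀ V : Set (Fin n → ℂ), hilbert n V 1 ≤ A := by
  refine ⟨({α : DegLex (Fin n →₀ ℕ) | (ofDegLex α).degree ≤ 1}).ncard + 1, by omega, fun V => ?_⟩
  rw [hilbert_ncard]
  exact (Set.ncard_le_ncard (fun α hα => hα.2) (Finsupp.finite_of_degree_le (σ := Fin n) 1)).trans (Nat.le_succ _)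

end part

/-- Theorem 3.2, polynomial partitioning for varieties: the general form of
the partitioning theorem, valid for every `M ≥ 1`, with the gain `M^{n-i_V(M)} Δ_{i_V(M)}(V)`.
Here `c₀` is the Chardin–Philippon constant and `c₁` is chosen so that every positive integer
lies in an interval `ℛ_i(V)` with `i` admissible. -/
theorem statement8 (n : ℕ) (c0 c1 : ℝ) (hc0 : 0 < c0) (hc1 : 0 < c1)
    (hCP : ChardinPhilippon n c0) (hcov : CoversPositiveIntegers n c0 c1) :
    ∃ C : ℝ, 0 < C ∧
      ∀ (V : Set (Fin n → ℂ)) (d : ℕ), IsIrredVariety n V → dim n V = d →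
        ∀ S : Finset (Fin n → ℝ), (∀ x ∈ S, toC n x ∈ V) →
          ∀ M : ℕ, 1 ≤ M →
            ∃ g : MvPolynomial (Fin n) ℝ,
              (g.totalDegree : ℝ) ≤ C * (M : ℝ) ∧
              g ∉ vanishingIdealR n V ∧
              ∀ x ∉ zeroSetR n g,
                (((↑S : Set (Fin n → ℝ)) ∩ connectedComponentIn (zeroSetR n g)ᶜ x).ncard : ℝ) ≤
                  C * (S.card : ℝ) /
                    ((M : ℝ) ^ (n - iV n c0 c1 V M) * Delta n V (iV n c0 c1 V M)) := by
  obtain ⟨C, c, hC, hc, hlb⟩ := lb_main hc0 hc1 hCP hcov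
  obtain ⟨A, hA1, hA⟩ := H1_bound n
  refine ⟨4 * n * C + 2 * A / c + 1, by positivity, ?_⟩
  intro V d hV _ S _ M hM
  have hCM : C * M ≠ 0 := Nat.mul_ne_zero (by omega) (by omega)
  obtain ⟨g, h1, h2, h3⟩ := deg_part hV S (Nat.log 2 (C * M) + 1) (hA V) hA1
  refine ⟨g, ?_, h2, ?_⟩
  · have e1 := Nat.pow_log_le_self 2 hCM
    have e2 : g.totalDegree ≤ 4 * n * C * M := by
      refine h1.trans ?_
      rw [pow_succ, pow_succ]
      nlinarith
    have e3 : (g.totalDegree : ℝ) ≤ 4 * n * C * M := by exact_mod_cast e2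
    refine e3.trans ?_
    have : 0 ≤ (2 * (A:ℝ) / c + 1) * M := by positivity
    nlinarith
  · intro x hx
    have hQ : 0 < (M : ℝ) ^ (n - iV n c0 c1 V M) * Delta n V (iV n c0 c1 V M) :=
      mul_pos (pow_pos (by exact_mod_cast hM) _) (Delta_pos _ _)
    have e1 := hlb V hV M hM
    have e2 : hilbert n V (C * M) ≤ hilbert n V (2 ^ (Nat.log 2 (C * M) + 1)) :=
      hilbert_mono V (Nat.lt_pow_succ_log_self (by norm_num) _).le
    have e3 := h3 x hx
    set N := ((↑S : Set (Fin n → ℝ)) ∩ connectedComponentIn (zeroSetR n g)ᶜ x).ncard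
    set Q := (M : ℝ) ^ (n - iV n c0 c1 V M) * Delta n V (iV n c0 c1 V M)
    have e4 : (N : ℝ) * hilbert n V (2 ^ (Nat.log 2 (C * M) + 1)) ≤ 2 * A * S.card := by exact_mod_cast e3
    have e5 : c * Q ≤ hilbert n V (2 ^ (Nat.log 2 (C * M) + 1)) := e1.trans (by exact_mod_cast e2)
    have e6 : (N : ℝ) * (c * Q) ≤ 2 * A * S.card := (mul_le_mul_of_nonneg_left e5 (by positivity)).trans e4
    rw [le_div_iff₀ hQ]
    have e7 : (N : ℝ) * Q ≤ 2 * A / c * S.card := by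
      rw [div_mul_eq_mul_div, le_div_iff₀ hc]
      linarith
    have : 0 ≤ (4 * (n:ℝ) * C + 1) * S.card := by positivity
    nlinarith

end Paper
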